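/- Assume conditions (i), (ii), (iii). For every subdomain Ω′ ⊂⊂ Ω there exists a constant C, depending only on dist(Ω′, ∂Ω) and X_1,…,X_m, such that every u ∈ C²(Ω) ∩ L¹(Ω) that is 2-convex with respect to X satisfies ∫_{Ω′} 𝓕_2[u] ≤ C ( ∫_Ω |u| )². In particular ∫_{Ω′} Σ_{i<j} ([X_i,X_j]u)² ≤ C ( ∫_Ω |u| )². -/

import Mathlib

open MeasureTheory Filter Topology

noncomputable section

/-- Action of a first-order vector field with coefficient vector `c` on a function `u`:
`(Xu)(x) = ∑ j c(x)_j D_j u(x) = Du(x)·c(x)`. -/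
def Xop {n : ℕ} (c : (Fin n → ℝ) → (Fin n → ℝ)) (u : (Fin n → ℝ) → ℝ)
    (x : Fin n → ℝ) : ℝ :=
  fderiv ℝ u x (c x)

/-- Lie bracket of the coefficient vector fields `c`, `d`. -/
def vfBracket {n : ℕ} (c d : (Fin n → ℝ) → (Fin n → ℝ)) (x : Fin n → ℝ) :
    Fin n → ℝ :=
  fun l => fderiv ℝ (fun y => d y l) x (c x) - fderiv ℝ (fun y => c y l) x (d x)

/-- The sub-Laplacian `Δ_X u = ∑ i X_i X_i u`. -/
def subLap {n m : ℕ} (b : Fin m → (Fin n → ℝ) → (Fin n → ℝ))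
    (u : (Fin n → ℝ) → ℝ) (x : Fin n → ℝ) : ℝ :=
  ∑ i, Xop (b i) (Xop (b i) u) x

/-- The commutator `[X_i, X_j] u = X_i X_j u - X_j X_i u`. -/
def commOp {n m : ℕ} (b : Fin m → (Fin n → ℝ) → (Fin n → ℝ)) (i j : Fin m)
    (u : (Fin n → ℝ) → ℝ) (x : Fin n → ℝ) : ℝ :=
  Xop (b i) (Xop (b j) u) x - Xop (b j) (Xop (b i) u) x

/-- The symmetric Hessian `X_s² u = [½ (X_i X_j + X_j X_i) u]`. -/
def symmHess {n m : ℕ} (b : Fin m → (Fin n → ℝ) → (Fin n → ℝ))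
    (u : (Fin n → ℝ) → ℝ) (x : Fin n → ℝ) : Matrix (Fin m) (Fin m) ℝ :=
  fun i j => (Xop (b i) (Xop (b j) u) x + Xop (b j) (Xop (b i) u) x) / 2

theorem symmHess_isHermitian {n m : ℕ} (b : Fin m → (Fin n → ℝ) → (Fin n → ℝ))
    (u : (Fin n → ℝ) → ℝ) (x : Fin n → ℝ) : (symmHess b u x).IsHermitian := by
  unfold Matrix.IsHermitian
  ext i j
  simp only [Matrix.conjTranspose_apply, symmHess, star_trivial]
  ring

/-- Eigenvalues of the symmetric Hessian. -/
def hessEig {n m : ℕ} (b : Fin m → (Fin n → ℝ) → (Fin n → ℝ))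
    (u : (Fin n → ℝ) → ℝ) (x : Fin n → ℝ) : Fin m → ℝ :=
  (symmHess_isHermitian b u x).eigenvalues

/-- `k`-th elementary symmetric function of `m` real numbers. -/
def esymmF {m : ℕ} (k : ℕ) (lam : Fin m → ℝ) : ℝ :=
  ∑ s ∈ Finset.powersetCard k (Finset.univ : Finset (Fin m)), ∏ i ∈ s, lam i

/-- `S_{j,i}(λ)`: the `j`-th elementary symmetric function with the variable `λ_i` set to `0`. -/
def esymmDrop {m : ℕ} (j : ℕ) (i : Fin m) (lam : Fin m → ℝ) : ℝ :=
  ∑ s ∈ Finset.powersetCard j ((Finset.univ : Finset (Fin m)).erase i), ∏ l ∈ s, lam l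

/-- `u` is `k`-convex with respect to the vector fields `b` on `Ω`:
`S_j(λ(X_s²u)) ≥ 0` on `Ω` for `j = 1, …, k`. -/
def IsKConvex {n m : ℕ} (Ω : Set (Fin n → ℝ)) (b : Fin m → (Fin n → ℝ) → (Fin n → ℝ))
    (k : ℕ) (u : (Fin n → ℝ) → ℝ) : Prop :=
  ∀ x ∈ Ω, ∀ j, 1 ≤ j → j ≤ k → 0 ≤ esymmF j (hessEig b u x)

/-- `F_2[u] = S_2(λ(X_s²u))`. -/
def F2fun {n m : ℕ} (b : Fin m → (Fin n → ℝ) → (Fin n → ℝ))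
    (u : (Fin n → ℝ) → ℝ) (x : Fin n → ℝ) : ℝ :=
  esymmF 2 (hessEig b u x)

/-- `𝓔_2[u] = ∑_{i<j} ([X_i,X_j]u)²`. -/
def E2fun {n m : ℕ} (b : Fin m → (Fin n → ℝ) → (Fin n → ℝ))
    (u : (Fin n → ℝ) → ℝ) (x : Fin n → ℝ) : ℝ :=
  ∑ i : Fin m, ∑ j ∈ Finset.Ioi i, (commOp b i j u x) ^ 2

/-- `𝓕_2[u] = F_2[u] + (3/4) 𝓔_2[u]`. -/
def calF2 {n m : ℕ} (b : Fin m → (Fin n → ℝ) → (Fin n → ℝ))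
    (u : (Fin n → ℝ) → ℝ) (x : Fin n → ℝ) : ℝ :=
  F2fun b u x + (3 / 4) * E2fun b u x

/-- `|Xu|(x)`, the length of the subelliptic gradient. -/
def XgradNorm {n m : ℕ} (b : Fin m → (Fin n → ℝ) → (Fin n → ℝ))
    (u : (Fin n → ℝ) → ℝ) (x : Fin n → ℝ) : ℝ :=
  Real.sqrt (∑ i, (Xop (b i) u x) ^ 2)

/-- Condition (i): each `X_i` is divergence free, i.e. anti-self-adjoint. -/
def DivFree {n m : ℕ} (Ω : Set (Fin n → ℝ))
    (b : Fin m → (Fin n → ℝ) → (Fin n → ℝ)) : Prop :=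
  ∀ i : Fin m, ∀ x ∈ Ω, ∑ j, fderiv ℝ (fun y => b i y j) x (Pi.single j 1) = 0

/-- The set of iterated Lie brackets generated by the fields `b`. -/
inductive LieGen {n m : ℕ} (b : Fin m → (Fin n → ℝ) → (Fin n → ℝ)) :
    ((Fin n → ℝ) → (Fin n → ℝ)) → Prop
  | base (i : Fin m) : LieGen b (b i)
  | bracket {c d : (Fin n → ℝ) → (Fin n → ℝ)} :
      LieGen b c → LieGen b d → LieGen b (fun x => vfBracket c d x)

/-- Condition (ii): the Hörmander condition; iterated commutators span `ℝⁿ` at each point. -/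
def Hormander {n m : ℕ} (Ω : Set (Fin n → ℝ))
    (b : Fin m → (Fin n → ℝ) → (Fin n → ℝ)) : Prop :=
  ∀ x ∈ Ω, Submodule.span ℝ {v : Fin n → ℝ | ∃ c, LieGen b c ∧ c x = v} = ⊤

/-- Condition (iii): all second commutators `[X_i,[X_i,X_j]]` vanish. -/
def SecondCommVanish {n m : ℕ} (Ω : Set (Fin n → ℝ))
    (b : Fin m → (Fin n → ℝ) → (Fin n → ℝ)) : Prop :=
  ∀ i j : Fin m, ∀ x ∈ Ω, vfBracket (b i) (fun y => vfBracket (b i) (b j) y) x = 0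

/-- `Ω' ⊂⊂ Ω`: `Ω'` is open and compactly contained in `Ω`. -/
def CptIn {n : ℕ} (Ω' Ω : Set (Fin n → ℝ)) : Prop :=
  IsOpen Ω' ∧ IsCompact (closure Ω') ∧ closure Ω' ⊆ Ω

/-- A sub-unitary (piecewise C¹) curve on `[0,T]` with respect to the fields `b`. -/
def IsSubunitary {n m : ℕ} (b : Fin m → (Fin n → ℝ) → (Fin n → ℝ)) (T : ℝ)
    (γ : ℝ → Fin n → ℝ) : Prop :=
  ContinuousOn γ (Set.Icc 0 T) ∧
  ∃ S : Finset ℝ, ∀ t ∈ Set.Ioo 0 T, t ∉ S →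
    ∃ γ' : Fin n → ℝ, HasDerivAt γ γ' t ∧
      ∀ ξ : Fin n → ℝ, (∑ j, γ' j * ξ j) ^ 2 ≤ ∑ i, (∑ j, b i (γ t) j * ξ j) ^ 2

/-- The Carnot–Carathéodory distance associated with the fields `b`. -/
def ccDist {n m : ℕ} (b : Fin m → (Fin n → ℝ) → (Fin n → ℝ))
    (x y : Fin n → ℝ) : ℝ :=
  sInf {T : ℝ | 0 < T ∧ ∃ γ : ℝ → Fin n → ℝ,
    IsSubunitary b T γ ∧ γ 0 = x ∧ γ T = y}

/-- The C-C ball of radius `R` about `x`. -/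
def ccBall {n m : ℕ} (b : Fin m → (Fin n → ℝ) → (Fin n → ℝ))
    (x : Fin n → ℝ) (R : ℝ) : Set (Fin n → ℝ) :=
  {y | ccDist b x y < R}

/-- The doubling property `|B_{tR}(x)| ≥ C t^Q |B_R(x)|`. -/
def DoublingDim {n m : ℕ} (Ω : Set (Fin n → ℝ))
    (b : Fin m → (Fin n → ℝ) → (Fin n → ℝ)) (Q : ℕ) : Prop :=
  ∃ C > (0 : ℝ), ∃ R0 > (0 : ℝ), ∀ x ∈ Ω, ∀ t ∈ Set.Ioo (0 : ℝ) 1,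
    ∀ R : ℝ, 0 < R → R < R0 →
      C * t ^ Q * (volume (ccBall b x R)).toReal ≤ (volume (ccBall b x (t * R))).toReal

/-- `Q` is the homogeneous dimension of the system `b` in `Ω`. -/
def IsHomDim {n m : ℕ} (Ω : Set (Fin n → ℝ))
    (b : Fin m → (Fin n → ℝ) → (Fin n → ℝ)) (Q : ℕ) : Prop :=
  0 < Q ∧ DoublingDim Ω b Q ∧ ∀ Q' : ℕ, 0 < Q' → DoublingDim Ω b Q' → Q ≤ Q'

/-- The class `φ^k(Ω)` of `L¹_loc(Ω)` limits of smooth `k`-convex functions. -/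
def PhiK {n m : ℕ} (Ω : Set (Fin n → ℝ)) (b : Fin m → (Fin n → ℝ) → (Fin n → ℝ))
    (k : ℕ) (u : (Fin n → ℝ) → ℝ) : Prop :=
  LocallyIntegrableOn u Ω ∧
  ∀ Ω' : Set (Fin n → ℝ), CptIn Ω' Ω →
    ∃ us : ℕ → (Fin n → ℝ) → ℝ,
      (∀ l, ContDiffOn ℝ 2 (us l) Ω' ∧ IsKConvex Ω' b k (us l)) ∧
      ∀ K : Set (Fin n → ℝ), K ⊆ Ω' → IsCompact K →
        Tendsto (fun l => ∫ x in K, |us l x - u x|) atTop (𝓝 0)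

end

section Flows

variable {E : Type*} [NormedAddCommGroup E] [NormedSpace ℝ E]

/-- `Φ` is the global flow of the vector field `Z`. -/
structure IsFlow (Z : E → E) (Φ : ℝ → E → E) : Prop where
  zero : ∀ x, Φ 0 x = x
  deriv : ∀ x t, HasDerivAt (fun t => Φ t x) (Z (Φ t x)) t

/-- `Z` is bounded by `M`, with `M`-Lipschitz and differentiable with `M`-Lipschitz derivative. -/
structure BoundedField (Z : E → E) (M : ℝ) : Prop where
  diff : Differentiable ℝ Z
  norm_le : ∀ x, ‖Z x‖ ≤ M
  fderiv_le : ∀ x, ‖fderiv ℝ Z x‖ ≤ M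
  fderiv_lip : ∀ x y, ‖fderiv ℝ Z x - fderiv ℝ Z y‖ ≤ M * ‖x - y‖

namespace BoundedField

variable {Z : E → E} {M : ℝ}

lemma nonneg (h : BoundedField Z M) : 0 ≤ M := (norm_nonneg _).trans (h.norm_le 0)

lemma mono {M' : ℝ} (h : BoundedField Z M) (hM : M ≤ M') : BoundedField Z M' where
  diff := h.diff
  norm_le x := (h.norm_le x).trans hM
  fderiv_le x := (h.fderiv_le x).trans hM
  fderiv_lip x y := (h.fderiv_lip x y).trans (by gcongr)

lemma lip (h : BoundedField Z M) (x y : E) : ‖Z x - Z y‖ ≤ M * ‖x - y‖ :=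
  Convex.norm_image_sub_le_of_norm_fderiv_le (𝕜 := ℝ) (fun z _ => h.diff z)
    (fun z _ => h.fderiv_le z) convex_univ (Set.mem_univ _) (Set.mem_univ _)

lemma lipschitzWith (h : BoundedField Z M) : LipschitzWith M.toNNReal Z :=
  LipschitzWith.of_dist_le_mul fun x y => by
    rw [dist_eq_norm, dist_eq_norm, Real.coe_toNNReal _ h.nonneg]; exact h.lip x y

lemma neg (h : BoundedField Z M) : BoundedField (fun x => - Z x) M where
  diff := h.diff.neg
  norm_le x := by simpa using h.norm_le x
  fderiv_le x := by
    have : fderiv ℝ (fun x => - Z x) x = - fderiv ℝ Z x := fderiv_fun_neg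
    rw [this, norm_neg]; exact h.fderiv_le x
  fderiv_lip x y := by
    have h1 : ∀ x, fderiv ℝ (fun x => - Z x) x = - fderiv ℝ Z x := fun x => fderiv_fun_neg
    rw [h1, h1, ← neg_sub', norm_neg]; exact h.fderiv_lip x y

lemma taylor (hZ : BoundedField Z M) (x h : E) :
    ‖Z (x + h) - Z x - fderiv ℝ Z x h‖ ≤ M * ‖h‖ ^ 2 := by
  have key := Convex.norm_image_sub_le_of_norm_fderiv_le (𝕜 := ℝ)
    (f := fun y => Z y - fderiv ℝ Z x y) (s := Metric.closedBall x ‖h‖) (C := M * ‖h‖)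
    (x := x) (y := x + h) (fun z _ => (hZ.diff z).sub (fderiv ℝ Z x).differentiableAt)
    (fun z hz => by
      have : fderiv ℝ (fun y => Z y - fderiv ℝ Z x y) z = fderiv ℝ Z z - fderiv ℝ Z x := by
        rw [fderiv_fun_sub (hZ.diff z) (fderiv ℝ Z x).differentiableAt]
        simp
      rw [this]
      refine (hZ.fderiv_lip z x).trans ?_
      have : ‖z - x‖ ≤ ‖h‖ := by simpa [dist_eq_norm] using hz
      have := hZ.nonneg
      gcongr)
    (convex_closedBall _ _) (by simp) (by simp)
  have e : Z (x + h) - fderiv ℝ Z x (x + h) - (Z x - fderiv ℝ Z x x)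
      = Z (x + h) - Z x - fderiv ℝ Z x h := by rw [map_add]; abel
  rw [e] at key
  refine key.trans (le_of_eq ?_)
  simp; ring

end BoundedField

namespace IsFlow

variable {Z : E → E} {M : ℝ} {Φ : ℝ → E → E}

lemma neg (h : IsFlow Z Φ) : IsFlow (fun x => - Z x) (fun t => Φ (-t)) where
  zero x := by simpa using h.zero x
  deriv x t := by
    have := (h.deriv x (-t)).scomp t (hasDerivAt_neg t)
    simpa [Function.comp_def] using this

lemma eq_of_hasDerivAt (h : IsFlow Z Φ) (hZ : BoundedField Z M) {α : ℝ → E}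
    (hα : ∀ t, HasDerivAt α (Z (α t)) t) (t : ℝ) : α t = Φ t (α 0) := by
  have := ODE_solution_unique_univ (v := fun _ => Z) (s := fun _ => Set.univ)
    (K := M.toNNReal) (f := α) (g := fun t => Φ t (α 0)) (t₀ := 0)
    (fun _ => hZ.lipschitzWith.lipschitzOnWith) (fun t => ⟨hα t, trivial⟩)
    (fun t => ⟨h.deriv _ t, trivial⟩) (by simp [h.zero])
  exact congrFun this t

lemma add (h : IsFlow Z Φ) (hZ : BoundedField Z M) (s t : ℝ) (x : E) :
    Φ (s + t) x = Φ s (Φ t x) := by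
  have := h.eq_of_hasDerivAt hZ (α := fun s => Φ (s + t) x) (fun s => by
    simpa using (h.deriv x (s + t)).comp_add_const s t) s
  simpa using this

lemma neg_apply (h : IsFlow Z Φ) (hZ : BoundedField Z M) (t : ℝ) (x : E) :
    Φ (-t) (Φ t x) = x := by
  rw [← h.add hZ, neg_add_cancel, h.zero]

lemma apply_neg (h : IsFlow Z Φ) (hZ : BoundedField Z M) (t : ℝ) (x : E) :
    Φ t (Φ (-t) x) = x := by
  rw [← h.add hZ, add_neg_cancel, h.zero]

lemma continuous_time (h : IsFlow Z Φ) (x : E) : Continuous fun t => Φ t x :=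
  continuous_iff_continuousAt.2 fun t => (h.deriv x t).continuousAt

lemma norm_sub_le_of_nonneg (h : IsFlow Z Φ) (hZ : BoundedField Z M) {t : ℝ} (ht : 0 ≤ t)
    (x y : E) : ‖Φ t x - Φ t y‖ ≤ Real.exp (M * t) * ‖x - y‖ := by
  have := dist_le_of_trajectories_ODE (v := fun _ => Z) (K := M.toNNReal) (a := 0) (b := t)
    (f := fun t => Φ t x) (g := fun t => Φ t y) (δ := ‖x - y‖)
    (fun _ => hZ.lipschitzWith) (h.continuous_time x).continuousOn
    (fun r _ => (h.deriv x r).hasDerivWithinAt) (h.continuous_time y).continuousOn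
    (fun r _ => (h.deriv y r).hasDerivWithinAt) (by simp [h.zero, dist_eq_norm]) t ⟨ht, le_rfl⟩
  rw [dist_eq_norm, Real.coe_toNNReal _ hZ.nonneg, sub_zero] at this
  linarith

lemma norm_sub_le (h : IsFlow Z Φ) (hZ : BoundedField Z M) (t : ℝ)
    (x y : E) : ‖Φ t x - Φ t y‖ ≤ Real.exp (M * |t|) * ‖x - y‖ := by
  rcases le_total 0 t with ht | ht
  · rw [abs_of_nonneg ht]; exact h.norm_sub_le_of_nonneg hZ ht x y
  · rw [abs_of_nonpos ht]
    simpa using h.neg.norm_sub_le_of_nonneg hZ.neg (neg_nonneg.2 ht) x y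

lemma norm_sub_self_le (h : IsFlow Z Φ) (hZ : BoundedField Z M) (s t : ℝ) (x : E) :
    ‖Φ s x - Φ t x‖ ≤ M * |s - t| := by
  have := Convex.norm_image_sub_le_of_norm_hasDerivWithin_le (s := Set.univ)
    (f := fun t => Φ t x) (f' := fun t => Z (Φ t x)) (C := M)
    (fun r _ => (h.deriv x r).hasDerivWithinAt) (fun r _ => hZ.norm_le _) convex_univ
    (Set.mem_univ t) (Set.mem_univ s)
  simpa using this

lemma continuous_uncurry (h : IsFlow Z Φ) (hZ : BoundedField Z M) :
    Continuous fun p : ℝ × E => Φ p.1 p.2 := by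
  rw [continuous_iff_continuousAt]
  rintro ⟨t, x⟩
  have : Tendsto (fun p : ℝ × E => M * |p.1 - t| + Real.exp (M * |t|) * ‖p.2 - x‖)
      (𝓝 (t, x)) (𝓝 0) := by
    have : Continuous (fun p : ℝ × E => M * |p.1 - t| + Real.exp (M * |t|) * ‖p.2 - x‖) := by
      fun_prop
    simpa using this.tendsto (t, x)
  refine tendsto_iff_norm_sub_tendsto_zero.2 (squeeze_zero (fun _ => norm_nonneg _) ?_ this)
  rintro ⟨s, y⟩
  calc ‖Φ s y - Φ t x‖ = ‖(Φ s y - Φ t y) + (Φ t y - Φ t x)‖ := by congr 1; abel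
    _ ≤ _ := (norm_add_le _ _).trans
      (add_le_add (h.norm_sub_self_le hZ _ _ _) (h.norm_sub_le hZ _ _ _))

lemma continuous_space (h : IsFlow Z Φ) (hZ : BoundedField Z M) (t : ℝ) : Continuous (Φ t) :=
  (h.continuous_uncurry hZ).comp (by fun_prop : Continuous fun x : E => (t, x))

lemma antilipschitz (h : IsFlow Z Φ) (hZ : BoundedField Z M) {t T : ℝ} (ht : |t| ≤ T) :
    AntilipschitzWith (Real.exp (M * T)).toNNReal (Φ t) :=
  AntilipschitzWith.of_le_mul_dist fun x y => by
    have := h.norm_sub_le hZ (-t) (Φ t x) (Φ t y)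
    rw [h.neg_apply hZ, h.neg_apply hZ, abs_neg] at this
    rw [dist_eq_norm, dist_eq_norm, Real.coe_toNNReal _ (Real.exp_nonneg _)]
    refine this.trans ?_
    have := hZ.nonneg
    gcongr

lemma taylor (h : IsFlow Z Φ) (hZ : BoundedField Z M) {s : ℝ} (hs : 0 ≤ s) (x : E) :
    ‖Φ s x - x - s • Z x‖ ≤ M ^ 2 * s ^ 2 := by
  have := (convex_Icc (0 : ℝ) s).norm_image_sub_le_of_norm_hasDerivWithin_le
    (f := fun t => Φ t x - t • Z x) (f' := fun t => Z (Φ t x) - (1 : ℝ) • Z x) (C := M * (M * s))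
    (fun r _ => ((h.deriv x r).sub ((hasDerivAt_id r).smul_const (Z x))).hasDerivWithinAt)
    (fun r hr => by
      rw [one_smul]
      refine (hZ.lip _ _).trans ?_
      have := h.norm_sub_self_le hZ r 0 x
      rw [h.zero, sub_zero, abs_of_nonneg hr.1] at this
      have := hZ.nonneg
      have := hr.2
      gcongr
      nlinarith)
    (Set.left_mem_Icc.2 hs) (Set.right_mem_Icc.2 hs)
  simp only [h.zero, zero_smul, sub_zero, Real.norm_eq_abs, abs_of_nonneg hs] at this
  calc _ = ‖Φ s x - s • Z x - x‖ := by congr 1; abel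
    _ ≤ _ := this
    _ = _ := by ring

end IsFlow

lemma exists_isFlow [CompleteSpace E] {Z : E → E} {M : ℝ} (hZ : BoundedField Z M) :
    ∃ Φ, IsFlow Z Φ := by
  have h1 : ∀ (N : ℕ) (x : E), ∃ α : ℝ → E, α 0 = x ∧
      ∀ t ∈ Set.Icc (-(N : ℝ)) N, HasDerivWithinAt α (Z (α t)) (Set.Icc (-(N : ℝ)) N) t := by
    intro N x
    have hN : (0 : ℝ) ≤ N := N.cast_nonneg
    have hp : IsPicardLindelof (fun _ => Z) (⟨0, by simp⟩ : Set.Icc (-(N : ℝ)) N) x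
        (M.toNNReal * N) 0 M.toNNReal M.toNNReal := by
      apply IsPicardLindelof.of_time_independent
      · intro y _
        rw [Real.coe_toNNReal _ hZ.nonneg]; exact hZ.norm_le y
      · exact hZ.lipschitzWith.lipschitzOnWith
      · simp
    obtain ⟨α, h0, h⟩ := hp.exists_eq_forall_mem_Icc_hasDerivWithinAt₀
    exact ⟨α, h0, h⟩
  choose α h0 h using h1
  have hat : ∀ (N : ℕ) (x : E), ∀ t ∈ Set.Ioo (-(N : ℝ)) N, HasDerivAt (α N x) (Z (α N x t)) t := by
    intro N x t ht
    exact (h N x t (Set.Ioo_subset_Icc_self ht)).hasDerivAt (Icc_mem_nhds ht.1 ht.2)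
  have hag : ∀ (N N' : ℕ) (x : E) (t : ℝ), t ∈ Set.Ioo (-(N : ℝ)) N → N ≤ N' → α N x t = α N' x t := by
    intro N N' x t ht hNN
    have hNN' : (N : ℝ) ≤ N' := by exact_mod_cast hNN
    have hpos : (0 : ℝ) < N := by have := ht.1; have := ht.2; linarith
    refine ODE_solution_unique_of_mem_Ioo (v := fun _ => Z) (s := fun _ => Set.univ)
      (K := M.toNNReal) (a := -(N : ℝ)) (b := N) (t₀ := 0)
      (fun _ _ => hZ.lipschitzWith.lipschitzOnWith) ⟨by linarith, hpos⟩
      (fun r hr => ⟨hat N x r hr, trivial⟩)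
      (fun r hr => ⟨hat N' x r ⟨by linarith [hr.1], by linarith [hr.2]⟩, trivial⟩)
      (by rw [h0, h0]) ht
  have hc : ∀ t : ℝ, |t| < ((⌈|t|⌉₊ + 1 : ℕ) : ℝ) := fun t => by
    push_cast; linarith [Nat.le_ceil |t|]
  refine ⟨fun t x => α (⌈|t|⌉₊ + 1) x t, fun x => h0 _ _, fun x t => ?_⟩
  have ht := abs_lt.1 (hc t)
  set N := ⌈|t|⌉₊ + 1 with hN
  have hd := hat (N + 1) x t ⟨by push_cast; linarith, by push_cast; linarith⟩
  have e : ∀ r ∈ Set.Ioo (-(N : ℝ)) N, α (⌈|r|⌉₊ + 1) x r = α (N + 1) x r := by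
    intro r hr
    have hle : ⌈|r|⌉₊ ≤ N := Nat.ceil_le.2 (abs_lt.2 ⟨hr.1, hr.2⟩).le
    exact hag _ _ x r (abs_lt.1 (hc r)) (by omega)
  have he : (fun r => α (⌈|r|⌉₊ + 1) x r) =ᶠ[𝓝 t] α (N + 1) x :=
    Filter.eventually_of_mem (Ioo_mem_nhds ht.1 ht.2) e
  have := hd.congr_of_eventuallyEq he
  rwa [← e t ht] at this

lemma gronwallBound_le {δ K ε x : ℝ} (hK : 0 ≤ K) (hε : 0 ≤ ε) :
    gronwallBound δ K ε x ≤ (δ + ε * x) * Real.exp (K * x) ∨ x < 0 := by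
  rcases lt_or_ge x 0 with hx | hx
  · exact Or.inr hx
  left
  rcases hK.eq_or_lt with rfl | hK
  · simp [gronwallBound_K0]
  rw [gronwallBound_of_K_ne_0 hK.ne', add_mul]
  have h1 : Real.exp (K * x) - 1 ≤ K * x * Real.exp (K * x) := by
    have := Real.add_one_le_exp (-(K * x))
    have h2 := Real.exp_pos (K * x)
    have h3 : Real.exp (-(K * x)) * Real.exp (K * x) = 1 := by rw [← Real.exp_add]; simp
    nlinarith
  have : ε / K * (Real.exp (K * x) - 1) ≤ ε / K * (K * x * Real.exp (K * x)) := by gcongr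
  calc _ ≤ δ * Real.exp (K * x) + ε / K * (K * x * Real.exp (K * x)) := by linarith
    _ = _ := by field_simp

/-- Group commutator expansion of two flows, with the bracket `B = DZ·X - DX·Z`. -/
lemma flow_commutator_expansion {X Z B : E → E} {M : ℝ} {Φ Ψ : ℝ → E → E}
    (hX : BoundedField X M) (hZ : BoundedField Z M) (hB : BoundedField B M)
    (hBeq : ∀ x, B x = fderiv ℝ Z x (X x) - fderiv ℝ X x (Z x))
    (hΦ : IsFlow X Φ) (hΨ : IsFlow Z Ψ) :
    ∃ C ≥ (0 : ℝ), ∀ s t : ℝ, 0 ≤ s → s ≤ 1 → 0 ≤ t → t ≤ 1 → ∀ q,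
      ‖Φ (-t) (Ψ s q) - Ψ s (Φ (-t) q) - (s * t) • B (Ψ s (Φ (-t) q))‖
        ≤ C * (s ^ 2 + s * t ^ 2) := by
  have hM := hX.nonneg
  set c1 : ℝ := M ^ 2 * 2 + 4 * M ^ 3 with hc1
  have hc1p : 0 ≤ c1 := by positivity
  refine ⟨(M ^ 2 + 2 * c1) * Real.exp M + 2 * M ^ 2, by positivity, ?_⟩
  intro s t hs hs1 ht ht1 q
  set p : ℝ → E := fun r => Φ (-r) q with hp
  have hpd : ∀ r, HasDerivAt p (- X (p r)) r := fun r => hΦ.neg.deriv q r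
  set h : ℝ → E := fun r => s • Z (p r) + (s * r) • B (p r) with hh
  set c : ℝ → E := fun r => p r + h r with hc
  have hcd : ∀ r, HasDerivAt c (- X (p r) + (s • (fderiv ℝ Z (p r) (- X (p r)))
      + ((s * r) • (fderiv ℝ B (p r) (- X (p r))) + s • B (p r)))) r := by
    intro r
    have e1 : HasDerivAt (fun r => Z (p r)) (fderiv ℝ Z (p r) (- X (p r))) r :=
      (hZ.diff (p r)).hasFDerivAt.comp_hasDerivAt r (hpd r)
    have e2 : HasDerivAt (fun r => B (p r)) (fderiv ℝ B (p r) (- X (p r))) r :=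
      (hB.diff (p r)).hasFDerivAt.comp_hasDerivAt r (hpd r)
    have e3 : HasDerivAt (fun r : ℝ => s * r) s r := by
      simpa using (hasDerivAt_id r).const_mul s
    exact (hpd r).add ((e1.const_smul s).add (e3.smul e2))
  have hfd : ∀ r, HasDerivAt (fun r => Φ (-r) (Ψ s q)) (- X (Φ (-r) (Ψ s q))) r :=
    fun r => hΦ.neg.deriv (Ψ s q) r
  have g := dist_le_of_approx_trajectories_ODE (v := fun _ x => - X x) (K := M.toNNReal)
    (a := 0) (b := t) (f := fun r => Φ (-r) (Ψ s q)) (g := c)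
    (εf := 0) (εg := c1 * (s * t + s ^ 2)) (δ := M ^ 2 * s ^ 2)
    (fun _ => hX.neg.lipschitzWith)
    (fun r _ => (hfd r).continuousAt.continuousWithinAt)
    (fun r _ => (hfd r).hasDerivWithinAt) (fun r _ => by simp)
    (fun r _ => (hcd r).continuousAt.continuousWithinAt)
    (fun r _ => (hcd r).hasDerivWithinAt)
    (fun r hr => by
      rw [dist_eq_norm]
      have hr0 := hr.1
      have hrt : r ≤ t := hr.2.le
      have hT := hX.taylor (p r) (h r)
      have hhn : ‖h r‖ ≤ 2 * M * s := by
        refine (norm_add_le _ _).trans ?_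
        rw [norm_smul, norm_smul, Real.norm_eq_abs, Real.norm_eq_abs, abs_of_nonneg hs,
          abs_of_nonneg (mul_nonneg hs hr0)]
        have a1 := hZ.norm_le (p r)
        have a2 := hB.norm_le (p r)
        have a3 : s * r ≤ s := by nlinarith
        have : s * r * ‖B (p r)‖ ≤ s * M := by gcongr
        have : s * ‖Z (p r)‖ ≤ s * M := by gcongr
        linarith
      have e : - X (p r) + (s • (fderiv ℝ Z (p r) (- X (p r)))
          + ((s * r) • (fderiv ℝ B (p r) (- X (p r))) + s • B (p r))) - - X (c r)
          = (X (p r + h r) - X (p r) - fderiv ℝ X (p r) (h r))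
            + ((s * r) • fderiv ℝ X (p r) (B (p r)) - (s * r) • fderiv ℝ B (p r) (X (p r))) := by
        simp only [hc]
        simp only [hh, map_add, map_smul, map_neg, hBeq (p r), map_sub]
        module
      rw [e]
      have n1 : ‖(s * r) • fderiv ℝ X (p r) (B (p r))‖ ≤ s * t * (M * M) := by
        rw [norm_smul, Real.norm_eq_abs, abs_of_nonneg (mul_nonneg hs hr0)]
        have := (fderiv ℝ X (p r)).le_of_opNorm_le (hX.fderiv_le _) (B (p r))
        have := hB.norm_le (p r)
        gcongr
        nlinarith
      have n2 : ‖(s * r) • fderiv ℝ B (p r) (X (p r))‖ ≤ s * t * (M * M) := by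
        rw [norm_smul, Real.norm_eq_abs, abs_of_nonneg (mul_nonneg hs hr0)]
        have := (fderiv ℝ B (p r)).le_of_opNorm_le (hB.fderiv_le _) (X (p r))
        have := hX.norm_le (p r)
        gcongr
        nlinarith
      have n3 : M * ‖h r‖ ^ 2 ≤ 4 * M ^ 3 * s ^ 2 := by
        calc M * ‖h r‖ ^ 2 ≤ M * (2 * M * s) ^ 2 := by gcongr
          _ = _ := by ring
      calc _ ≤ _ := norm_add_le _ _
        _ ≤ 4 * M ^ 3 * s ^ 2 + (s * t * (M * M) + s * t * (M * M)) :=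
          add_le_add (hT.trans n3) ((norm_sub_le _ _).trans (add_le_add n1 n2))
        _ ≤ _ := by
          rw [hc1]
          have : 0 ≤ s * t := by positivity
          have : 0 ≤ M ^ 3 * (s * t) := by positivity
          have : 0 ≤ M ^ 2 * s ^ 2 := by positivity
          nlinarith)
    (by
      have := hΨ.taylor hZ hs q
      simp only [hc, hh, hp, neg_zero, hΦ.zero, mul_zero, zero_smul, add_zero, dist_eq_norm]
      rwa [← sub_sub])
    t ⟨ht, le_rfl⟩
  have g2 : ‖Φ (-t) (Ψ s q) - c t‖ ≤ (M ^ 2 + 2 * c1) * Real.exp M * (s ^ 2 + s * t ^ 2) := by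
    rw [dist_eq_norm, Real.coe_toNNReal _ hM, sub_zero, zero_add] at g
    refine g.trans ?_
    rcases gronwallBound_le (δ := M ^ 2 * s ^ 2) (x := t) hM
      (by positivity : 0 ≤ c1 * (s * t + s ^ 2)) with h1 | h1
    · refine h1.trans ?_
      have a1 : Real.exp (M * t) ≤ Real.exp M := Real.exp_le_exp.2 (by nlinarith)
      have a2 : M ^ 2 * s ^ 2 + c1 * (s * t + s ^ 2) * t
          ≤ (M ^ 2 + 2 * c1) * (s ^ 2 + s * t ^ 2) := by
        have b1 : 0 ≤ M ^ 2 * (s * t ^ 2) := by positivity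
        have b2 : c1 * s ^ 2 * t ≤ c1 * s ^ 2 * 1 := by gcongr
        have b3 : 0 ≤ c1 * s ^ 2 := by positivity
        have b4 : 0 ≤ c1 * (s * t ^ 2) := by positivity
        nlinarith
      calc _ ≤ (M ^ 2 + 2 * c1) * (s ^ 2 + s * t ^ 2) * Real.exp M := by gcongr
        _ = _ := by ring
    · linarith
  have g3 := hΨ.taylor hZ hs (p t)
  have g4 : ‖B (p t) - B (Ψ s (p t))‖ ≤ M * (M * s) := by
    refine (hB.lip _ _).trans ?_
    have := hΨ.norm_sub_self_le hZ 0 s (p t)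
    rw [hΨ.zero, zero_sub, abs_neg, abs_of_nonneg hs] at this
    gcongr
  have e : Φ (-t) (Ψ s q) - Ψ s (Φ (-t) q) - (s * t) • B (Ψ s (Φ (-t) q))
      = (Φ (-t) (Ψ s q) - c t) - (Ψ s (p t) - p t - s • Z (p t))
        + (s * t) • (B (p t) - B (Ψ s (p t))) := by
    simp only [hc, hh, hp]; module
  rw [e]
  have n4 : ‖(s * t) • (B (p t) - B (Ψ s (p t)))‖ ≤ M ^ 2 * s ^ 2 := by
    rw [norm_smul, Real.norm_eq_abs, abs_of_nonneg (mul_nonneg hs ht)]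
    calc s * t * ‖B (p t) - B (Ψ s (p t))‖ ≤ s * t * (M * (M * s)) := by gcongr
      _ ≤ s * 1 * (M * (M * s)) := by gcongr
      _ = _ := by ring
  calc _ ≤ ‖Φ (-t) (Ψ s q) - c t‖ + ‖Ψ s (p t) - p t - s • Z (p t)‖
        + ‖(s * t) • (B (p t) - B (Ψ s (p t)))‖ :=
        (norm_add_le _ _).trans (add_le_add_left (norm_sub_le _ _) _)
    _ ≤ (M ^ 2 + 2 * c1) * Real.exp M * (s ^ 2 + s * t ^ 2) + M ^ 2 * s ^ 2 + M ^ 2 * s ^ 2 :=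
        add_le_add (add_le_add g2 g3) n4
    _ ≤ _ := by
      have : 0 ≤ M ^ 2 * (s * t ^ 2) := by positivity
      nlinarith

end Flows

section ChangeOfVariables

variable {n : ℕ}

lemma map_volume_le_of_antilipschitz {ψ : (Fin n → ℝ) → (Fin n → ℝ)} {K : NNReal}
    (hψ : AntilipschitzWith K ψ) (hc : Continuous ψ) :
    Measure.map ψ volume ≤ (K ^ n : NNReal) • (volume : Measure (Fin n → ℝ)) := by
  refine Measure.le_iff.2 fun s hs => ?_
  rw [Measure.map_apply hc.measurable hs]
  have h := hψ.hausdorffMeasure_preimage_le (d := n) (by positivity) s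
  have e : (MeasureTheory.Measure.hausdorffMeasure (n : ℝ) : Measure (Fin n → ℝ)) = volume := by
    have := hausdorffMeasure_pi_real (ι := Fin n)
    simpa using this
  rw [e] at h
  simpa [Measure.smul_apply, ENNReal.smul_def] using h

lemma integrable_comp_of_antilipschitz {ψ : (Fin n → ℝ) → (Fin n → ℝ)} {K : NNReal}
    (hψ : AntilipschitzWith K ψ) (hc : Continuous ψ) {g : (Fin n → ℝ) → ℝ} (hg : Integrable g) :
    Integrable fun x => g (ψ x) := by
  have h1 : Integrable g (Measure.map ψ volume) :=
    (hg.smul_measure_nnreal (c := K ^ n)).mono_measure (map_volume_le_of_antilipschitz hψ hc)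
  exact (integrable_map_measure h1.aestronglyMeasurable hc.aemeasurable).1 h1

lemma integral_comp_le_of_antilipschitz {ψ : (Fin n → ℝ) → (Fin n → ℝ)} {K : NNReal}
    (hψ : AntilipschitzWith K ψ) (hc : Continuous ψ) {g : (Fin n → ℝ) → ℝ} (hg : Integrable g)
    (h0 : ∀ x, 0 ≤ g x) : ∫ x, g (ψ x) ≤ (K : ℝ) ^ n * ∫ x, g x := by
  have hle := map_volume_le_of_antilipschitz hψ hc
  have h2 : Integrable g ((K ^ n : NNReal) • (volume : Measure (Fin n → ℝ))) :=
    hg.smul_measure_nnreal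
  have h1 : Integrable g (Measure.map ψ volume) := h2.mono_measure hle
  rw [← integral_map hc.aemeasurable h1.aestronglyMeasurable]
  refine (integral_mono_measure hle (Eventually.of_forall h0) h2).trans (le_of_eq ?_)
  rw [integral_smul_nnreal_measure]
  simp [NNReal.smul_def]

end ChangeOfVariables

section FlowIntegrals

variable {n : ℕ} {Z : (Fin n → ℝ) → (Fin n → ℝ)} {M : ℝ} {Φ : ℝ → (Fin n → ℝ) → (Fin n → ℝ)}

lemma IsFlow.integrable_comp (h : IsFlow Z Φ) (hZ : BoundedField Z M) (t : ℝ)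
    {g : (Fin n → ℝ) → ℝ} (hg : Integrable g) : Integrable fun x => g (Φ t x) :=
  integrable_comp_of_antilipschitz (h.antilipschitz hZ le_rfl) (h.continuous_space hZ t) hg

lemma IsFlow.integral_comp_le (h : IsFlow Z Φ) (hZ : BoundedField Z M) {t : ℝ} (ht : |t| ≤ 1)
    {g : (Fin n → ℝ) → ℝ} (hg : Integrable g) (h0 : ∀ x, 0 ≤ g x) :
    ∫ x, g (Φ t x) ≤ Real.exp M ^ n * ∫ x, g x := by
  have := integral_comp_le_of_antilipschitz (h.antilipschitz hZ ht) (h.continuous_space hZ t) hg h0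
  rwa [Real.coe_toNNReal _ (Real.exp_nonneg _), mul_one] at this

lemma continuous_Xop {F : (Fin n → ℝ) → ℝ} (hF : ContDiff ℝ 1 F) (hZ : Continuous Z) :
    Continuous (Xop Z F) :=
  (hF.continuous_fderiv one_ne_zero).clm_apply hZ

lemma hasCompactSupport_Xop {F : (Fin n → ℝ) → ℝ} (hc : HasCompactSupport F) :
    HasCompactSupport (Xop Z F) :=
  (hc.fderiv (𝕜 := ℝ)).mono fun x hx => by
    contrapose! hx
    simp only [Function.notMem_support] at hx ⊢
    simp [Xop, hx]

lemma integrable_Xop {F : (Fin n → ℝ) → ℝ} (hF : ContDiff ℝ 1 F) (hc : HasCompactSupport F)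
    (hZ : Continuous Z) : Integrable (Xop Z F) :=
  (continuous_Xop hF hZ).integrable_of_hasCompactSupport (hasCompactSupport_Xop hc)

lemma IsFlow.integral_abs_comp_sub_le_of_nonneg (h : IsFlow Z Φ) (hZ : BoundedField Z M) {t : ℝ}
    (ht : 0 ≤ t) (ht1 : t ≤ 1) {F : (Fin n → ℝ) → ℝ} (hF : ContDiff ℝ 1 F)
    (hc : HasCompactSupport F) :
    ∫ x, |F (Φ t x) - F x| ≤ t * (Real.exp M ^ n * ∫ x, |Xop Z F x|) := by
  have hcont := continuous_Xop hF hZ.diff.continuous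
  have h_int := (integrable_Xop hF hc hZ.diff.continuous).abs
  have hpt : ∀ x, |F (Φ t x) - F x| ≤ ∫ r in (0 : ℝ)..t, |Xop Z F (Φ r x)| := by
    intro x
    have hd : ∀ r, HasDerivAt (fun r => F (Φ r x)) (Xop Z F (Φ r x)) r := fun r =>
      ((hF.differentiable one_ne_zero) (Φ r x)).hasFDerivAt.comp_hasDerivAt r (h.deriv x r)
    have hci : Continuous fun r => Xop Z F (Φ r x) := hcont.comp (h.continuous_time x)
    have := intervalIntegral.integral_eq_sub_of_hasDerivAt (fun r _ => hd r)
      (hci.intervalIntegrable 0 t)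
    rw [h.zero] at this
    rw [← this]
    exact intervalIntegral.abs_integral_le_integral_abs ht
  have hjc : Continuous fun p : (Fin n → ℝ) × ℝ => |Xop Z F (Φ p.2 p.1)| :=
    (hcont.comp ((h.continuous_uncurry hZ).comp continuous_swap)).abs
  have hprod : Integrable (fun p : (Fin n → ℝ) × ℝ => |Xop Z F (Φ p.2 p.1)|)
      (volume.prod (volume.restrict (Set.Ioc 0 t))) := by
    rw [integrable_prod_iff' hjc.aestronglyMeasurable]
    constructor
    · exact Eventually.of_forall fun r => h.integrable_comp hZ r h_int
    · refine Measure.integrableOn_of_bounded (M := Real.exp M ^ n * ∫ x, |Xop Z F x|)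
        (by simp) ?_ ?_
      · have := ((hjc.comp continuous_swap).norm.aestronglyMeasurable
          (μ := (volume : Measure ℝ).prod (volume : Measure (Fin n → ℝ)))).integral_prod_right'
        exact this
      · refine (ae_restrict_mem measurableSet_Ioc).mono fun r hr => ?_
        rw [Real.norm_eq_abs, abs_of_nonneg (by positivity)]
        simp only [Real.norm_eq_abs, abs_abs]
        exact h.integral_comp_le hZ (abs_le.2 ⟨by linarith [hr.1], by linarith [hr.2]⟩) h_int
          fun _ => abs_nonneg _
  have hFi := hF.continuous.integrable_of_hasCompactSupport hc (μ := volume)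
  calc ∫ x, |F (Φ t x) - F x| ≤ ∫ x, ∫ r in Set.Ioc 0 t, |Xop Z F (Φ r x)| := by
        refine integral_mono (((h.integrable_comp hZ t hFi).sub hFi).abs) hprod.integral_prod_left
          fun x => ?_
        have := hpt x
        rwa [intervalIntegral.integral_of_le ht] at this
    _ = ∫ r in Set.Ioc 0 t, ∫ x, |Xop Z F (Φ r x)| := integral_integral_swap hprod
    _ ≤ ∫ r in Set.Ioc 0 t, Real.exp M ^ n * ∫ x, |Xop Z F x| := by
        refine setIntegral_mono_on hprod.integral_prod_right (integrable_const _) measurableSet_Ioc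
          fun r hr => ?_
        exact h.integral_comp_le hZ (abs_le.2 ⟨by linarith [hr.1], by linarith [hr.2]⟩) h_int
          fun _ => abs_nonneg _
    _ = _ := by simp [ht]

lemma IsFlow.integral_abs_comp_sub_le (h : IsFlow Z Φ) (hZ : BoundedField Z M) {t : ℝ}
    (ht : |t| ≤ 1) {F : (Fin n → ℝ) → ℝ} (hF : ContDiff ℝ 1 F)
    (hc : HasCompactSupport F) :
    ∫ x, |F (Φ t x) - F x| ≤ |t| * (Real.exp M ^ n * ∫ x, |Xop Z F x|) := by
  rcases le_total 0 t with h0 | h0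
  · rw [abs_of_nonneg h0] at ht ⊢
    exact h.integral_abs_comp_sub_le_of_nonneg hZ h0 ht hF hc
  · rw [abs_of_nonpos h0] at ht ⊢
    have := h.neg.integral_abs_comp_sub_le_of_nonneg hZ.neg (neg_nonneg.2 h0) ht hF hc
    simpa [Xop] using this

end FlowIntegrals

section BracketStep

variable {n : ℕ}

/-- `G / τ` controls the gradient of `F`, and `G / τ²` its increments, at scale `τ`. -/
structure ScaleControl (τ : ℝ) (F G : (Fin n → ℝ) → ℝ) : Prop where
  contDiff : ContDiff ℝ 1 F
  compact : HasCompactSupport F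
  integrable : Integrable G
  grad_le : ∀ x z, ‖z‖ ≤ τ → ‖fderiv ℝ F (x + z)‖ ≤ G x / τ
  grad_sub_le : ∀ x z, ‖z‖ ≤ τ → ‖fderiv ℝ F (x + z) - fderiv ℝ F x‖ ≤ G x * ‖z‖ / τ ^ 2

lemma ScaleControl.nonneg {τ : ℝ} (hτ : 0 < τ) {F G : (Fin n → ℝ) → ℝ} (h : ScaleControl τ F G)
    (x : Fin n → ℝ) : 0 ≤ G x := by
  have := (norm_nonneg _).trans (h.grad_le x 0 (by simpa using hτ.le))
  by_contra hx
  exact absurd this (not_le.2 (div_neg_of_neg_of_pos (not_le.1 hx) hτ))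

lemma ScaleControl.taylor {τ : ℝ} (hτ : 0 < τ) {F G : (Fin n → ℝ) → ℝ} (h : ScaleControl τ F G)
    (x z : Fin n → ℝ) (hz : ‖z‖ ≤ τ) :
    |F (x + z) - F x - fderiv ℝ F x z| ≤ G x * ‖z‖ ^ 2 / τ ^ 2 := by
  have hd := h.contDiff.differentiable one_ne_zero
  have hG := h.nonneg hτ x
  have key := Convex.norm_image_sub_le_of_norm_fderiv_le (𝕜 := ℝ)
    (f := fun y => F y - fderiv ℝ F x y) (s := Metric.closedBall x ‖z‖)
    (C := G x * ‖z‖ / τ ^ 2)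
    (x := x) (y := x + z) (fun y _ => (hd y).sub (fderiv ℝ F x).differentiableAt)
    (fun y hy => by
      have : fderiv ℝ (fun y => F y - fderiv ℝ F x y) y = fderiv ℝ F y - fderiv ℝ F x := by
        rw [fderiv_fun_sub (hd y) (fderiv ℝ F x).differentiableAt]
        simp
      rw [this]
      have hy' : ‖y - x‖ ≤ ‖z‖ := by simpa [dist_eq_norm] using hy
      have := h.grad_sub_le x (y - x) (hy'.trans hz)
      rw [add_sub_cancel] at this
      refine this.trans ?_
      gcongr)
    (convex_closedBall _ _) (by simp) (by simp)
  have e : F (x + z) - fderiv ℝ F x (x + z) - (F x - fderiv ℝ F x x)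
      = F (x + z) - F x - fderiv ℝ F x z := by rw [map_add]; ring
  rw [e, Real.norm_eq_abs] at key
  refine key.trans (le_of_eq ?_)
  simp; ring

lemma integral_le_add_five {f g₁ g₂ g₃ g₄ g₅ : (Fin n → ℝ) → ℝ} (hf : Integrable f)
    (h₁ : Integrable g₁) (h₂ : Integrable g₂) (h₃ : Integrable g₃) (h₄ : Integrable g₄)
    (h₅ : Integrable g₅) (h : ∀ x, f x ≤ g₁ x + g₂ x + g₃ x + g₄ x + g₅ x) :
    ∫ x, f x ≤ (∫ x, g₁ x) + (∫ x, g₂ x) + (∫ x, g₃ x) + (∫ x, g₄ x) + ∫ x, g₅ x := by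
  have e := integral_add' (((h₁.add h₂).add h₃).add h₄) h₅
  rw [integral_add' ((h₁.add h₂).add h₃) h₄, integral_add' (h₁.add h₂) h₃,
    integral_add' h₁ h₂] at e
  rw [← e]
  exact integral_mono hf ((((h₁.add h₂).add h₃).add h₄).add h₅) h

set_option maxHeartbeats 1000000 in
lemma integral_bracket_le {X Z B : (Fin n → ℝ) → (Fin n → ℝ)} {M : ℝ}
    (hX : BoundedField X M) (hZ : BoundedField Z M) (hB : BoundedField B M)
    (hBeq : ∀ x, B x = fderiv ℝ Z x (X x) - fderiv ℝ X x (Z x)) :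
    ∃ C > (0 : ℝ), ∀ s t : ℝ, 0 ≤ s → s ≤ t → t ≤ 1 → ∀ τ > 0, C * (s * t) ≤ τ →
      ∀ F G, ScaleControl τ F G →
        s * t * ∫ x, |Xop B F x| ≤ C * (t * (∫ x, |Xop X F x|) + s * (∫ x, |Xop Z F x|)
          + ((s * t) ^ 2 / τ ^ 2 + (s ^ 2 + s * t ^ 2) / τ) * ∫ x, G x) := by
  obtain ⟨Φ, hΦ⟩ := exists_isFlow hX
  obtain ⟨Ψ, hΨ⟩ := exists_isFlow hZ
  obtain ⟨C₀, hC₀, hexp⟩ := flow_commutator_expansion hX hZ hB hBeq hΦ hΨ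
  have hM := hX.nonneg
  set D : ℝ := Real.exp M ^ n with hD
  have hD1 : 1 ≤ D := one_le_pow₀ (Real.one_le_exp hM)
  have hD0 : 0 ≤ D := zero_le_one.trans hD1
  set A : ℝ := M + 2 * C₀ with hA
  have hA0 : 0 ≤ A := by positivity
  refine ⟨2 * D ^ 4 + A + A ^ 2 + C₀ + 1, by positivity, ?_⟩
  intro s t hs hst ht τ hτ hτst F G h
  have ht0 : 0 ≤ t := hs.trans hst
  have hs1 : s ≤ 1 := hst.trans ht
  have hst0 : 0 ≤ s * t := mul_nonneg hs ht0
  have hsa : |s| ≤ 1 := by rwa [abs_of_nonneg hs]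
  have hta : |t| ≤ 1 := by rwa [abs_of_nonneg ht0]
  have hsa' : |-s| ≤ 1 := by rwa [abs_neg]
  have hta' : |-t| ≤ 1 := by rwa [abs_neg]
  set IX := ∫ x, |Xop X F x|
  set IZ := ∫ x, |Xop Z F x|
  have hIX : 0 ≤ IX := integral_nonneg fun _ => abs_nonneg _
  have hIZ : 0 ≤ IZ := integral_nonneg fun _ => abs_nonneg _
  have hFi : Integrable F := h.contDiff.continuous.integrable_of_hasCompactSupport h.compact
  have hGi := h.integrable
  have hG0 : 0 ≤ ∫ x, G x := integral_nonneg fun x => h.nonneg hτ x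
  -- the four increments
  set g1 : (Fin n → ℝ) → ℝ := fun y => |F (Φ (-t) y) - F y| with hg1
  set g2 : (Fin n → ℝ) → ℝ := fun y => |F (Ψ s y) - F y| with hg2
  set g3 : (Fin n → ℝ) → ℝ := fun y => |F (Φ t y) - F y| with hg3
  set g4 : (Fin n → ℝ) → ℝ := fun y => |F (Ψ (-s) y) - F y| with hg4
  have i1 : Integrable g1 := ((hΦ.integrable_comp hX _ hFi).sub hFi).abs
  have i2 : Integrable g2 := ((hΨ.integrable_comp hZ _ hFi).sub hFi).abs
  have i3 : Integrable g3 := ((hΦ.integrable_comp hX _ hFi).sub hFi).abs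
  have i4 : Integrable g4 := ((hΨ.integrable_comp hZ _ hFi).sub hFi).abs
  have b1 : ∫ x, g1 x ≤ t * (D * IX) := by
    have := hΦ.integral_abs_comp_sub_le hX hta' h.contDiff h.compact
    rwa [abs_neg, abs_of_nonneg ht0] at this
  have b2 : ∫ x, g2 x ≤ s * (D * IZ) := by
    have := hΨ.integral_abs_comp_sub_le hZ hsa h.contDiff h.compact
    rwa [abs_of_nonneg hs] at this
  have b3 : ∫ x, g3 x ≤ t * (D * IX) := by
    have := hΦ.integral_abs_comp_sub_le hX hta h.contDiff h.compact
    rwa [abs_of_nonneg ht0] at this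
  have b4 : ∫ x, g4 x ≤ s * (D * IZ) := by
    have := hΨ.integral_abs_comp_sub_le hZ hsa' h.contDiff h.compact
    rwa [abs_neg, abs_of_nonneg hs] at this
  have j3 := hΨ.integrable_comp hZ (-s) i3
  have c3 : ∫ x, g3 (Ψ (-s) x) ≤ D * (t * (D * IX)) :=
    (hΨ.integral_comp_le hZ hsa' i3 fun _ => abs_nonneg _).trans (by gcongr)
  have k2 := hΦ.integrable_comp hX t i2
  have j2 := hΨ.integrable_comp hZ (-s) k2
  have c2 : ∫ x, g2 (Φ t (Ψ (-s) x)) ≤ D * (D * (s * (D * IZ))) :=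
    (hΨ.integral_comp_le hZ hsa' k2 fun _ => abs_nonneg _).trans
      (mul_le_mul_of_nonneg_left ((hΦ.integral_comp_le hX hta i2 fun _ => abs_nonneg _).trans
        (by gcongr)) hD0)
  have k1 := hΨ.integrable_comp hZ s i1
  have l1 := hΦ.integrable_comp hX t k1
  have j1 := hΨ.integrable_comp hZ (-s) l1
  have c1 : ∫ x, g1 (Ψ s (Φ t (Ψ (-s) x))) ≤ D * (D * (D * (t * (D * IX)))) :=
    (hΨ.integral_comp_le hZ hsa' l1 fun _ => abs_nonneg _).trans
      (mul_le_mul_of_nonneg_left ((hΦ.integral_comp_le hX hta k1 fun _ => abs_nonneg _).trans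
        (mul_le_mul_of_nonneg_left ((hΨ.integral_comp_le hZ hsa i1 fun _ => abs_nonneg _).trans
        (by gcongr)) hD0)) hD0)
  set a : ℝ := A ^ 2 * ((s * t) ^ 2 / τ ^ 2) + C₀ * ((s ^ 2 + s * t ^ 2) / τ) with ha
  have hpt : ∀ x, s * t * |Xop B F x| ≤ g1 (Ψ s (Φ t (Ψ (-s) x))) + g2 (Φ t (Ψ (-s) x))
      + g3 (Ψ (-s) x) + g4 x + a * G x := by
    intro x
    have hGx := h.nonneg hτ x
    set q := Φ t (Ψ (-s) x) with hq
    have hx : Ψ s (Φ (-t) q) = x := by rw [hq, hΦ.neg_apply hX, hΨ.apply_neg hZ]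
    have hE := hexp s t hs hs1 ht0 ht q
    rw [hx] at hE
    set T := Φ (-t) (Ψ s q) with hT
    have htri : |F T - F x| ≤ g1 (Ψ s q) + g2 q + g3 (Ψ (-s) x) + g4 x := by
      have e : F T - F x = (F (Φ (-t) (Ψ s q)) - F (Ψ s q)) + (F (Ψ s q) - F q)
        + (F (Φ t (Ψ (-s) x)) - F (Ψ (-s) x)) + (F (Ψ (-s) x) - F x) := by
        rw [← hT, ← hq]; ring
      rw [e]
      exact (abs_add_le _ _).trans (add_le_add_left ((abs_add_le _ _).trans
        (add_le_add_left (abs_add_le _ _) _)) _)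
    set w := T - x with hw
    have hr1 : s ^ 2 + s * t ^ 2 ≤ 2 * (s * t) := by nlinarith
    have hwn : ‖w‖ ≤ A * (s * t) := by
      have e : w = (w - (s * t) • B x) + (s * t) • B x := by abel
      rw [e]
      refine (norm_add_le _ _).trans ?_
      have : ‖(s * t) • B x‖ ≤ s * t * M := by
        rw [norm_smul, Real.norm_eq_abs, abs_of_nonneg hst0]
        exact mul_le_mul_of_nonneg_left (hB.norm_le x) hst0
      have : C₀ * (s ^ 2 + s * t ^ 2) ≤ C₀ * (2 * (s * t)) := by gcongr
      rw [hA]; linarith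
    have hwτ : ‖w‖ ≤ τ := by
      refine hwn.trans (le_trans ?_ hτst)
      gcongr
      have : 0 ≤ D ^ 4 := by positivity
      nlinarith [sq_nonneg A]
    have t1 := h.taylor hτ x w hwτ
    rw [hw, add_sub_cancel, ← hw] at t1
    have t2 : |fderiv ℝ F x (w - (s * t) • B x)| ≤ G x / τ * (C₀ * (s ^ 2 + s * t ^ 2)) := by
      have g0 := h.grad_le x 0 (by simpa using hτ.le)
      rw [add_zero] at g0
      refine ((fderiv ℝ F x).le_of_opNorm_le g0 _).trans ?_
      gcongr
    have t3 : G x * ‖w‖ ^ 2 / τ ^ 2 ≤ G x * (A * (s * t)) ^ 2 / τ ^ 2 := by gcongr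
    have e : s * t * Xop B F x = (F T - F x) - (F T - F x - fderiv ℝ F x w)
        - fderiv ℝ F x (w - (s * t) • B x) := by
      have e0 : fderiv ℝ F x (w - (s * t) • B x) = fderiv ℝ F x w - s * t * Xop B F x := by
        rw [map_sub, map_smul, smul_eq_mul, Xop]
      rw [e0]; ring
    rw [← abs_of_nonneg hst0, ← abs_mul, e]
    have := abs_sub ((F T - F x) - (F T - F x - fderiv ℝ F x w))
      (fderiv ℝ F x (w - (s * t) • B x))
    have := abs_sub (F T - F x) (F T - F x - fderiv ℝ F x w)
    have e2 : G x * (A * (s * t)) ^ 2 / τ ^ 2 + G x / τ * (C₀ * (s ^ 2 + s * t ^ 2)) = a * G x := by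
      rw [ha]; ring
    linarith
  have hBi := (integrable_Xop h.contDiff h.compact hB.diff.continuous).abs
  have h_int : s * t * ∫ x, |Xop B F x| ≤ (∫ x, g1 (Ψ s (Φ t (Ψ (-s) x))))
      + (∫ x, g2 (Φ t (Ψ (-s) x))) + (∫ x, g3 (Ψ (-s) x)) + (∫ x, g4 x) + a * ∫ x, G x := by
    rw [← integral_const_mul, ← integral_const_mul]
    exact integral_le_add_five (hBi.const_mul _) j1 j2 j3 i4 (hGi.const_mul a) hpt
  have hD4 : ∀ y, 0 ≤ y → D * y ≤ D ^ 4 * y ∧ D * (D * y) ≤ D ^ 4 * y ∧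
      D * (D * (D * y)) ≤ D ^ 4 * y ∧ D * (D * (D * (D * y))) ≤ D ^ 4 * y := by
    intro y hy
    have p2 : D ≤ D ^ 4 := le_self_pow₀ hD1 (by norm_num)
    have p3 : D ^ 2 ≤ D ^ 4 := pow_le_pow_right₀ hD1 (by norm_num)
    have p4 : D ^ 3 ≤ D ^ 4 := pow_le_pow_right₀ hD1 (by norm_num)
    have e2 : D * (D * y) = D ^ 2 * y := by ring
    have e3 : D * (D * (D * y)) = D ^ 3 * y := by ring
    have e4 : D * (D * (D * (D * y))) = D ^ 4 * y := by ring
    rw [e4, e3, e2]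
    exact ⟨by gcongr, by gcongr, by gcongr, le_rfl⟩
  have htX : 0 ≤ t * IX := mul_nonneg ht0 hIX
  have hsZ : 0 ≤ s * IZ := mul_nonneg hs hIZ
  have d1 := (hD4 _ htX).2.2.2
  have d3 := (hD4 _ htX).2.1
  have d2 := (hD4 _ hsZ).2.2.1
  have d4 := (hD4 _ hsZ).1
  have r1 : D * (D * (D * (t * (D * IX)))) = D * (D * (D * (D * (t * IX)))) := by ring
  have r3 : D * (t * (D * IX)) = D * (D * (t * IX)) := by ring
  have r2 : D * (D * (s * (D * IZ))) = D * (D * (D * (s * IZ))) := by ring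
  have r4 : s * (D * IZ) = D * (s * IZ) := by ring
  rw [r1] at c1; rw [r2] at c2; rw [r3] at c3; rw [r4] at b4
  have hP1 : 0 ≤ (s * t) ^ 2 / τ ^ 2 := by positivity
  have hP2 : 0 ≤ (s ^ 2 + s * t ^ 2) / τ := by positivity
  have ha2 : a * (∫ x, G x) ≤ (A ^ 2 + C₀) * (((s * t) ^ 2 / τ ^ 2 + (s ^ 2 + s * t ^ 2) / τ)
      * ∫ x, G x) := by
    rw [← mul_assoc]
    gcongr
    rw [ha]
    have : 0 ≤ A ^ 2 * ((s ^ 2 + s * t ^ 2) / τ) := by positivity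
    have : 0 ≤ C₀ * ((s * t) ^ 2 / τ ^ 2) := by positivity
    linarith
  set Q := ((s * t) ^ 2 / τ ^ 2 + (s ^ 2 + s * t ^ 2) / τ) * ∫ x, G x
  have hQ : 0 ≤ Q := by positivity
  have hD4n : 0 ≤ D ^ 4 := by positivity
  have hR : 0 ≤ t * IX + s * IZ := add_nonneg htX hsZ
  have q1 : 0 ≤ (A + A ^ 2 + C₀ + 1) * (t * IX + s * IZ) := by positivity
  have q2 : 0 ≤ (2 * D ^ 4 + A + 1) * Q := by positivity
  calc s * t * ∫ x, |Xop B F x| ≤ 2 * D ^ 4 * (t * IX + s * IZ) + (A ^ 2 + C₀) * Q := by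
        linarith only [h_int, c1, c2, c3, b4, d1, d2, d3, d4, ha2]
    _ ≤ _ := by linarith only [q1, q2]

end BracketStep

section Hoermander

variable {n m : ℕ}

/-- Smooth compactly supported vector fields. -/
structure TestField (Z : (Fin n → ℝ) → (Fin n → ℝ)) : Prop where
  contDiff : ContDiff ℝ ((⊤ : ℕ∞) : WithTop ℕ∞) Z
  compact : HasCompactSupport Z

lemma vfBracket_eq_fderiv {c d : (Fin n → ℝ) → (Fin n → ℝ)} {x : Fin n → ℝ}
    (hc : DifferentiableAt ℝ c x) (hd : DifferentiableAt ℝ d x) :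
    vfBracket c d x = fderiv ℝ d x (c x) - fderiv ℝ c x (d x) := by
  ext l
  simp only [vfBracket, Pi.sub_apply]
  rw [fderiv_apply hc l, fderiv_apply hd l]
  rfl

lemma natCast_le_smooth (k : ℕ) : (k : WithTop ℕ∞) ≤ ((⊤ : ℕ∞) : WithTop ℕ∞) :=
  WithTop.coe_le_coe.2 (le_top : (k : ℕ∞) ≤ ⊤)

namespace TestField

variable {Z c d : (Fin n → ℝ) → (Fin n → ℝ)}

lemma differentiable (h : TestField Z) : Differentiable ℝ Z :=
  h.contDiff.differentiable (by simp)

lemma exists_boundedField (h : TestField Z) : ∃ M, BoundedField Z M := by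
  obtain ⟨M₁, h₁⟩ := h.contDiff.continuous.bounded_above_of_compact_support h.compact
  have hf : ContDiff ℝ 1 (fderiv ℝ Z) := h.contDiff.fderiv_right (by rw [one_add_one_eq_two]; exact natCast_le_smooth 2)
  obtain ⟨M₂, h₂⟩ := hf.continuous.bounded_above_of_compact_support (h.compact.fderiv (𝕜 := ℝ))
  obtain ⟨M₃, h₃⟩ := ContDiff.lipschitzWith_of_hasCompactSupport (h.compact.fderiv (𝕜 := ℝ)) hf
    one_ne_zero
  refine ⟨max M₁ (max M₂ M₃), h.differentiable, fun x => (h₁ x).trans (le_max_left _ _),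
    fun x => (h₂ x).trans ((le_max_left _ _).trans (le_max_right _ _)), fun x y => ?_⟩
  have := h₃.dist_le_mul x y
  rw [dist_eq_norm, dist_eq_norm] at this
  refine this.trans ?_
  gcongr
  exact (le_max_right _ _).trans (le_max_right _ _)

lemma vfBracket_eq (hc : TestField c) (hd : TestField d) :
    (fun x => vfBracket c d x) = VectorField.lieBracket ℝ c d :=
  funext fun x => vfBracket_eq_fderiv (hc.differentiable x) (hd.differentiable x)

lemma bracket (hc : TestField c) (hd : TestField d) : TestField fun x => vfBracket c d x := by
  rw [hc.vfBracket_eq hd]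
  refine ⟨hc.contDiff.lieBracket_vectorField hd.contDiff (by simp), ?_⟩
  refine HasCompactSupport.intro hc.compact fun x hx => ?_
  simp [VectorField.lieBracket, image_eq_zero_of_notMem_tsupport hx,
    fderiv_of_notMem_tsupport ℝ hx]

lemma jacobi (hc : TestField c) (hd : TestField d) (hZ : TestField Z) :
    (fun x => vfBracket (fun x => vfBracket c d x) Z x) =
      fun x => vfBracket c (fun x => vfBracket d Z x) x
        - vfBracket d (fun x => vfBracket c Z x) x := by
  rw [(hc.bracket hd).vfBracket_eq hZ, hc.vfBracket_eq hd]
  funext x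
  have h1 := congrFun (hc.vfBracket_eq (hd.bracket hZ)) x
  have h2 := congrFun (hd.vfBracket_eq (hc.bracket hZ)) x
  beta_reduce at h1 h2
  rw [h1, h2, hd.vfBracket_eq hZ, hc.vfBracket_eq hZ]
  have := VectorField.leibniz_identity_lieBracket (𝕜 := ℝ) (n := ((⊤ : ℕ∞) : WithTop ℕ∞))
    (by simpa using natCast_le_smooth 2) hc.contDiff.contDiffAt hd.contDiff.contDiffAt hZ.contDiff.contDiffAt (x := x)
  rw [this]; abel

end TestField

/-- Fractional gain in the direction `Z`: `‖Z F‖₁ ≲ τ ^ (γ - 1)` for `F` controlled at scale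
`τ`, relative to the first order energy with respect to `X`. -/
def Gains (X : Fin m → (Fin n → ℝ) → (Fin n → ℝ)) (Z : (Fin n → ℝ) → (Fin n → ℝ)) : Prop :=
  ∃ γ : ℝ, 0 < γ ∧ γ ≤ 1 ∧ ∃ C ≥ (0 : ℝ), ∀ τ : ℝ, 0 < τ → τ ≤ 1 → ∀ F G, ScaleControl τ F G →
    ∫ x, |Xop Z F x| ≤ C * τ ^ (γ - 1) * ((∫ x, G x) + ∑ i, ∫ x, |Xop (X i) F x|)

variable {X : Fin m → (Fin n → ℝ) → (Fin n → ℝ)}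

lemma energy_nonneg {τ : ℝ} (hτ : 0 < τ) {F G : (Fin n → ℝ) → ℝ} (h : ScaleControl τ F G) :
    0 ≤ (∫ x, G x) + ∑ i, ∫ x, |Xop (X i) F x| :=
  add_nonneg (integral_nonneg fun x => h.nonneg hτ x)
    (Finset.sum_nonneg fun _ _ => integral_nonneg fun _ => abs_nonneg _)

lemma integral_le_energy {τ : ℝ} (hτ : 0 < τ) {F G : (Fin n → ℝ) → ℝ} (h : ScaleControl τ F G)
    (i : Fin m) :
    ∫ x, |Xop (X i) F x| ≤ (∫ x, G x) + ∑ i, ∫ x, |Xop (X i) F x| := by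
  have h1 : 0 ≤ ∫ x, G x := integral_nonneg fun x => h.nonneg hτ x
  have := Finset.single_le_sum (f := fun i => ∫ x, |Xop (X i) F x|)
    (fun _ _ => integral_nonneg fun _ => abs_nonneg _) (Finset.mem_univ i)
  beta_reduce at this
  linarith

lemma gains_self (i : Fin m) : Gains X (X i) := by
  refine ⟨1, one_pos, le_rfl, 1, zero_le_one, fun τ hτ _ F G h => ?_⟩
  simpa using integral_le_energy hτ h i

lemma Gains.sub {Z₁ Z₂ : (Fin n → ℝ) → (Fin n → ℝ)} (h₁ : Gains X Z₁) (h₂ : Gains X Z₂)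
    (hc₁ : Continuous Z₁) (hc₂ : Continuous Z₂) : Gains X fun x => Z₁ x - Z₂ x := by
  obtain ⟨γ₁, p₁, q₁, C₁, r₁, k₁⟩ := h₁
  obtain ⟨γ₂, p₂, q₂, C₂, r₂, k₂⟩ := h₂
  refine ⟨min γ₁ γ₂, lt_min p₁ p₂, (min_le_left _ _).trans q₁, C₁ + C₂, add_nonneg r₁ r₂,
    fun τ hτ hτ1 F G h => ?_⟩
  have hN := energy_nonneg (X := X) hτ h
  have e₁ : τ ^ (γ₁ - 1) ≤ τ ^ (min γ₁ γ₂ - 1) :=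
    Real.rpow_le_rpow_of_exponent_ge hτ hτ1 (by linarith [min_le_left γ₁ γ₂])
  have e₂ : τ ^ (γ₂ - 1) ≤ τ ^ (min γ₁ γ₂ - 1) :=
    Real.rpow_le_rpow_of_exponent_ge hτ hτ1 (by linarith [min_le_right γ₁ γ₂])
  have i₁ := (integrable_Xop h.contDiff h.compact hc₁).abs
  have i₂ := (integrable_Xop h.contDiff h.compact hc₂).abs
  have l₁ := (k₁ τ hτ hτ1 F G h).trans (by gcongr :
    _ ≤ C₁ * τ ^ (min γ₁ γ₂ - 1) * ((∫ x, G x) + ∑ i, ∫ x, |Xop (X i) F x|))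
  have l₂ := (k₂ τ hτ hτ1 F G h).trans (by gcongr :
    _ ≤ C₂ * τ ^ (min γ₁ γ₂ - 1) * ((∫ x, G x) + ∑ i, ∫ x, |Xop (X i) F x|))
  calc ∫ x, |Xop (fun x => Z₁ x - Z₂ x) F x| ≤ ∫ x, (|Xop Z₁ F x| + |Xop Z₂ F x|) := by
        refine integral_mono (integrable_Xop h.contDiff h.compact (hc₁.sub hc₂)).abs (i₁.add i₂)
          fun x => ?_
        simp only [Xop, map_sub]
        exact abs_sub _ _
    _ = (∫ x, |Xop Z₁ F x|) + ∫ x, |Xop Z₂ F x| := integral_add i₁ i₂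
    _ ≤ _ := (add_le_add l₁ l₂).trans (le_of_eq (by ring))

lemma Gains.bracket {Z : (Fin n → ℝ) → (Fin n → ℝ)} (hX : ∀ i, TestField (X i))
    (hZ : TestField Z) (h : Gains X Z) (i : Fin m) : Gains X fun x => vfBracket (X i) Z x := by
  obtain ⟨γ, hγ, hγ1, C₁, hC₁, hP⟩ := h
  obtain ⟨M₁, hM₁⟩ := (hX i).exists_boundedField
  obtain ⟨M₂, hM₂⟩ := hZ.exists_boundedField
  obtain ⟨M₃, hM₃⟩ := ((hX i).bracket hZ).exists_boundedField
  set M := max M₁ (max M₂ M₃)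
  obtain ⟨C, hC, hK⟩ := integral_bracket_le (M := M) (hM₁.mono (le_max_left _ _))
    (hM₂.mono ((le_max_left _ _).trans (le_max_right _ _)))
    (hM₃.mono ((le_max_right _ _).trans (le_max_right _ _)))
    (fun x => vfBracket_eq_fderiv ((hX i).differentiable x) (hZ.differentiable x))
  set κ : ℝ := 1 / (C + 1) with hκ
  have hκ0 : 0 < κ := by positivity
  have hκ1 : κ ≤ 1 := by rw [hκ, div_le_one (by positivity)]; linarith
  have hCκ : C * κ ≤ 1 := by rw [hκ, mul_one_div, div_le_one (by positivity)]; linarith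
  refine ⟨γ / 4, by positivity, by linarith, C * (4 + C₁) / κ, by positivity,
    fun τ hτ hτ1 F G h => ?_⟩
  set N := (∫ x, G x) + ∑ i, ∫ x, |Xop (X i) F x| with hN
  have hN0 : 0 ≤ N := energy_nonneg hτ h
  set u := τ ^ (γ / 4) with hu
  have hu0 : 0 < u := Real.rpow_pos_of_pos hτ _
  have hu1 : u ≤ 1 := Real.rpow_le_one hτ.le hτ1 (by positivity)
  have hu4 : u ^ 4 = τ ^ γ := by
    rw [hu, ← Real.rpow_natCast, ← Real.rpow_mul hτ.le]; congr 1; push_cast; ring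
  have hτu : τ ≤ u ^ 4 := by
    rw [hu4]
    calc τ = τ ^ (1 : ℝ) := (Real.rpow_one τ).symm
      _ ≤ τ ^ γ := Real.rpow_le_rpow_of_exponent_ge hτ hτ1 hγ1
  have e1 : τ ^ (γ - 1) = u ^ 4 / τ := by rw [Real.rpow_sub_one hτ.ne', hu4]
  have e2 : τ ^ (γ / 4 - 1) = u / τ := by rw [Real.rpow_sub_one hτ.ne']
  have hZb := hP τ hτ hτ1 F G h
  have hXb := integral_le_energy (X := X) hτ h i
  have hGb : ∫ x, G x ≤ N := by
    have : 0 ≤ ∑ i, ∫ x, |Xop (X i) F x| :=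
      Finset.sum_nonneg fun _ _ => integral_nonneg fun _ => abs_nonneg _
    linarith
  rw [e1] at hZb
  rw [e2]
  have hu3 : u ^ 4 ≤ u ^ 3 := pow_le_pow_of_le_one hu0.le hu1 (by norm_num)
  have hs : κ * τ / u ≤ u ^ 2 := by
    rw [div_le_iff₀ hu0]
    calc κ * τ ≤ 1 * u ^ 3 := by gcongr; linarith
      _ = _ := by ring
  have hst : κ * τ / u * u ^ 2 = κ * τ * u := by field_simp
  have hb := hK (κ * τ / u) (u ^ 2) (by positivity) hs (pow_le_one₀ hu0.le hu1) τ hτ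
    (by
      rw [hst]
      calc C * (κ * τ * u) = C * κ * (τ * u) := by ring
        _ ≤ 1 * (τ * 1) := by gcongr
        _ = τ := by ring) F G h
  rw [hst] at hb
  set I := ∫ x, |Xop (fun x => vfBracket (X i) Z x) F x| with hI
  have hQ : (κ * τ * u) ^ 2 / τ ^ 2 + ((κ * τ / u) ^ 2 + κ * τ / u * (u ^ 2) ^ 2) / τ
      ≤ 3 * u ^ 2 := by
    have f1 : (κ * τ * u) ^ 2 / τ ^ 2 = κ ^ 2 * u ^ 2 := by field_simp
    have f2 : ((κ * τ / u) ^ 2 + κ * τ / u * (u ^ 2) ^ 2) / τ = κ ^ 2 * (τ / u ^ 2) + κ * u ^ 3 := by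
      field_simp
    have f3 : τ / u ^ 2 ≤ u ^ 2 := by rw [div_le_iff₀ (by positivity)]; linarith
    have f4 : u ^ 3 ≤ u ^ 2 := pow_le_pow_of_le_one hu0.le hu1 (by norm_num)
    have f5 : κ ^ 2 ≤ 1 := pow_le_one₀ hκ0.le hκ1
    have f6 : κ ^ 2 * u ^ 2 ≤ 1 * u ^ 2 := by gcongr
    have f7 : κ ^ 2 * (τ / u ^ 2) ≤ 1 * u ^ 2 := by gcongr
    have f8 : κ * u ^ 3 ≤ 1 * u ^ 2 := by gcongr
    rw [f1, f2]; linarith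
  have hZ2 : κ * τ / u * ∫ x, |Xop Z F x| ≤ C₁ * u ^ 2 * N := by
    calc κ * τ / u * ∫ x, |Xop Z F x| ≤ κ * τ / u * (C₁ * (u ^ 4 / τ) * N) := by gcongr
      _ = κ * (C₁ * u ^ 3 * N) := by field_simp
      _ ≤ 1 * (C₁ * u ^ 2 * N) := by
        have f4 : u ^ 3 ≤ u ^ 2 := pow_le_pow_of_le_one hu0.le hu1 (by norm_num)
        gcongr
      _ = _ := one_mul _
  have hG0 : 0 ≤ ∫ x, G x := integral_nonneg fun x => h.nonneg hτ x
  have hfin : κ * τ * u * I ≤ C * ((4 + C₁) * u ^ 2 * N) := by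
    refine hb.trans (mul_le_mul_of_nonneg_left ?_ hC.le)
    have g1 : u ^ 2 * (∫ x, |Xop (X i) F x|) ≤ u ^ 2 * N := by gcongr
    have g2 := mul_le_mul hQ hGb hG0 (by positivity)
    linarith
  have : I ≤ C * ((4 + C₁) * u ^ 2 * N) / (κ * τ * u) := by
    rw [le_div_iff₀ (by positivity)]; linarith
  refine this.trans (le_of_eq ?_)
  field_simp

lemma LieGen.testField (hX : ∀ i, TestField (X i)) {c : (Fin n → ℝ) → (Fin n → ℝ)}
    (hc : LieGen X c) : TestField c := by
  induction hc with
  | base i => exact hX i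
  | bracket _ _ h₁ h₂ => exact h₁.bracket h₂

lemma LieGen.gains (hX : ∀ i, TestField (X i)) {c : (Fin n → ℝ) → (Fin n → ℝ)}
    (hc : LieGen X c) :
    Gains X c ∧ ∀ Z, TestField Z → Gains X Z → Gains X fun x => vfBracket c Z x := by
  induction hc with
  | base i => exact ⟨gains_self i, fun Z hZ h => h.bracket hX hZ i⟩
  | @bracket c d hc hd ihc ihd =>
    have tc := hc.testField hX
    have td := hd.testField hX
    refine ⟨ihc.2 d td ihd.1, fun Z hZ h => ?_⟩
    have a := ihc.2 _ (td.bracket hZ) (ihd.2 Z hZ h)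
    have b := ihd.2 _ (tc.bracket hZ) (ihc.2 Z hZ h)
    have := a.sub b (tc.bracket (td.bracket hZ)).contDiff.continuous
      (td.bracket (tc.bracket hZ)).contDiff.continuous
    rwa [tc.jacobi td hZ]

end Hoermander

section Divergence

variable {n m : ℕ}

/-- The divergence of a vector field. -/
noncomputable def divField (Z : (Fin n → ℝ) → (Fin n → ℝ)) (x : Fin n → ℝ) : ℝ :=
  ∑ j, fderiv ℝ (fun y => Z y j) x (Pi.single j 1)

variable {Z : (Fin n → ℝ) → (Fin n → ℝ)}

lemma Xop_eq_sum (h : (Fin n → ℝ) → ℝ) (x : Fin n → ℝ) :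
    Xop Z h x = ∑ j, Z x j * fderiv ℝ h x (Pi.single j 1) := by
  rw [Xop]
  conv_lhs => rw [pi_eq_sum_univ' (Z x)]
  rw [map_sum]
  refine Finset.sum_congr rfl fun j _ => ?_
  rw [map_smul, smul_eq_mul]

lemma TestField.apply_contDiff (hZ : TestField Z) (j : Fin n) :
    ContDiff ℝ ((⊤ : ℕ∞) : WithTop ℕ∞) fun y => Z y j :=
  contDiff_pi.1 hZ.contDiff j

lemma TestField.continuous_divField (hZ : TestField Z) : Continuous (divField Z) :=
  continuous_finsetSum _ fun j _ =>
    ((hZ.apply_contDiff j).continuous_fderiv (by simp)).clm_apply continuous_const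

lemma TestField.exists_abs_divField_le (hZ : TestField Z) : ∃ D ≥ (0 : ℝ), ∀ x, |divField Z x| ≤ D := by
  have hc : HasCompactSupport (divField Z) := by
    refine HasCompactSupport.intro hZ.compact fun x hx => ?_
    refine Finset.sum_eq_zero fun j _ => ?_
    rw [fderiv_apply (hZ.differentiable x) j, fderiv_of_notMem_tsupport ℝ hx]
    simp
  obtain ⟨D, hD⟩ := hZ.continuous_divField.bounded_above_of_compact_support hc
  exact ⟨D, (norm_nonneg _).trans (hD 0), hD⟩

lemma TestField.integral_Xop (hZ : TestField Z) {h : (Fin n → ℝ) → ℝ} (hh : ContDiff ℝ 1 h)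
    (hc : HasCompactSupport h) : ∫ x, Xop Z h x = - ∫ x, divField Z x * h x := by
  have hcf : HasCompactSupport (fderiv ℝ h) := hc.fderiv (𝕜 := ℝ)
  have cf := hh.continuous_fderiv one_ne_zero
  have i1 : ∀ j : Fin n, Integrable fun x => Z x j * fderiv ℝ h x (Pi.single j 1) := fun j => by
    refine Continuous.integrable_of_hasCompactSupport
      ((hZ.apply_contDiff j).continuous.mul (cf.clm_apply continuous_const)) ?_
    exact hcf.mono fun x hx => by
      contrapose! hx
      have : fderiv ℝ h x = 0 := by simpa using hx
      simp [this]
  have i2 : ∀ j : Fin n, Integrable fun x => fderiv ℝ (fun y => Z y j) x (Pi.single j 1) * h x :=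
    fun j => by
      refine Continuous.integrable_of_hasCompactSupport
        ((((hZ.apply_contDiff j).continuous_fderiv (by simp)).clm_apply continuous_const).mul
          hh.continuous) hc.mul_left
  have i3 : ∀ j : Fin n, Integrable fun x => Z x j * h x := fun j =>
    Continuous.integrable_of_hasCompactSupport
      ((hZ.apply_contDiff j).continuous.mul hh.continuous) hc.mul_left
  calc ∫ x, Xop Z h x = ∫ x, ∑ j, Z x j * fderiv ℝ h x (Pi.single j 1) := by
        simp_rw [Xop_eq_sum]
    _ = ∑ j, ∫ x, Z x j * fderiv ℝ h x (Pi.single j 1) := integral_finsetSum _ fun j _ => i1 j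
    _ = ∑ j, - ∫ x, fderiv ℝ (fun y => Z y j) x (Pi.single j 1) * h x := by
        refine Finset.sum_congr rfl fun j _ => ?_
        exact integral_mul_fderiv_eq_neg_fderiv_mul_of_integrable (i2 j) (i1 j) (i3 j)
          (fun x _ => (hZ.apply_contDiff j).differentiable (by simp) x)
          (fun x _ => hh.differentiable one_ne_zero x)
    _ = _ := by
        rw [Finset.sum_neg_distrib, ← integral_finsetSum _ fun j _ => i2 j]
        simp_rw [divField, Finset.sum_mul]

end Divergence

section Spanning

variable {n m : ℕ} {X : Fin m → (Fin n → ℝ) → (Fin n → ℝ)}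

lemma exists_list_spanning (hX : ∀ i, TestField (X i)) {K : Set (Fin n → ℝ)} (hK : IsCompact K)
    (hspan : ∀ x ∈ K, Submodule.span ℝ {v : Fin n → ℝ | ∃ c, LieGen X c ∧ c x = v} = ⊤) :
    ∃ L : List ((Fin n → ℝ) → (Fin n → ℝ)), (∀ c ∈ L, LieGen X c) ∧ ∃ δ > (0 : ℝ),
      ∀ x ∈ K, ∀ l : (Fin n → ℝ) →L[ℝ] ℝ, δ * ‖l‖ ≤ (L.map fun c => |l (c x)|).sum := by
  have hnn : ∀ (L : List ((Fin n → ℝ) → (Fin n → ℝ))) (x : Fin n → ℝ)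
      (l : (Fin n → ℝ) →L[ℝ] ℝ), 0 ≤ (L.map fun c => |l (c x)|).sum := fun L x l =>
    List.sum_nonneg fun a ha => by
      obtain ⟨c, _, rfl⟩ := List.mem_map.1 ha
      exact abs_nonneg _
  have : ProperSpace ((Fin n → ℝ) →L[ℝ] ℝ) := FiniteDimensional.proper ℝ _
  have hS : IsCompact (K ×ˢ Metric.sphere (0 : (Fin n → ℝ) →L[ℝ] ℝ) 1) :=
    hK.prod (isCompact_sphere _ _)
  have key : ∃ L : List ((Fin n → ℝ) → (Fin n → ℝ)), (∀ c ∈ L, LieGen X c) ∧ ∃ δ > (0 : ℝ),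
      ∀ p ∈ K ×ˢ Metric.sphere (0 : (Fin n → ℝ) →L[ℝ] ℝ) 1,
        δ ≤ (L.map fun c => |p.2 (c p.1)|).sum := by
    refine hS.induction_on (p := fun s => ∃ L : List ((Fin n → ℝ) → (Fin n → ℝ)),
      (∀ c ∈ L, LieGen X c) ∧ ∃ δ > (0 : ℝ), ∀ p ∈ s, δ ≤ (L.map fun c => |p.2 (c p.1)|).sum)
      ?_ ?_ ?_ ?_
    · exact ⟨[], by simp, 1, one_pos, by simp⟩
    · rintro s t hst ⟨L, hL, δ, hδ, h⟩
      exact ⟨L, hL, δ, hδ, fun p hp => h p (hst hp)⟩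
    · rintro s t ⟨L, hL, δ, hδ, h⟩ ⟨L', hL', δ', hδ', h'⟩
      refine ⟨L ++ L', fun c hc => (List.mem_append.1 hc).elim (hL c) (hL' c), min δ δ',
        lt_min hδ hδ', fun p hp => ?_⟩
      rw [List.map_append, List.sum_append]
      have a := hnn L p.1 p.2
      have b := hnn L' p.1 p.2
      rcases hp with hp | hp
      · have := h p hp; have := min_le_left δ δ'; linarith
      · have := h' p hp; have := min_le_right δ δ'; linarith
    · rintro ⟨x, l⟩ ⟨hx, hl⟩
      have hl0 : l ≠ 0 := by
        rintro rfl
        simp at hl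
      obtain ⟨c, hc, hne⟩ : ∃ c, LieGen X c ∧ l (c x) ≠ 0 := by
        by_contra! hcon
        apply hl0
        have : (l : (Fin n → ℝ) →ₗ[ℝ] ℝ) = 0 :=
          LinearMap.ext_on (hspan x hx) (by rintro v ⟨c, hc, rfl⟩; simpa using hcon c hc)
        exact ContinuousLinearMap.coe_injective this
      have hcont : Continuous fun p : (Fin n → ℝ) × ((Fin n → ℝ) →L[ℝ] ℝ) => |p.2 (c p.1)| :=
        (continuous_snd.clm_apply
          ((hc.testField hX).contDiff.continuous.comp continuous_fst)).abs
      have hpos : 0 < |l (c x)| := abs_pos.2 hne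
      refine ⟨{p | |l (c x)| / 2 < |p.2 (c p.1)|}, mem_nhdsWithin_of_mem_nhds
        ((isOpen_lt continuous_const hcont).mem_nhds (by simpa using half_lt_self hpos)),
        [c], by simpa using hc, |l (c x)| / 2, by positivity, fun p hp => ?_⟩
      simpa using (show |l (c x)| / 2 < |p.2 (c p.1)| from hp).le
  obtain ⟨L, hL, δ, hδ, h⟩ := key
  refine ⟨L, hL, δ, hδ, fun x hx l => ?_⟩
  rcases eq_or_ne l 0 with rfl | hl
  · simp
  have hl0 : 0 < ‖l‖ := norm_pos_iff.2 hl
  have := h (x, ‖l‖⁻¹ • l) ⟨hx, by simp [norm_smul, hl0.ne']⟩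
  have e : (L.map fun c => |(‖l‖⁻¹ • l) (c x)|).sum = ‖l‖⁻¹ * (L.map fun c => |l (c x)|).sum := by
    rw [← List.sum_map_mul_left]
    simp [abs_mul]
  rw [e, inv_mul_eq_div, le_div_iff₀ hl0] at this
  exact this

lemma exists_gain_list (hX : ∀ i, TestField (X i)) (L : List ((Fin n → ℝ) → (Fin n → ℝ)))
    (hL : ∀ c ∈ L, LieGen X c) :
    ∃ γ : ℝ, 0 < γ ∧ γ ≤ 1 ∧ ∃ C ≥ (0 : ℝ), ∀ τ : ℝ, 0 < τ → τ ≤ 1 → ∀ F G, ScaleControl τ F G →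
      Integrable (fun x => (L.map fun c => |fderiv ℝ F x (c x)|).sum) ∧
      ∫ x, (L.map fun c => |fderiv ℝ F x (c x)|).sum
        ≤ C * τ ^ (γ - 1) * ((∫ x, G x) + ∑ i, ∫ x, |Xop (X i) F x|) := by
  induction L with
  | nil =>
    refine ⟨1, one_pos, le_rfl, 0, le_rfl, fun τ hτ hτ1 F G h => ?_⟩
    simp
  | cons c L ih =>
    obtain ⟨γ₁, p₁, q₁, C₁, r₁, k₁⟩ := ih fun d hd => hL d (List.mem_cons_of_mem _ hd)
    have hc := hL c List.mem_cons_self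
    obtain ⟨γ₂, p₂, q₂, C₂, r₂, k₂⟩ := (hc.gains hX).1
    refine ⟨min γ₁ γ₂, lt_min p₁ p₂, (min_le_left _ _).trans q₁, C₁ + C₂, add_nonneg r₁ r₂,
      fun τ hτ hτ1 F G h => ?_⟩
    have hN := energy_nonneg (X := X) hτ h
    have e₁ : τ ^ (γ₁ - 1) ≤ τ ^ (min γ₁ γ₂ - 1) :=
      Real.rpow_le_rpow_of_exponent_ge hτ hτ1 (by linarith [min_le_left γ₁ γ₂])
    have e₂ : τ ^ (γ₂ - 1) ≤ τ ^ (min γ₁ γ₂ - 1) :=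
      Real.rpow_le_rpow_of_exponent_ge hτ hτ1 (by linarith [min_le_right γ₁ γ₂])
    have i₂ : Integrable fun x => |fderiv ℝ F x (c x)| :=
      (integrable_Xop h.contDiff h.compact (hc.testField hX).contDiff.continuous).abs
    obtain ⟨i₁, k₁⟩ := k₁ τ hτ hτ1 F G h
    have l₁ := k₁.trans (by gcongr :
      _ ≤ C₁ * τ ^ (min γ₁ γ₂ - 1) * ((∫ x, G x) + ∑ i, ∫ x, |Xop (X i) F x|))
    have l₂ := (k₂ τ hτ hτ1 F G h).trans (by gcongr :
      _ ≤ C₂ * τ ^ (min γ₁ γ₂ - 1) * ((∫ x, G x) + ∑ i, ∫ x, |Xop (X i) F x|))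
    simp only [List.map_cons, List.sum_cons]
    refine ⟨i₂.add i₁, ?_⟩
    rw [integral_add i₂ i₁]
    exact (add_le_add l₂ l₁).trans (le_of_eq (by ring))

/-- Full gradient gain under Hörmander's condition. -/
lemma exists_gradient_gain (hX : ∀ i, TestField (X i)) {K : Set (Fin n → ℝ)} (hK : IsCompact K)
    (hspan : ∀ x ∈ K, Submodule.span ℝ {v : Fin n → ℝ | ∃ c, LieGen X c ∧ c x = v} = ⊤) :
    ∃ γ : ℝ, 0 < γ ∧ γ ≤ 1 ∧ ∃ C ≥ (0 : ℝ), ∀ τ : ℝ, 0 < τ → τ ≤ 1 → ∀ F G, ScaleControl τ F G →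
      tsupport F ⊆ K →
      ∫ x, ‖fderiv ℝ F x‖ ≤ C * τ ^ (γ - 1) * ((∫ x, G x) + ∑ i, ∫ x, |Xop (X i) F x|) := by
  obtain ⟨L, hL, δ, hδ, hsp⟩ := exists_list_spanning hX hK hspan
  obtain ⟨γ, p, q, C, r, k⟩ := exists_gain_list hX L hL
  refine ⟨γ, p, q, C / δ, by positivity, fun τ hτ hτ1 F G h hF => ?_⟩
  obtain ⟨hi, hle⟩ := k τ hτ hτ1 F G h
  have hfi : Integrable fun x => ‖fderiv ℝ F x‖ :=
    ((h.contDiff.continuous_fderiv one_ne_zero).integrable_of_hasCompactSupport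
      (h.compact.fderiv (𝕜 := ℝ))).norm
  have : δ * ∫ x, ‖fderiv ℝ F x‖ ≤ ∫ x, (L.map fun c => |fderiv ℝ F x (c x)|).sum := by
    rw [← integral_const_mul]
    refine integral_mono (hfi.const_mul _) hi fun x => ?_
    by_cases hx : x ∈ K
    · exact hsp x hx _
    · rw [fderiv_of_notMem_tsupport ℝ fun h => hx (hF h)]
      simp
  rw [div_mul_eq_mul_div, div_mul_eq_mul_div, le_div_iff₀ hδ]
  linarith

end Spanning

section Kernel

variable {n : ℕ}

/-- A smooth averaging kernel at scale `τ`. -/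
structure IsKernel (L τ : ℝ) (k : (Fin n → ℝ) → ℝ) : Prop where
  contDiff : ContDiff ℝ ((⊤ : ℕ∞) : WithTop ℕ∞) k
  nonneg : ∀ x, 0 ≤ k x
  eq_zero : ∀ x, τ < ‖x‖ → k x = 0
  integral : ∫ x, k x = 1
  le : ∀ x, k x ≤ L / τ ^ n
  fderiv_le : ∀ x, ‖fderiv ℝ k x‖ ≤ L / τ ^ (n + 1)
  fderiv_lip : ∀ x y, ‖fderiv ℝ k x - fderiv ℝ k y‖ ≤ L / τ ^ (n + 2) * ‖x - y‖

lemma exists_kernel (n : ℕ) : ∃ L ≥ (0 : ℝ), ∃ k : ℝ → (Fin n → ℝ) → ℝ,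
    ∀ τ > 0, IsKernel L τ (k τ) := by
  let φ : ContDiffBump (0 : Fin n → ℝ) := ⟨1 / 2, 1, by norm_num, by norm_num⟩
  let ρ : (Fin n → ℝ) → ℝ := φ.normed volume
  have hρ : ContDiff ℝ ((⊤ : ℕ∞) : WithTop ℕ∞) ρ := φ.contDiff_normed
  have hρc : HasCompactSupport ρ := φ.hasCompactSupport_normed
  have h1 : ContDiff ℝ 1 (fderiv ℝ ρ) := hρ.fderiv_right (by exact_mod_cast natCast_le_smooth 2)
  obtain ⟨A, hA⟩ := hρ.continuous.bounded_above_of_compact_support hρc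
  obtain ⟨B, hB⟩ := h1.continuous.bounded_above_of_compact_support (hρc.fderiv (𝕜 := ℝ))
  obtain ⟨D, hD⟩ := h1.lipschitzWith_of_hasCompactSupport (hρc.fderiv (𝕜 := ℝ)) one_ne_zero
  have hA0 := (norm_nonneg _).trans (hA 0)
  have hB0 := (norm_nonneg _).trans (hB 0)
  refine ⟨A + B + D, by positivity, fun τ x => (τ ^ n)⁻¹ * ρ (τ⁻¹ • x), fun τ hτ => ?_⟩
  have hd : ∀ x, fderiv ℝ (fun x => (τ ^ n)⁻¹ * ρ (τ⁻¹ • x)) x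
      = ((τ ^ n)⁻¹ * τ⁻¹) • fderiv ℝ ρ (τ⁻¹ • x) := fun x => by
    have e : HasFDerivAt (fun x => ρ (τ⁻¹ • x)) (τ⁻¹ • fderiv ℝ ρ (τ⁻¹ • x)) x := by
      have := ((hρ.differentiable (by simp)) (τ⁻¹ • x)).hasFDerivAt.comp x
        ((hasFDerivAt_id x).const_smul τ⁻¹)
      exact this.congr_fderiv (by ext v; simp)
    rw [(e.const_mul _).fderiv, smul_smul]
  refine ⟨contDiff_const.mul (hρ.comp (contDiff_const_smul _)),
    fun x => mul_nonneg (by positivity) (φ.nonneg_normed _), fun x hx => ?_, ?_, fun x => ?_,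
    fun x => ?_, fun x y => ?_⟩
  · have : τ⁻¹ • x ∉ Function.support ρ := by
      rw [φ.support_normed_eq]
      simp only [Metric.mem_ball, dist_zero_right, norm_smul, norm_inv, Real.norm_eq_abs,
        abs_of_pos hτ, not_lt]
      show (1 : ℝ) ≤ _
      rw [inv_mul_eq_div, le_div_iff₀ hτ]
      linarith
    show (τ ^ n)⁻¹ * ρ (τ⁻¹ • x) = 0
    rw [Function.notMem_support.1 this, mul_zero]
  · rw [integral_const_mul, Measure.integral_comp_smul]
    have : ∫ x, ρ x = 1 := φ.integral_normed
    rw [this]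
    simp [abs_of_pos hτ]
    field_simp
  · show (τ ^ n)⁻¹ * ρ (τ⁻¹ • x) ≤ _
    rw [div_eq_inv_mul]
    gcongr
    have := (le_abs_self _).trans (hA (τ⁻¹ • x))
    have : (0:ℝ) ≤ D := D.2
    linarith
  · rw [hd, norm_smul, div_eq_inv_mul, Real.norm_of_nonneg (by positivity), pow_succ, mul_inv]
    gcongr
    have := hB (τ⁻¹ • x)
    have : (0:ℝ) ≤ D := D.2
    linarith
  · have e : ((τ ^ n)⁻¹ * τ⁻¹) • fderiv ℝ ρ (τ⁻¹ • x) - ((τ ^ n)⁻¹ * τ⁻¹) • fderiv ℝ ρ (τ⁻¹ • y)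
        = ((τ ^ n)⁻¹ * τ⁻¹) • (fderiv ℝ ρ (τ⁻¹ • x) - fderiv ℝ ρ (τ⁻¹ • y)) := by
      ext v; simp; ring
    rw [hd, hd, e, norm_smul, Real.norm_of_nonneg (by positivity)]
    have := hD.norm_sub_le (τ⁻¹ • x) (τ⁻¹ • y)
    rw [← smul_sub, norm_smul, Real.norm_of_nonneg (by positivity)] at this
    calc _ ≤ (τ ^ n)⁻¹ * τ⁻¹ * (D * (τ⁻¹ * ‖x - y‖)) := by gcongr
      _ = D / τ ^ (n + 2) * ‖x - y‖ := by field_simp; ring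
      _ ≤ _ := by gcongr; linarith

namespace IsKernel

variable {L τ : ℝ} {k : (Fin n → ℝ) → ℝ}

lemma hasCompactSupport (hk : IsKernel L τ k) : HasCompactSupport k :=
  HasCompactSupport.intro (isCompact_closedBall (0 : Fin n → ℝ) τ) fun x hx =>
    hk.eq_zero x (by simpa using hx)

lemma integrable (hk : IsKernel L τ k) : Integrable k :=
  hk.contDiff.continuous.integrable_of_hasCompactSupport hk.hasCompactSupport

lemma fderiv_eq_zero (hk : IsKernel L τ k) {x : Fin n → ℝ} (hx : τ < ‖x‖) : fderiv ℝ k x = 0 := by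
  have : k =ᶠ[𝓝 x] fun _ => 0 := by
    filter_upwards [(isOpen_lt continuous_const continuous_norm).mem_nhds hx] with y hy
    exact hk.eq_zero y hy
  rw [this.fderiv_eq]; simp

end IsKernel

end Kernel

section Mollification

variable {n m : ℕ} {L τ : ℝ} {k f : (Fin n → ℝ) → ℝ}

/-- Mollification of `f` by the kernel `k`. -/
noncomputable def moll (k f : (Fin n → ℝ) → ℝ) (x : Fin n → ℝ) : ℝ :=
  ∫ t, f t * k (x - t)

lemma moll_eq_convolution (k f : (Fin n → ℝ) → ℝ) :
    moll k f = convolution f k (ContinuousLinearMap.mul ℝ ℝ) volume := rfl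

lemma integrable_moll {k f : (Fin n → ℝ) → ℝ} (hf : Integrable f) (hk : Integrable k) :
    Integrable (moll k f) :=
  hf.integrable_convolution (ContinuousLinearMap.mul ℝ ℝ) hk

lemma integral_moll {k f : (Fin n → ℝ) → ℝ} (hf : Integrable f) (hk : Integrable k) :
    ∫ x, moll k f x = (∫ x, f x) * ∫ x, k x :=
  integral_convolution (ContinuousLinearMap.mul ℝ ℝ) hf hk

lemma moll_swap (k f : (Fin n → ℝ) → ℝ) (x : Fin n → ℝ) :
    moll k f x = ∫ t, f (x - t) * k t := by
  rw [moll_eq_convolution, convolution_mul_swap]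

lemma moll_comm {k₁ k₂ : (Fin n → ℝ) → ℝ} (hf : Continuous f) (hfc : HasCompactSupport f)
    (h₁ : Continuous k₁) (h₁c : HasCompactSupport k₁) (h₂ : Continuous k₂)
    (h₂c : HasCompactSupport k₂) : moll k₁ (moll k₂ f) = moll k₂ (moll k₁ f) := by
  have assoc : ∀ {a b : (Fin n → ℝ) → ℝ}, Continuous a → HasCompactSupport a → Continuous b →
      HasCompactSupport b → moll a (moll b f) = moll (moll a b) f := by
    intro a b ha hac hb hbc
    funext x
    simp only [moll_eq_convolution]
    refine convolution_assoc (L := ContinuousLinearMap.mul ℝ ℝ) (L₂ := ContinuousLinearMap.mul ℝ ℝ)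
      (L₃ := ContinuousLinearMap.mul ℝ ℝ) (L₄ := ContinuousLinearMap.mul ℝ ℝ)
      (fun x y z => by simp [mul_assoc]) hf.aestronglyMeasurable hb.aestronglyMeasurable
      ha.aestronglyMeasurable (Eventually.of_forall fun y => ?_) (Eventually.of_forall fun y => ?_)
      ?_
    · exact hbc.convolutionExists_right _ (hf.locallyIntegrable) hb y
    · exact hac.norm.convolutionExists_right _ hb.norm.locallyIntegrable ha.norm y
    · refine HasCompactSupport.convolutionExists_left _ hfc.norm hf.norm ?_ x
      exact (hac.norm.continuous_convolution_right _ hb.norm.locallyIntegrable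
        ha.norm).locallyIntegrable
  rw [assoc h₁ h₁c h₂ h₂c, assoc h₂ h₂c h₁ h₁c]
  congr 1
  funext x
  rw [moll_swap]
  simp only [moll, mul_comm]

namespace IsKernel

lemma contDiff_moll (hk : IsKernel L τ k) (hf : LocallyIntegrable f) :
    ContDiff ℝ ((⊤ : ℕ∞) : WithTop ℕ∞) (moll k f) := by
  rw [moll_eq_convolution]
  exact hk.hasCompactSupport.contDiff_convolution_right _ hf hk.contDiff

lemma tsupport_moll_subset (hk : IsKernel L τ k) {K : Set (Fin n → ℝ)} (hK : tsupport f ⊆ K) :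
    tsupport (moll k f) ⊆ Metric.cthickening τ K := by
  refine closure_minimal (fun x hx => ?_) Metric.isClosed_cthickening
  by_contra hcon
  apply hx
  refine integral_eq_zero_of_ae (Eventually.of_forall fun t => ?_)
  by_cases ht : t ∈ K
  · show f t * k (x - t) = 0
    rw [hk.eq_zero, mul_zero]
    by_contra! hle
    exact hcon (Metric.mem_cthickening_of_dist_le x t τ K ht (by rwa [dist_eq_norm]))
  · have : f t = 0 := image_eq_zero_of_notMem_tsupport fun h => ht (hK h)
    simp [this]

lemma hasCompactSupport_moll (hk : IsKernel L τ k) (hfc : HasCompactSupport f) :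
    HasCompactSupport (moll k f) := by
  rw [moll_eq_convolution]
  exact hfc.convolution _ hk.hasCompactSupport

lemma integrable_mul (hk : IsKernel L τ k) (hf : LocallyIntegrable f) (x : Fin n → ℝ) :
    Integrable fun t => f t * k (x - t) :=
  hk.hasCompactSupport.convolutionExists_right (ContinuousLinearMap.mul ℝ ℝ) hf
    hk.contDiff.continuous x

lemma integrable_smul_fderiv (hk : IsKernel L τ k) (hf : LocallyIntegrable f) (x : Fin n → ℝ) :
    Integrable fun t => f t • fderiv ℝ k (x - t) :=
  (hk.hasCompactSupport.fderiv (𝕜 := ℝ)).convolutionExists_right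
    (ContinuousLinearMap.lsmul ℝ ℝ) hf (hk.contDiff.continuous_fderiv (by simp)) x

lemma fderiv_moll (hk : IsKernel L τ k) (hf : LocallyIntegrable f) (x : Fin n → ℝ) :
    fderiv ℝ (moll k f) x = ∫ t, f t • fderiv ℝ k (x - t) := by
  have := hk.hasCompactSupport.hasFDerivAt_convolution_right (ContinuousLinearMap.mul ℝ ℝ) hf
    (hk.contDiff.of_le (natCast_le_smooth 1)) x
  rw [moll_eq_convolution, this.fderiv]
  rfl

end IsKernel

/-- The indicator function of the closed ball of radius `r`. -/
noncomputable def ballInd (n : ℕ) (r : ℝ) : (Fin n → ℝ) → ℝ :=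
  (Metric.closedBall (0 : Fin n → ℝ) r).indicator fun _ => 1

lemma ballInd_nonneg (r : ℝ) (x : Fin n → ℝ) : 0 ≤ ballInd n r x :=
  Set.indicator_nonneg (fun _ _ => zero_le_one) x

lemma ballInd_le_one (r : ℝ) (x : Fin n → ℝ) : ballInd n r x ≤ 1 :=
  Set.indicator_le_self' (fun _ _ => zero_le_one) x

lemma ballInd_of_le {r : ℝ} {x : Fin n → ℝ} (h : ‖x‖ ≤ r) : ballInd n r x = 1 :=
  Set.indicator_of_mem (by simpa using h) _

lemma measurable_ballInd (r : ℝ) : Measurable (ballInd n r) :=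
  measurable_const.indicator Metric.isClosed_closedBall.measurableSet

lemma integrable_ballInd (r : ℝ) : Integrable (ballInd n r) :=
  (integrable_indicator_iff Metric.isClosed_closedBall.measurableSet).2
    (integrableOn_const (measure_closedBall_lt_top.ne))

lemma integral_ballInd {r : ℝ} (hr : 0 ≤ r) : ∫ x, ballInd n r x = (2 * r) ^ n := by
  rw [ballInd, integral_indicator Metric.isClosed_closedBall.measurableSet, setIntegral_const,
    measureReal_def, Real.volume_pi_closedBall _ hr, ENNReal.toReal_ofReal (by positivity)]
  simp

lemma integrable_mul_ballInd (hf : Integrable f) (r : ℝ) (x : Fin n → ℝ) :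
    Integrable fun t => |f t| * ballInd n r (x - t) := by
  refine hf.abs.mono' (hf.abs.1.mul ((measurable_ballInd r).comp
    (measurable_const.sub measurable_id)).aestronglyMeasurable) (Eventually.of_forall fun t => ?_)
  rw [norm_mul, Real.norm_of_nonneg (ballInd_nonneg r _), Real.norm_eq_abs, abs_abs]
  exact mul_le_of_le_one_right (abs_nonneg _) (ballInd_le_one r _)

lemma IsKernel.const_nonneg (hk : IsKernel L τ k) (hτ : 0 < τ) : 0 ≤ L := by
  have := (hk.nonneg 0).trans (hk.le 0)
  by_contra hL
  exact absurd this (not_le.2 (div_neg_of_neg_of_pos (not_le.1 hL) (by positivity)))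

lemma IsKernel.scaleControl (hk : IsKernel L τ k) (hτ : 0 < τ) (hf : Integrable f)
    (hfc : HasCompactSupport f) :
    ScaleControl τ (moll k f) fun x => L / τ ^ n * moll (ballInd n (2 * τ)) (fun t => |f t|) x := by
  have hL := hk.const_nonneg hτ
  have hfl := hf.locallyIntegrable
  refine ⟨(hk.contDiff_moll hfl).of_le (natCast_le_smooth 1), hk.hasCompactSupport_moll hfc,
    (integrable_moll hf.abs (integrable_ballInd _)).const_mul _, fun x z hz => ?_, fun x z hz => ?_⟩
  · rw [hk.fderiv_moll hfl]
    have hi := (integrable_mul_ballInd hf (2 * τ) x).const_mul (L / τ ^ (n + 1))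
    refine (norm_integral_le_integral_norm _).trans
      ((integral_mono (hk.integrable_smul_fderiv hfl _).norm hi fun t => ?_).trans (le_of_eq ?_))
    · show ‖f t • fderiv ℝ k (x + z - t)‖ ≤ L / τ ^ (n + 1) * (|f t| * ballInd n (2 * τ) (x - t))
      rw [norm_smul, Real.norm_eq_abs]
      by_cases hx : ‖x - t‖ ≤ 2 * τ
      · rw [ballInd_of_le hx, mul_one, mul_comm]
        gcongr
        exact hk.fderiv_le _
      · have := norm_sub_le (x + z - t) z
        rw [show x + z - t - z = x - t by abel] at this
        rw [hk.fderiv_eq_zero (by linarith), norm_zero, mul_zero]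
        have := ballInd_nonneg (n := n) (2 * τ) (x - t)
        positivity
    · rw [integral_const_mul, moll]
      field_simp
      ring
  · rw [hk.fderiv_moll hfl, hk.fderiv_moll hfl, ← integral_sub (hk.integrable_smul_fderiv hfl _)
      (hk.integrable_smul_fderiv hfl _)]
    have hi := (integrable_mul_ballInd hf (2 * τ) x).const_mul (L / τ ^ (n + 2) * ‖z‖)
    refine (norm_integral_le_integral_norm _).trans
      ((integral_mono ((hk.integrable_smul_fderiv hfl _).sub
        (hk.integrable_smul_fderiv hfl _)).norm hi fun t => ?_).trans (le_of_eq ?_))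
    · show ‖f t • fderiv ℝ k (x + z - t) - f t • fderiv ℝ k (x - t)‖
        ≤ L / τ ^ (n + 2) * ‖z‖ * (|f t| * ballInd n (2 * τ) (x - t))
      rw [← smul_sub (f t) (fderiv ℝ k (x + z - t)), norm_smul, Real.norm_eq_abs]
      by_cases hx : ‖x - t‖ ≤ 2 * τ
      · rw [ballInd_of_le hx, mul_one, mul_comm]
        gcongr
        refine (hk.fderiv_lip _ _).trans (le_of_eq ?_)
        rw [show x + z - t - (x - t) = z by abel]
      · have := norm_sub_le (x + z - t) z
        rw [show x + z - t - z = x - t by abel] at this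
        rw [hk.fderiv_eq_zero (by linarith), hk.fderiv_eq_zero (by linarith), sub_zero, norm_zero,
          mul_zero]
        have := ballInd_nonneg (n := n) (2 * τ) (x - t)
        positivity
    · rw [integral_const_mul, moll]
      field_simp
      ring

lemma integral_scaleControl (hτ : 0 < τ) (hf : Integrable f) :
    ∫ x, L / τ ^ n * moll (ballInd n (2 * τ)) (fun t => |f t|) x = L * 4 ^ n * ∫ x, |f x| := by
  rw [integral_const_mul, integral_moll hf.abs (integrable_ballInd _),
    integral_ballInd (by positivity), show (2 * (2 * τ)) ^ n = 4 ^ n * τ ^ n by rw [← mul_pow]; ring]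
  field_simp

end Mollification

section GainLemma

variable {n m : ℕ} {L τ : ℝ} {k f : (Fin n → ℝ) → ℝ}

/-- Commutation error between mollification and a vector field. -/
lemma TestField.integral_abs_Xop_moll_le {Z : (Fin n → ℝ) → (Fin n → ℝ)} (hZ : TestField Z)
    (L : ℝ) (hL : 0 ≤ L) :
    ∃ C ≥ (0 : ℝ), ∀ (τ : ℝ) (k f : (Fin n → ℝ) → ℝ), 0 < τ → IsKernel L τ k → ContDiff ℝ 1 f →
      HasCompactSupport f →
      ∫ x, |Xop Z (moll k f) x| ≤ (∫ x, |Xop Z f x|) + C * ∫ x, |f x| := by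
  obtain ⟨M, hM⟩ := hZ.exists_boundedField
  obtain ⟨D, hD0, hD⟩ := hZ.exists_abs_divField_le
  have hM0 := hM.nonneg
  refine ⟨L * M * 2 ^ n + D, by positivity, fun τ k f hτ hk hf hfc => ?_⟩
  have hfi : Integrable f := hf.continuous.integrable_of_hasCompactSupport hfc
  have hfl := hfi.locallyIntegrable
  have hXc : Continuous (Xop Z f) := continuous_Xop hf hZ.contDiff.continuous
  have hXi : Integrable (Xop Z f) := integrable_Xop hf hfc hZ.contDiff.continuous
  have hdi : Integrable fun t => divField Z t * f t :=
    (hZ.continuous_divField.mul hf.continuous).integrable_of_hasCompactSupport hfc.mul_left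
  have key : ∀ x, |Xop Z (moll k f) x| ≤ L * M / τ ^ n * moll (ballInd n τ) (fun t => |f t|) x
      + moll k (fun t => |Xop Z f t|) x + D * moll k (fun t => |f t|) x := by
    intro x
    have hkx : ContDiff ℝ 1 fun t => k (x - t) :=
      (hk.contDiff.of_le (natCast_le_smooth 1)).comp (contDiff_const.sub contDiff_id)
    have hder : ∀ t, fderiv ℝ (fun t => k (x - t)) t = - fderiv ℝ k (x - t) := fun t => by
      have := ((hk.contDiff.differentiable (by simp)) (x - t)).hasFDerivAt.comp t
        ((hasFDerivAt_id t).const_sub x)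
      exact (this.congr_fderiv (by ext v; simp) :
        HasFDerivAt (fun t => k (x - t)) (- fderiv ℝ k (x - t)) t).fderiv
    have hprod : ∀ t, Xop Z (fun t => f t * k (x - t)) t
        = Xop Z f t * k (x - t) - f t * fderiv ℝ k (x - t) (Z t) := fun t => by
      rw [Xop, fderiv_fun_mul (hf.differentiable one_ne_zero t) (hkx.differentiable one_ne_zero t),
        hder]
      simp [Xop]; ring
    have hibp := hZ.integral_Xop (hf.mul hkx) (hfc.mul_right (f' := fun t => k (x - t)))
    simp only [hprod] at hibp
    have i1 : Integrable fun t => f t * fderiv ℝ k (x - t) (Z x) :=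
      ((hk.integrable_smul_fderiv hfl x).apply_continuousLinearMap (Z x))
    have i2 : Integrable fun t => f t * fderiv ℝ k (x - t) (Z t) := by
      refine Continuous.integrable_of_hasCompactSupport (hf.continuous.mul
        (((hk.contDiff.continuous_fderiv (by simp)).comp (continuous_const.sub continuous_id)).clm_apply
          hZ.contDiff.continuous)) hfc.mul_right
    have i3 := hk.integrable_mul hXi.locallyIntegrable x
    have i4 := hk.integrable_mul hdi.locallyIntegrable x
    have i5 := hk.integrable_mul hXi.abs.locallyIntegrable x
    have i6 := hk.integrable_mul hfi.abs.locallyIntegrable x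
    have i7 := integrable_mul_ballInd hfi τ x
    have e1 : Xop Z (moll k f) x = ∫ t, f t * fderiv ℝ k (x - t) (Z x) := by
      rw [Xop, hk.fderiv_moll hfl, ContinuousLinearMap.integral_apply (hk.integrable_smul_fderiv hfl x)]
      rfl
    have e2 : Xop Z (moll k f) x = ∫ t, (f t * fderiv ℝ k (x - t) (Z x)
        - f t * fderiv ℝ k (x - t) (Z t) + Xop Z f t * k (x - t) + divField Z t * f t * k (x - t)) := by
      rw [integral_sub i3 i2] at hibp
      have e3 := integral_add' ((i1.sub i2).add i3) i4
      rw [integral_add' (i1.sub i2) i3, integral_sub' i1 i2] at e3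
      refine Eq.trans ?_ e3.symm
      rw [e1]
      have : ∫ t, divField Z t * (f t * k (x - t)) = ∫ t, divField Z t * f t * k (x - t) := by
        simp only [mul_assoc]
      rw [this] at hibp
      linarith
    rw [e2]
    have hi : Integrable fun t => L * M / τ ^ n * (|f t| * ballInd n τ (x - t))
        + |Xop Z f t| * k (x - t) + D * (|f t| * k (x - t)) :=
      ((i7.const_mul _).add i5).add (i6.const_mul _)
    refine (abs_integral_le_integral_abs).trans
      ((integral_mono (((i1.sub i2).add i3).add i4).abs hi fun t => ?_).trans (le_of_eq ?_))
    · refine (abs_add_le _ _).trans (add_le_add ((abs_add_le _ _).trans (add_le_add ?_ ?_)) ?_)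
      · show |f t * fderiv ℝ k (x - t) (Z x) - f t * fderiv ℝ k (x - t) (Z t)|
          ≤ L * M / τ ^ n * (|f t| * ballInd n τ (x - t))
        rw [← mul_sub, ← map_sub, abs_mul]
        by_cases hx : ‖x - t‖ ≤ τ
        · rw [ballInd_of_le hx, mul_one, mul_comm]
          gcongr
          calc |fderiv ℝ k (x - t) (Z x - Z t)| ≤ ‖fderiv ℝ k (x - t)‖ * ‖Z x - Z t‖ :=
                (fderiv ℝ k (x - t)).le_opNorm _
            _ ≤ L / τ ^ (n + 1) * (M * τ) := by
                gcongr
                · exact hk.fderiv_le _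
                · exact (hM.lip x t).trans (by gcongr)
            _ = L * M / τ ^ n := by field_simp; ring
        · rw [hk.fderiv_eq_zero (not_le.1 hx)]
          have := ballInd_nonneg (n := n) τ (x - t)
          simp only [zero_apply, abs_zero, mul_zero]
          positivity
      · simp only [abs_mul, abs_of_nonneg (hk.nonneg (x - t)), le_refl]
      · rw [abs_mul, abs_mul, abs_of_nonneg (hk.nonneg (x - t)), ← mul_assoc]
        have := hk.nonneg (x - t)
        gcongr
        exact hD t
    · have e3 := integral_add' ((i7.const_mul (L * M / τ ^ n)).add i5) (i6.const_mul D)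
      rw [integral_add' (i7.const_mul _) i5, integral_const_mul, integral_const_mul] at e3
      exact e3
  have j1 := integrable_moll hfi.abs (integrable_ballInd (n := n) τ)
  have j2 := integrable_moll hXi.abs hk.integrable
  have j3 := integrable_moll hfi.abs hk.integrable
  have hmi : Integrable fun x => |Xop Z (moll k f) x| :=
    (integrable_Xop ((hk.contDiff_moll hfl).of_le (natCast_le_smooth 1))
      (hk.hasCompactSupport_moll hfc) hZ.contDiff.continuous).abs
  refine (integral_mono hmi (((j1.const_mul _).add j2).add (j3.const_mul _)) key).trans
    (le_of_eq ?_)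
  have e3 := integral_add' ((j1.const_mul (L * M / τ ^ n)).add j2) (j3.const_mul D)
  rw [integral_add' (j1.const_mul _) j2, integral_const_mul, integral_const_mul] at e3
  refine e3.trans ?_
  rw [
    integral_moll hfi.abs (integrable_ballInd _), integral_moll hXi.abs hk.integrable,
    integral_moll hfi.abs hk.integrable, hk.integral, integral_ballInd hτ.le, mul_pow]
  field_simp
  ring

end GainLemma

section Telescoping

variable {n m : ℕ}

lemma integral_abs_translate_sub_le {F : (Fin n → ℝ) → ℝ} (hF : ContDiff ℝ 1 F)
    (hc : HasCompactSupport F) {v : Fin n → ℝ} (hv : ‖v‖ ≤ 1) :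
    ∫ x, |F (x - v) - F x| ≤ Real.exp 1 ^ n * ‖v‖ * ∫ x, ‖fderiv ℝ F x‖ := by
  have hflow : IsFlow (fun _ : Fin n → ℝ => -v) (fun t x => x + t • (-v)) :=
    ⟨fun x => by simp, fun x t => by
      simpa using ((hasDerivAt_id t).smul_const (-v)).const_add x⟩
  have hZ : BoundedField (fun _ : Fin n → ℝ => -v) 1 :=
    ⟨differentiable_const _, fun _ => by simpa using hv, fun _ => by simp, fun _ _ => by simp⟩
  have := hflow.integral_abs_comp_sub_le hZ (t := 1) (by simp) hF hc
  simp only [one_smul, ← sub_eq_add_neg, abs_one, one_mul] at this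
  refine this.trans ?_
  rw [mul_assoc, ← integral_const_mul ‖v‖]
  gcongr ?_ * ?_
  refine integral_mono (integrable_Xop hF hc continuous_const).abs
    (((hF.continuous_fderiv one_ne_zero).integrable_of_hasCompactSupport
      (hc.fderiv (𝕜 := ℝ))).norm.const_mul _) fun x => ?_
  calc |fderiv ℝ F x (-v)| ≤ ‖fderiv ℝ F x‖ * ‖-v‖ := (fderiv ℝ F x).le_opNorm _
    _ = _ := by rw [norm_neg, mul_comm]

lemma IsKernel.integral_abs_moll_sub_le {L τ : ℝ} {k : (Fin n → ℝ) → ℝ} (hk : IsKernel L τ k)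
    (hτ1 : τ ≤ 1) {F : (Fin n → ℝ) → ℝ} (hF : ContDiff ℝ 1 F)
    (hc : HasCompactSupport F) :
    ∫ x, |moll k F x - F x| ≤ Real.exp 1 ^ n * τ * ∫ x, ‖fderiv ℝ F x‖ := by
  have hFi : Integrable F := hF.continuous.integrable_of_hasCompactSupport hc
  have hki := hk.integrable
  have hkc := hk.contDiff.continuous
  have hgn : 0 ≤ ∫ x, ‖fderiv ℝ F x‖ := integral_nonneg fun _ => norm_nonneg _
  have hjc : Continuous fun p : (Fin n → ℝ) × (Fin n → ℝ) => |F (p.1 - p.2) - F p.1| * k p.2 :=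
    (((hF.continuous.comp (continuous_fst.sub continuous_snd)).sub
      (hF.continuous.comp continuous_fst)).abs).mul (hkc.comp continuous_snd)
  have hb : ∀ t, ‖t‖ ≤ τ → ∫ x, |F (x - t) - F x| * k t
      ≤ Real.exp 1 ^ n * τ * (∫ x, ‖fderiv ℝ F x‖) * k t := fun t ht => by
    rw [integral_mul_const]
    have := integral_abs_translate_sub_le hF hc (ht.trans hτ1)
    have h0 := hk.nonneg t
    gcongr
    refine this.trans ?_
    gcongr
  have hb' : ∀ t, ∫ x, |F (x - t) - F x| * k t
      ≤ Real.exp 1 ^ n * τ * (∫ x, ‖fderiv ℝ F x‖) * k t := fun t => by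
    by_cases ht : ‖t‖ ≤ τ
    · exact hb t ht
    · rw [hk.eq_zero t (not_le.1 ht)]; simp
  have hprod : Integrable (fun p : (Fin n → ℝ) × (Fin n → ℝ) => |F (p.1 - p.2) - F p.1| * k p.2)
      (volume.prod volume) := by
    rw [integrable_prod_iff' hjc.aestronglyMeasurable]
    refine ⟨Eventually.of_forall fun t => (((hFi.comp_sub_right t).sub hFi).abs).mul_const (k t), ?_⟩
    refine (hki.const_mul (Real.exp 1 ^ n * τ * ∫ x, ‖fderiv ℝ F x‖)).mono'
      ((hjc.comp continuous_swap).norm.aestronglyMeasurable.integral_prod_right')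
      (Eventually.of_forall fun t => ?_)
    rw [Real.norm_of_nonneg (integral_nonneg fun _ => norm_nonneg _)]
    simp only [norm_mul, Real.norm_eq_abs, abs_abs, abs_of_nonneg (hk.nonneg t)]
    exact hb' t
  calc ∫ x, |moll k F x - F x| ≤ ∫ x, ∫ t, |F (x - t) - F x| * k t := by
        refine integral_mono ((integrable_moll hFi hki).sub hFi).abs hprod.integral_prod_left
          fun x => ?_
        have i1 : Integrable fun t => F (x - t) * k t :=
          ((hF.continuous.comp (continuous_const.sub continuous_id)).mul
            hkc).integrable_of_hasCompactSupport hk.hasCompactSupport.mul_left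
        have e : moll k F x - F x = ∫ t, (F (x - t) - F x) * k t := by
          simp only [sub_mul]
          rw [integral_sub i1 (hki.const_mul _), integral_const_mul, hk.integral, mul_one, moll_swap]
        show |moll k F x - F x| ≤ _
        rw [e]
        refine abs_integral_le_integral_abs.trans (le_of_eq ?_)
        simp only [abs_mul, abs_of_nonneg (hk.nonneg _)]
    _ = ∫ t, ∫ x, |F (x - t) - F x| * k t := integral_integral_swap hprod
    _ ≤ ∫ t, Real.exp 1 ^ n * τ * (∫ x, ‖fderiv ℝ F x‖) * k t :=
        integral_mono hprod.integral_prod_right (hki.const_mul _) hb'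
    _ = _ := by rw [integral_const_mul, hk.integral, mul_one]

/-- The `L¹` norm of `f` together with its derivatives along the fields `X`. -/
noncomputable def xNorm (X : Fin m → (Fin n → ℝ) → (Fin n → ℝ)) (f : (Fin n → ℝ) → ℝ) : ℝ :=
  (∫ x, |f x|) + ∑ i, ∫ x, |Xop (X i) f x|

variable {X : Fin m → (Fin n → ℝ) → (Fin n → ℝ)}

lemma xNorm_nonneg (f : (Fin n → ℝ) → ℝ) : 0 ≤ xNorm X f :=
  add_nonneg (integral_nonneg fun _ => abs_nonneg _)
    (Finset.sum_nonneg fun _ _ => integral_nonneg fun _ => abs_nonneg _)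

lemma integral_abs_le_xNorm (f : (Fin n → ℝ) → ℝ) : ∫ x, |f x| ≤ xNorm X f :=
  le_add_of_nonneg_right (Finset.sum_nonneg fun _ _ => integral_nonneg fun _ => abs_nonneg _)

lemma exists_scale_energy_le (hX : ∀ i, TestField (X i)) {L : ℝ} (hL : 0 ≤ L) :
    ∃ C ≥ (0 : ℝ), ∀ (τ : ℝ) (k f : (Fin n → ℝ) → ℝ), 0 < τ → IsKernel L τ k → ContDiff ℝ 1 f →
      HasCompactSupport f →
      L * 4 ^ n * (∫ x, |f x|) + ∑ i, ∫ x, |Xop (X i) (moll k f) x| ≤ C * xNorm X f := by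
  choose C hC0 hC using fun i => (hX i).integral_abs_Xop_moll_le L hL
  refine ⟨L * 4 ^ n + 1 + ∑ i, C i, add_nonneg (by positivity) (Finset.sum_nonneg fun i _ => hC0 i),
    fun τ k f hτ hk hf hfc => ?_⟩
  have h1 := integral_abs_le_xNorm (X := X) f
  have h0 : 0 ≤ ∫ x, |f x| := integral_nonneg fun _ => abs_nonneg _
  have h2 : ∑ i, ∫ x, |Xop (X i) f x| ≤ xNorm X f := le_add_of_nonneg_left h0
  calc _ ≤ L * 4 ^ n * (∫ x, |f x|) + ∑ i, ((∫ x, |Xop (X i) f x|) + C i * ∫ x, |f x|) := by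
        gcongr with i
        exact hC i τ k f hτ hk hf hfc
    _ = L * 4 ^ n * (∫ x, |f x|) + ((∑ i, ∫ x, |Xop (X i) f x|) + (∑ i, C i) * ∫ x, |f x|) := by
        rw [Finset.sum_add_distrib, Finset.sum_mul]
    _ ≤ L * 4 ^ n * xNorm X f + (xNorm X f + (∑ i, C i) * xNorm X f) := by
        have := Finset.sum_nonneg fun i (_ : i ∈ Finset.univ) => hC0 i
        gcongr
    _ = _ := by ring

/-- Rate of convergence of mollifications under Hörmander's condition. -/
lemma exists_integral_abs_sub_moll_le (hX : ∀ i, TestField (X i)) {K V : Set (Fin n → ℝ)}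
    (hK : IsCompact K) (hV : IsOpen V) (hKV : K ⊆ V)
    (hspan : ∀ x ∈ V, Submodule.span ℝ {v : Fin n → ℝ | ∃ c, LieGen X c ∧ c x = v} = ⊤)
    {L : ℝ} (hL : 0 ≤ L) {k : ℝ → (Fin n → ℝ) → ℝ} (hk : ∀ τ > 0, IsKernel L τ (k τ)) :
    ∃ γ : ℝ, 0 < γ ∧ γ ≤ 1 ∧ ∃ τ₀ : ℝ, 0 < τ₀ ∧ τ₀ ≤ 1 ∧ ∃ C ≥ (0 : ℝ), ∀ f, ContDiff ℝ 1 f →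
      tsupport f ⊆ K → ∀ τ, 0 < τ → τ ≤ τ₀ →
      ∫ x, |f x - moll (k τ) f x| ≤ C * τ ^ γ * xNorm X f := by
  obtain ⟨τ₁, hτ₁, hcV⟩ := hK.exists_cthickening_subset_open hV hKV
  set τ₀ := min τ₁ 1 with hτ₀
  have hτ₀p : 0 < τ₀ := lt_min hτ₁ one_pos
  have hK' : IsCompact (Metric.cthickening τ₀ K) := hK.cthickening
  have hK'V : Metric.cthickening τ₀ K ⊆ V :=
    (Metric.cthickening_mono (min_le_left _ _) K).trans hcV
  obtain ⟨γ, hγ, hγ1, C₁, hC₁, hgrad⟩ :=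
    exists_gradient_gain hX hK' fun x hx => hspan x (hK'V hx)
  obtain ⟨C₂, hC₂, hen⟩ := exists_scale_energy_le hX hL
  set C₃ := 3 * Real.exp 1 ^ n * C₁ * C₂ with hC₃
  have hC₃0 : 0 ≤ C₃ := by positivity
  have h2γ : (1 / 2 : ℝ) ^ γ < 1 := Real.rpow_lt_one (by norm_num) (by norm_num) hγ
  refine ⟨γ, hγ, hγ1, τ₀, hτ₀p, min_le_right _ _, C₃ / (1 - (1 / 2 : ℝ) ^ γ),
    div_nonneg hC₃0 (by linarith), fun f hf hfK τ hτ hττ₀ => ?_⟩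
  have hfc : HasCompactSupport f := hK.of_isClosed_subset (isClosed_tsupport f) hfK
  have hfi : Integrable f := hf.continuous.integrable_of_hasCompactSupport hfc
  have hN := xNorm_nonneg (X := X) f
  have cd : ∀ s > 0, ContDiff ℝ 1 (moll (k s) f) := fun s hs =>
    ((hk s hs).contDiff_moll hfi.locallyIntegrable).of_le (natCast_le_smooth 1)
  have hcs : ∀ s > 0, HasCompactSupport (moll (k s) f) := fun s hs =>
    (hk s hs).hasCompactSupport_moll hfc
  have hmi : ∀ s > 0, Integrable (moll (k s) f) := fun s hs =>
    (cd s hs).continuous.integrable_of_hasCompactSupport (hcs s hs)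
  have grad : ∀ s, 0 < s → s ≤ τ₀ →
      ∫ x, ‖fderiv ℝ (moll (k s) f) x‖ ≤ C₁ * C₂ * s ^ (γ - 1) * xNorm X f := fun s hs hs0 => by
    have h1 := hgrad s hs (hs0.trans (min_le_right _ _)) _ _ ((hk s hs).scaleControl hs hfi hfc)
      (((hk s hs).tsupport_moll_subset hfK).trans (Metric.cthickening_mono hs0 K))
    rw [integral_scaleControl hs hfi] at h1
    refine h1.trans ?_
    have := hen s (k s) f hs (hk s hs) hf hfc
    calc _ ≤ C₁ * s ^ (γ - 1) * (C₂ * xNorm X f) := by gcongr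
      _ = _ := by ring
  have step : ∀ s, 0 < s → s ≤ τ₀ →
      ∫ x, |moll (k (s / 2)) f x - moll (k s) f x| ≤ C₃ * s ^ γ * xNorm X f := fun s hs hs0 => by
    have hs1 : s ≤ 1 := hs0.trans (min_le_right _ _)
    have hs2 : 0 < s / 2 := by positivity
    have a1 := (hk _ hs2).integral_abs_moll_sub_le (by linarith) (cd s hs) (hcs s hs)
    have a2 := (hk s hs).integral_abs_moll_sub_le hs1 (cd _ hs2) (hcs _ hs2)
    rw [moll_comm hf.continuous hfc (hk _ hs2).contDiff.continuous (hk _ hs2).hasCompactSupport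
      (hk s hs).contDiff.continuous (hk s hs).hasCompactSupport] at a1
    set g := moll (k s) (moll (k (s / 2)) f)
    have gi : Integrable g := integrable_moll (hmi _ hs2) (hk s hs).integrable
    have p1 : s * s ^ (γ - 1) = s ^ γ := by
      rw [Real.rpow_sub_one hs.ne']; field_simp
    have p2 : s * (s / 2) ^ (γ - 1) ≤ 2 * s ^ γ := by
      rw [Real.rpow_sub_one hs2.ne']
      have : (s / 2) ^ γ ≤ s ^ γ := Real.rpow_le_rpow hs2.le (by linarith) hγ.le
      rw [show s * ((s / 2) ^ γ / (s / 2)) = 2 * (s / 2) ^ γ by field_simp]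
      linarith
    calc ∫ x, |moll (k (s / 2)) f x - moll (k s) f x|
        ≤ ∫ x, (|g x - moll (k s) f x| + |g x - moll (k (s / 2)) f x|) := by
          refine integral_mono ((hmi _ hs2).sub (hmi s hs)).abs
            ((gi.sub (hmi s hs)).abs.add (gi.sub (hmi _ hs2)).abs) fun x => ?_
          rw [abs_sub_comm (g x) (moll (k (s / 2)) f x), add_comm]
          exact abs_sub_le _ _ _
      _ = (∫ x, |g x - moll (k s) f x|) + ∫ x, |g x - moll (k (s / 2)) f x| :=
          integral_add (gi.sub (hmi s hs)).abs (gi.sub (hmi _ hs2)).abs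
      _ ≤ Real.exp 1 ^ n * (s / 2) * (C₁ * C₂ * s ^ (γ - 1) * xNorm X f)
          + Real.exp 1 ^ n * s * (C₁ * C₂ * (s / 2) ^ (γ - 1) * xNorm X f) := by
          refine add_le_add (a1.trans ?_) (a2.trans ?_)
          · gcongr; exact grad s hs hs0
          · gcongr; exact grad _ hs2 (by linarith)
      _ = Real.exp 1 ^ n * C₁ * C₂ * xNorm X f * (s * s ^ (γ - 1) / 2 + s * (s / 2) ^ (γ - 1)) := by
          ring
      _ ≤ Real.exp 1 ^ n * C₁ * C₂ * xNorm X f * (s ^ γ + 2 * s ^ γ) := by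
          have : 0 ≤ s ^ γ := Real.rpow_nonneg hs.le _
          gcongr
          rw [p1]; linarith
      _ = _ := by rw [hC₃]; ring
  set A := C₃ / (1 - (1 / 2 : ℝ) ^ γ) with hA
  set b : ℝ → ℝ := fun s => (∫ x, |f x - moll (k s) f x|) - A * s ^ γ * xNorm X f with hb
  have bstep : ∀ s, 0 < s → s ≤ τ₀ → b s ≤ b (s / 2) := fun s hs hs0 => by
    have hs2 : 0 < s / 2 := by positivity
    have h1 : ∫ x, |f x - moll (k s) f x| ≤ (∫ x, |f x - moll (k (s / 2)) f x|)
        + ∫ x, |moll (k (s / 2)) f x - moll (k s) f x| := by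
      exact (integral_mono (hfi.sub (hmi s hs)).abs
        ((hfi.sub (hmi _ hs2)).abs.add ((hmi _ hs2).sub (hmi s hs)).abs) fun x =>
          abs_sub_le (f x) (moll (k (s / 2)) f x) (moll (k s) f x)).trans
        (integral_add' (hfi.sub (hmi _ hs2)).abs ((hmi _ hs2).sub (hmi s hs)).abs).le
    have h2 := step s hs hs0
    have h3 : (s / 2) ^ γ = s ^ γ * (1 / 2 : ℝ) ^ γ := by
      rw [← Real.mul_rpow hs.le (by norm_num)]; congr 1; ring
    have h4 : A * (1 - (1 / 2 : ℝ) ^ γ) = C₃ := div_mul_cancel₀ _ (by linarith)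
    simp only [hb]
    rw [h3]
    have : A * s ^ γ * xNorm X f - A * (s ^ γ * (1 / 2) ^ γ) * xNorm X f
        = C₃ * s ^ γ * xNorm X f := by rw [← h4]; ring
    linarith
  have bmono : ∀ j : ℕ, b τ ≤ b (τ * (1 / 2) ^ j) := fun j => by
    induction j with
    | zero => simp
    | succ j ih =>
      refine ih.trans ((bstep _ (by positivity) ?_).trans (le_of_eq ?_))
      · refine le_trans ?_ hττ₀
        exact mul_le_of_le_one_right hτ.le (pow_le_one₀ (by norm_num) (by norm_num))
      · congr 1; rw [pow_succ]; ring
  have blim : ∀ j : ℕ, b τ ≤ Real.exp 1 ^ n * (τ * (1 / 2) ^ j) * ∫ x, ‖fderiv ℝ f x‖ := fun j => by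
    have hs : 0 < τ * (1 / 2 : ℝ) ^ j := by positivity
    have hs1 : τ * (1 / 2 : ℝ) ^ j ≤ 1 :=
      (mul_le_of_le_one_right hτ.le (pow_le_one₀ (by norm_num) (by norm_num))).trans
        (hττ₀.trans (min_le_right _ _))
    have h1 := (hk _ hs).integral_abs_moll_sub_le hs1 hf hfc
    simp_rw [abs_sub_comm (moll _ f _)] at h1
    refine (bmono j).trans ((sub_le_self _ ?_).trans h1)
    have : 0 ≤ A := div_nonneg hC₃0 (by linarith)
    positivity
  have hlim : Tendsto (fun j : ℕ => Real.exp 1 ^ n * (τ * (1 / 2) ^ j) * ∫ x, ‖fderiv ℝ f x‖) atTop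
      (𝓝 (Real.exp 1 ^ n * (τ * 0) * ∫ x, ‖fderiv ℝ f x‖)) :=
    (((tendsto_pow_atTop_nhds_zero_of_lt_one (by norm_num) (by norm_num)).const_mul τ).const_mul
      _).mul_const _
  have := ge_of_tendsto' hlim blim
  simp only [mul_zero, zero_mul, hb] at this
  linarith

/-- Under Hörmander's condition, the `L¹` norm on small sets gains a power of the measure. -/
lemma exists_setIntegral_gain (hX : ∀ i, TestField (X i)) {K V : Set (Fin n → ℝ)}
    (hK : IsCompact K) (hV : IsOpen V) (hKV : K ⊆ V)
    (hspan : ∀ x ∈ V, Submodule.span ℝ {v : Fin n → ℝ | ∃ c, LieGen X c ∧ c x = v} = ⊤) :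
    ∃ γ > (0 : ℝ), ∃ C ≥ (0 : ℝ), ∀ f, ContDiff ℝ 1 f → tsupport f ⊆ K →
      ∀ A : Set (Fin n → ℝ), MeasurableSet A → ∀ a : ℝ, 0 < a → volume A ≤ ENNReal.ofReal a →
      ∫ x in A, |f x| ≤ C * a ^ γ * xNorm X f := by
  obtain ⟨L, hL, k, hk⟩ := exists_kernel n
  obtain ⟨γ, hγ, hγ1, τ₀, hτ₀, hτ₀1, C, hC, hrate⟩ :=
    exists_integral_abs_sub_moll_le hX hK hV hKV hspan hL hk
  refine ⟨γ / (n + 1), by positivity, C + L / τ₀ ^ n + 1, by positivity,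
    fun f hf hfK A hA a ha hAa => ?_⟩
  have hfc : HasCompactSupport f := hK.of_isClosed_subset (isClosed_tsupport f) hfK
  have hfi : Integrable f := hf.continuous.integrable_of_hasCompactSupport hfc
  have hN := integral_abs_le_xNorm (X := X) f
  have hN0 := xNorm_nonneg (X := X) f
  have hset : ∫ x in A, |f x| ≤ ∫ x, |f x| :=
    setIntegral_le_integral hfi.abs (Eventually.of_forall fun _ => abs_nonneg _)
  have hLτ : 0 ≤ L / τ₀ ^ n := by positivity
  rcases le_total 1 a with h1a | ha1
  · have : 1 ≤ a ^ (γ / (n + 1)) := Real.one_le_rpow h1a (by positivity)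
    calc ∫ x in A, |f x| ≤ 1 * 1 * xNorm X f := by linarith
      _ ≤ _ := by gcongr; linarith
  · set s := a ^ (1 / ((n : ℝ) + 1)) with hs
    have hs0 : 0 < s := Real.rpow_pos_of_pos ha _
    have hs1 : s ≤ 1 := Real.rpow_le_one ha.le ha1 (by positivity)
    have hsa : s ^ (n + 1) = a := by
      rw [hs, ← Real.rpow_natCast, ← Real.rpow_mul ha.le]
      push_cast
      rw [one_div_mul_cancel (by positivity), Real.rpow_one]
    have hsγ : s ^ γ = a ^ (γ / (n + 1)) := by
      rw [hs, ← Real.rpow_mul ha.le]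
      congr 1; ring
    have hτ : 0 < τ₀ * s := by positivity
    have hk' := hk _ hτ
    have hmi : Integrable (moll (k (τ₀ * s)) f) := integrable_moll hfi hk'.integrable
    have hr := hrate f hf hfK (τ₀ * s) hτ (mul_le_of_le_one_right hτ₀.le hs1)
    have hvol : volume.real A ≤ a := by
      rw [measureReal_def]
      exact ENNReal.toReal_le_of_le_ofReal ha.le hAa
    have hAfin : volume A ≠ ⊤ := (hAa.trans_lt ENNReal.ofReal_lt_top).ne
    have hsup : ∀ x, |moll (k (τ₀ * s)) f x| ≤ L / (τ₀ * s) ^ n * ∫ t, |f t| := fun x => by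
      rw [moll, ← integral_const_mul]
      refine abs_integral_le_integral_abs.trans (integral_mono
        (hk'.integrable_mul hfi.locallyIntegrable x).abs (hfi.abs.const_mul _) fun t => ?_)
      show |f t * k (τ₀ * s) (x - t)| ≤ L / (τ₀ * s) ^ n * |f t|
      rw [abs_mul, abs_of_nonneg (hk'.nonneg _), mul_comm]
      gcongr
      exact hk'.le _
    calc ∫ x in A, |f x|
        ≤ ∫ x in A, (|f x - moll (k (τ₀ * s)) f x| + |moll (k (τ₀ * s)) f x|) := by
          refine setIntegral_mono hfi.abs.integrableOn
            ((hfi.sub hmi).abs.add hmi.abs).integrableOn fun x => ?_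
          simpa using abs_add_le (f x - moll (k (τ₀ * s)) f x) (moll (k (τ₀ * s)) f x)
      _ = (∫ x in A, |f x - moll (k (τ₀ * s)) f x|) + ∫ x in A, |moll (k (τ₀ * s)) f x| :=
          integral_add (hfi.sub hmi).abs.integrableOn hmi.abs.integrableOn
      _ ≤ C * (τ₀ * s) ^ γ * xNorm X f + L / (τ₀ * s) ^ n * (∫ t, |f t|) * a := by
          refine add_le_add ((setIntegral_le_integral (hfi.sub hmi).abs
            (Eventually.of_forall fun _ => abs_nonneg _)).trans hr) ?_
          calc ∫ x in A, |moll (k (τ₀ * s)) f x| ≤ ∫ x in A, L / (τ₀ * s) ^ n * ∫ t, |f t| :=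
                setIntegral_mono hmi.abs.integrableOn (integrableOn_const hAfin) hsup
            _ = L / (τ₀ * s) ^ n * (∫ t, |f t|) * volume.real A := by
                rw [setIntegral_const, smul_eq_mul, mul_comm]
            _ ≤ _ := by
                have : 0 ≤ ∫ t, |f t| := integral_nonneg fun _ => abs_nonneg _
                gcongr
      _ ≤ C * s ^ γ * xNorm X f + L / τ₀ ^ n * s * xNorm X f := by
          have e : L / (τ₀ * s) ^ n * (∫ t, |f t|) * a = L / τ₀ ^ n * s * ∫ t, |f t| := by
            rw [← hsa, mul_pow, pow_succ]; field_simp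
          rw [e]
          gcongr
          exact mul_le_of_le_one_left hs0.le hτ₀1
      _ ≤ C * s ^ γ * xNorm X f + L / τ₀ ^ n * s ^ γ * xNorm X f := by
          gcongr
          calc s = s ^ (1 : ℝ) := (Real.rpow_one s).symm
            _ ≤ s ^ γ := Real.rpow_le_rpow_of_exponent_ge hs0 hs1 hγ1
      _ ≤ _ := by
          rw [← hsγ]
          have : 0 ≤ s ^ γ * xNorm X f := by positivity
          nlinarith

end Telescoping

lemma esymmF_one {m : ℕ} (lam : Fin m → ℝ) : esymmF 1 lam = ∑ i, lam i := by
  simp [esymmF, Finset.powersetCard_one]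

lemma two_mul_sum_powersetCard_two {ι : Type*} [DecidableEq ι] (lam : ι → ℝ) (s : Finset ι) :
    2 * ∑ t ∈ Finset.powersetCard 2 s, ∏ i ∈ t, lam i
      = (∑ i ∈ s, lam i) ^ 2 - ∑ i ∈ s, lam i ^ 2 := by
  induction s using Finset.induction_on with
  | empty =>
    rw [Finset.powersetCard_eq_empty.2 (by simp)]
    simp
  | insert a s ha ih =>
    rw [Finset.powersetCard_succ_insert ha, Finset.sum_union, mul_add, ih, Finset.sum_insert ha,
      Finset.sum_insert ha, Finset.sum_image, Finset.powersetCard_one, Finset.sum_map]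
    · have h : ∀ x ∈ s, ∏ i ∈ insert a ({x} : Finset ι), lam i = lam a * lam x := by
        intro x hx
        rw [Finset.prod_pair (by rintro rfl; exact ha hx)]
      simp only [Function.Embedding.coeFn_mk]
      rw [Finset.sum_congr rfl h, ← Finset.mul_sum]
      ring
    · intro t ht t' ht' h
      have h1 : a ∉ t := fun h => ha ((Finset.mem_powersetCard.1 ht).1 h)
      have h2 : a ∉ t' := fun h => ha ((Finset.mem_powersetCard.1 ht').1 h)
      rw [← Finset.erase_insert h1, ← Finset.erase_insert h2, h]
    · rw [Finset.disjoint_left]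
      intro t ht ht'
      obtain ⟨r, -, rfl⟩ := Finset.mem_image.1 ht'
      exact ha ((Finset.mem_powersetCard.1 ht).1 (Finset.mem_insert_self a r))

lemma two_mul_esymmF_two {m : ℕ} (lam : Fin m → ℝ) :
    2 * esymmF 2 lam = (∑ i, lam i) ^ 2 - ∑ i, lam i ^ 2 :=
  two_mul_sum_powersetCard_two lam Finset.univ

lemma Matrix.IsHermitian.sum_sq_eq_sum_eigenvalues_sq {m : ℕ} {A : Matrix (Fin m) (Fin m) ℝ}
    (hA : A.IsHermitian) : ∑ i, ∑ j, A i j ^ 2 = ∑ i, hA.eigenvalues i ^ 2 := by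
  have h1 : (A * A).trace = ∑ i, ∑ j, A i j ^ 2 := by
    simp only [Matrix.trace, Matrix.diag_apply, Matrix.mul_apply]
    refine Finset.sum_congr rfl fun i _ => Finset.sum_congr rfl fun j _ => ?_
    have : A j i = A i j := by simpa using hA.apply i j
    rw [this, sq]
  rw [← h1]
  set D : Matrix (Fin m) (Fin m) ℝ := Matrix.diagonal (RCLike.ofReal ∘ hA.eigenvalues) with hD
  set c := Unitary.conjStarAlgAut ℝ _ hA.eigenvectorUnitary with hc
  have h2 : A = c D := hA.spectral_theorem
  have h3 : A * A = c (D * D) := by rw [map_mul, ← h2]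
  rw [h3, hc, Unitary.conjStarAlgAut_apply, Matrix.trace_mul_comm, ← mul_assoc,
    Unitary.coe_star_mul_self, one_mul, hD, Matrix.diagonal_mul_diagonal, Matrix.trace_diagonal]
  simp [sq]

section Pointwise
variable {n m : ℕ} {b : Fin m → (Fin n → ℝ) → (Fin n → ℝ)} {u : (Fin n → ℝ) → ℝ}
  {x : Fin n → ℝ}

lemma sum_hessEig : ∑ i, hessEig b u x i = subLap b u x := by
  have h := (symmHess_isHermitian b u x).trace_eq_sum_eigenvalues
  simp only [Matrix.trace, Matrix.diag_apply] at h
  unfold hessEig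
  rw [subLap]
  simp only [symmHess] at h
  simpa using h.symm

lemma two_mul_F2fun :
    2 * F2fun b u x = subLap b u x ^ 2 - ∑ i, ∑ j, symmHess b u x i j ^ 2 := by
  rw [F2fun, two_mul_esymmF_two, sum_hessEig,
    (symmHess_isHermitian b u x).sum_sq_eq_sum_eigenvalues_sq]
  rfl

lemma sum_symmHess_diag : ∑ i, symmHess b u x i i = subLap b u x := by
  simp [symmHess, subLap]

lemma sum_commOp_sq : ∑ i, ∑ j, commOp b i j u x ^ 2 = 2 * E2fun b u x := by
  have hanti : ∀ i j, commOp b i j u x ^ 2 = commOp b j i u x ^ 2 := fun i j => by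
    simp only [commOp]; ring
  have hsplit : ∀ i, ∑ j, commOp b i j u x ^ 2
      = ∑ j ∈ Finset.Ioi i, commOp b i j u x ^ 2 + ∑ j ∈ Finset.Iio i, commOp b i j u x ^ 2 := by
    intro i
    have hz : commOp b i i u x ^ 2 = 0 := by simp [commOp]
    have hd : Disjoint (Finset.Ioi i) (Finset.Iio i) := by
      rw [Finset.disjoint_left]
      intro j hj hj'
      exact lt_asymm (Finset.mem_Ioi.1 hj) (Finset.mem_Iio.1 hj')
    rw [← Finset.sum_union hd]
    refine (Finset.sum_subset (Finset.subset_univ _) fun j _ hj => ?_).symm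
    have : j = i := by
      by_contra hne
      rcases lt_or_gt_of_ne hne with h | h
      · exact hj (Finset.mem_union_right _ (Finset.mem_Iio.2 h))
      · exact hj (Finset.mem_union_left _ (Finset.mem_Ioi.2 h))
    rw [this, hz]
  have hswap : ∑ i, ∑ j ∈ Finset.Iio i, commOp b i j u x ^ 2
      = ∑ i, ∑ j ∈ Finset.Ioi i, commOp b i j u x ^ 2 := by
    rw [Finset.sum_comm' (t' := Finset.univ) (s' := fun j => Finset.Ioi j) (by simp)]
    exact Finset.sum_congr rfl fun i _ => Finset.sum_congr rfl fun j _ => hanti j i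
  rw [Finset.sum_congr rfl fun i _ => hsplit i, Finset.sum_add_distrib, hswap, E2fun, two_mul]

lemma E2fun_nonneg : 0 ≤ E2fun b u x :=
  Finset.sum_nonneg fun _ _ => Finset.sum_nonneg fun _ _ => sq_nonneg _

lemma two_mul_F2fun_eq_sum :
    2 * F2fun b u x = ∑ i, ∑ j, (Xop (b i) (Xop (b i) u) x * Xop (b j) (Xop (b j) u) x
      - Xop (b j) (Xop (b i) u) x * Xop (b i) (Xop (b j) u) x)
      - (1 / 4) * ∑ i, ∑ j, commOp b i j u x ^ 2 := by
  rw [two_mul_F2fun, subLap, sq, Finset.sum_mul_sum, Finset.mul_sum, ← Finset.sum_sub_distrib,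
    ← Finset.sum_sub_distrib]
  refine Finset.sum_congr rfl fun i _ => ?_
  rw [Finset.mul_sum, ← Finset.sum_sub_distrib, ← Finset.sum_sub_distrib]
  refine Finset.sum_congr rfl fun j _ => ?_
  simp only [symmHess, commOp]
  ring

/-- The pointwise consequences of `2`-convexity. -/
structure TwoConvexAt (b : Fin m → (Fin n → ℝ) → (Fin n → ℝ)) (u : (Fin n → ℝ) → ℝ)
    (x : Fin n → ℝ) : Prop where
  subLap_nonneg : 0 ≤ subLap b u x
  sum_sq_le : ∑ i, ∑ j, symmHess b u x i j ^ 2 ≤ subLap b u x ^ 2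

lemma IsKConvex.twoConvexAt {V : Set (Fin n → ℝ)} (h : IsKConvex V b 2 u) (hx : x ∈ V) :
    TwoConvexAt b u x := by
  refine ⟨?_, ?_⟩
  · have := h x hx 1 le_rfl one_le_two
    rwa [esymmF_one, sum_hessEig] at this
  · have h2 : 0 ≤ F2fun b u x := h x hx 2 one_le_two le_rfl
    have := two_mul_F2fun (b := b) (u := u) (x := x)
    linarith

namespace TwoConvexAt

lemma F2fun_nonneg (h : TwoConvexAt b u x) : 0 ≤ F2fun b u x := by
  have := two_mul_F2fun (b := b) (u := u) (x := x)
  linarith [h.sum_sq_le]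

lemma calF2_nonneg (h : TwoConvexAt b u x) : 0 ≤ calF2 b u x := by
  have := h.F2fun_nonneg
  have := E2fun_nonneg (b := b) (u := u) (x := x)
  rw [calF2]; positivity

lemma E2fun_le (h : TwoConvexAt b u x) : E2fun b u x ≤ 4 / 3 * calF2 b u x := by
  have := h.F2fun_nonneg
  rw [calF2]; linarith

lemma abs_symmHess_le (h : TwoConvexAt b u x) (i j : Fin m) :
    |symmHess b u x i j| ≤ subLap b u x := by
  refine abs_le_of_sq_le_sq ?_ h.subLap_nonneg
  refine le_trans ?_ h.sum_sq_le
  calc symmHess b u x i j ^ 2 ≤ ∑ j, symmHess b u x i j ^ 2 :=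
        Finset.single_le_sum (f := fun j => symmHess b u x i j ^ 2) (fun _ _ => sq_nonneg _)
          (Finset.mem_univ j)
    _ ≤ _ := Finset.single_le_sum (f := fun i => ∑ j, symmHess b u x i j ^ 2)
        (fun _ _ => Finset.sum_nonneg fun _ _ => sq_nonneg _) (Finset.mem_univ i)

lemma quadraticForm_le (h : TwoConvexAt b u x) (p : Fin m → ℝ) :
    (1 / m) * subLap b u x * ∑ i, p i ^ 2
      ≤ subLap b u x * ∑ i, p i ^ 2 + ∑ i, ∑ j, symmHess b u x i j * (p i * p j) := by
  set s := subLap b u x with hs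
  set q := ∑ i, p i ^ 2 with hq
  set A := symmHess b u x with hA
  set T := ∑ i, ∑ j, A i j * (p i * p j) with hT
  have hs0 : 0 ≤ s := h.subLap_nonneg
  have hq0 : 0 ≤ q := Finset.sum_nonneg fun _ _ => sq_nonneg _
  rcases Nat.eq_zero_or_pos m with rfl | hm
  · simp [hq, hT]
  have hm0 : (0 : ℝ) < m := by exact_mod_cast hm
  have hA2 : ∑ i, ∑ j, A i j ^ 2 ≤ s ^ 2 := h.sum_sq_le
  rcases hs0.eq_or_lt with h0 | hs1
  · have hz : ∀ i j, A i j = 0 := fun i j => by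
      have := h.abs_symmHess_le i j
      rw [← hs, ← h0] at this
      exact abs_nonpos_iff.1 this
    have : T = 0 := by simp [hT, hz]
    rw [← h0, this]; simp
  rcases hq0.eq_or_lt with h0 | hq1
  · have hz : ∀ i, p i = 0 := fun i => by
      have := (Finset.sum_eq_zero_iff_of_nonneg (fun i _ => sq_nonneg (p i))).1 h0.symm i
        (Finset.mem_univ i)
      exact pow_eq_zero_iff two_ne_zero |>.1 this
    have : T = 0 := by simp [hT, hz]
    rw [← h0, this]; simp
  set r := 2 * s / m * q with hr
  have hexp : ∑ i, ∑ j, (q * A i j + s * (p i * p j) - r * (if i = j then 1 else 0)) ^ 2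
      = q ^ 2 * (∑ i, ∑ j, A i j ^ 2) + s ^ 2 * q ^ 2 + r ^ 2 * m + 2 * q * s * T
        - 2 * q * r * s - 2 * s * r * q := by
    have e : ∀ i j, (q * A i j + s * (p i * p j) - r * (if i = j then 1 else 0)) ^ 2
        = q ^ 2 * A i j ^ 2 + s ^ 2 * (p i ^ 2 * p j ^ 2) + 2 * q * s * (A i j * (p i * p j))
          + (if i = j then r ^ 2 - 2 * q * r * A i j - 2 * s * r * (p i * p j) else 0) := by
      intro i j
      split_ifs <;> ring
    simp only [e, Finset.sum_add_distrib, Finset.sum_ite_eq, Finset.mem_univ, if_true,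
      Finset.sum_sub_distrib, ← Finset.mul_sum, ← Finset.sum_mul, ← sq, ← hq, ← hT]
    have hd : ∑ i, A i i = s := sum_symmHess_diag
    rw [hd]
    simp only [Finset.sum_const, Finset.card_univ, Fintype.card_fin, nsmul_eq_mul]
    ring
  have hnn : 0 ≤ ∑ i, ∑ j, (q * A i j + s * (p i * p j) - r * (if i = j then 1 else 0)) ^ 2 :=
    Finset.sum_nonneg fun _ _ => Finset.sum_nonneg fun _ _ => sq_nonneg _
  have hrm : r * m = 2 * s * q := by rw [hr]; field_simp
  have h1 : 0 ≤ q ^ 2 * s ^ 2 + s ^ 2 * q ^ 2 + r * (2 * s * q) + 2 * q * s * T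
        - 2 * q * r * s - 2 * s * r * q := by
    have := mul_le_mul_of_nonneg_left hA2 (sq_nonneg q)
    rw [hexp] at hnn
    have e : r ^ 2 * m = r * (2 * s * q) := by rw [← hrm]; ring
    rw [e] at hnn
    linarith
  have h2 : 0 ≤ (q * s) * (2 * (s * q + T - r)) := by
    refine le_trans h1 (le_of_eq ?_)
    ring
  have h3 := (mul_nonneg_iff_of_pos_left (mul_pos hq1 hs1)).1 h2
  have h4 : r = 2 * (1 / m * s * q) := by rw [hr]; ring
  have h5 : 0 ≤ 1 / m * s * q := by positivity
  linarith

end TwoConvexAt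

end Pointwise

section Calculus

variable {n m : ℕ} {Y Z : (Fin n → ℝ) → (Fin n → ℝ)} {f g : (Fin n → ℝ) → ℝ} {x : Fin n → ℝ}

lemma Xop_mul (hf : DifferentiableAt ℝ f x) (hg : DifferentiableAt ℝ g x) :
    Xop Z (fun y => f y * g y) x = f x * Xop Z g x + Xop Z f x * g x := by
  rw [Xop, fderiv_fun_mul hf hg]
  simp [Xop, mul_comm]

lemma Xop_comp {F : ℝ → ℝ} {F' : ℝ} (hF : HasDerivAt F F' (f x)) (hf : DifferentiableAt ℝ f x) :
    Xop Z (fun y => F (f y)) x = F' * Xop Z f x := by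
  have := (hF.comp_hasFDerivAt x hf.hasFDerivAt).fderiv
  rw [Xop]
  change fderiv ℝ (F ∘ f) x (Z x) = _
  rw [this]; simp [Xop]

lemma Xop_pow (k : ℕ) (hf : DifferentiableAt ℝ f x) :
    Xop Z (fun y => f y ^ k) x = k * f x ^ (k - 1) * Xop Z f x :=
  Xop_comp (F := fun t => t ^ k) (hasDerivAt_pow k (f x)) hf

lemma Xop_sum {ι : Type*} {s : Finset ι} {f : ι → (Fin n → ℝ) → ℝ}
    (hf : ∀ i ∈ s, DifferentiableAt ℝ (f i) x) :
    Xop Z (fun y => ∑ i ∈ s, f i y) x = ∑ i ∈ s, Xop Z (f i) x := by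
  rw [Xop, fderiv_fun_sum hf]
  simp [Xop]

lemma Xop_congr (h : f =ᶠ[𝓝 x] g) : Xop Z f x = Xop Z g x := by
  rw [Xop, h.fderiv_eq]; rfl

lemma ContDiff.Xop {k : ℕ} (hf : ContDiff ℝ (k + 1) f) (hZ : TestField Z) :
    ContDiff ℝ k (Xop Z f) :=
  (hf.fderiv_right le_rfl).clm_apply (hZ.contDiff.of_le (natCast_le_smooth k))

lemma Xop_bracket (hg : ContDiff ℝ 2 g) (hY : TestField Y) (hZ : TestField Z) (x : Fin n → ℝ) :
    Xop Y (Xop Z g) x - Xop Z (Xop Y g) x = Xop (vfBracket Y Z) g x := by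
  have hd : DifferentiableAt ℝ (fderiv ℝ g) x :=
    (hg.fderiv_right (m := 1) (by rw [one_add_one_eq_two])).differentiable one_ne_zero x
  have e : ∀ {A B : (Fin n → ℝ) → (Fin n → ℝ)}, TestField B → Xop A (Xop B g) x
      = fderiv ℝ (fderiv ℝ g) x (A x) (B x) + fderiv ℝ g x (fderiv ℝ B x (A x)) := by
    intro A B hB
    have := (hd.hasFDerivAt.clm_apply (hB.differentiable x).hasFDerivAt).fderiv
    rw [Xop]
    change fderiv ℝ (fun y => fderiv ℝ g y (B y)) x (A x) = _
    rw [this]; simp [add_comm]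
  have hs : fderiv ℝ (fderiv ℝ g) x (Y x) (Z x) = fderiv ℝ (fderiv ℝ g) x (Z x) (Y x) :=
    (hg.contDiffAt.isSymmSndFDerivAt (by simp)).eq (Y x) (Z x)
  rw [e hZ, e hY, hs, Xop, vfBracket_eq_fderiv (hY.differentiable x) (hZ.differentiable x), map_sub]
  ring

/-- `C¹` functions are approximated in the uniform `C¹` sense by smooth functions. -/
lemma exists_contDiff_fderiv_sub_le (hf : ContDiff ℝ 1 f) (hc : HasCompactSupport f) {δ : ℝ}
    (hδ : 0 < δ) :
    ∃ g : (Fin n → ℝ) → ℝ, ContDiff ℝ ((⊤ : ℕ∞) : WithTop ℕ∞) g ∧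
      ∀ x, ‖fderiv ℝ g x - fderiv ℝ f x‖ ≤ δ := by
  have hfc : Continuous (fderiv ℝ f) := hf.continuous_fderiv one_ne_zero
  obtain ⟨ε, hε, hu⟩ := Metric.uniformContinuous_iff.1
    ((hc.fderiv (𝕜 := ℝ)).uniformContinuous_of_continuous hfc) δ hδ
  let φ : ContDiffBump (0 : Fin n → ℝ) := ⟨ε / 2, ε, half_pos hε, half_lt_self hε⟩
  refine ⟨convolution (φ.normed volume) f (ContinuousLinearMap.lsmul ℝ ℝ) volume, ?_, fun x => ?_⟩
  · have hl : LocallyIntegrable f volume := hf.continuous.locallyIntegrable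
    exact (φ.hasCompactSupport_normed (μ := volume)).contDiff_convolution_left (n := ⊤) _
      φ.contDiff_normed hl
  · have h1 := (hc.hasFDerivAt_convolution_right (ContinuousLinearMap.lsmul ℝ ℝ)
      (μ := volume) (φ.continuous_normed (μ := volume)).locallyIntegrable hf x).fderiv
    rw [h1, ← dist_eq_norm]
    have e : convolution (φ.normed volume) (fderiv ℝ f)
        ((ContinuousLinearMap.lsmul ℝ ℝ).precompR (Fin n → ℝ)) volume x
        = convolution (φ.normed volume) (fderiv ℝ f) (ContinuousLinearMap.lsmul ℝ ℝ) volume x := by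
      simp only [convolution]
      congr 1
    rw [e]
    refine φ.dist_normed_convolution_le hfc.aestronglyMeasurable fun y hy => (hu ?_).le
    exact hy

/-- A continuous compactly supported field that is divergence free against smooth functions is
divergence free against `C¹` functions. -/
lemma integral_Xop_eq_zero_of_smooth (hZ : Continuous Z) (hZc : HasCompactSupport Z)
    (h : ∀ g : (Fin n → ℝ) → ℝ, ContDiff ℝ ((⊤ : ℕ∞) : WithTop ℕ∞) g → ∫ x, Xop Z g x = 0)
    (hf : ContDiff ℝ 1 f) (hc : HasCompactSupport f) : ∫ x, Xop Z f x = 0 := by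
  have h_int : ∀ g : (Fin n → ℝ) → ℝ, ContDiff ℝ 1 g → Integrable (Xop Z g) := fun g hg =>
    (continuous_Xop hg hZ).integrable_of_hasCompactSupport
      (hZc.mono' fun x hx => subset_tsupport _ (fun h0 => hx (by simp [Xop, h0])))
  have hN : Integrable fun x => ‖Z x‖ := (hZ.integrable_of_hasCompactSupport hZc).norm
  set N := ∫ x, ‖Z x‖
  have hN0 : 0 ≤ N := integral_nonneg fun _ => norm_nonneg _
  have key : ∀ δ > 0, |∫ x, Xop Z f x| ≤ δ * N := by
    intro δ hδ
    obtain ⟨g, hg, hgf⟩ := exists_contDiff_fderiv_sub_le hf hc hδ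
    have hg1 : ContDiff ℝ 1 g := hg.of_le (natCast_le_smooth 1)
    have e : ∫ x, Xop Z f x = ∫ x, (Xop Z f x - Xop Z g x) := by
      rw [integral_sub (h_int f hf) (h_int g hg1), h g hg, sub_zero]
    rw [e, ← integral_const_mul]
    refine (abs_integral_le_integral_abs).trans
      (integral_mono ((h_int f hf).sub (h_int g hg1)).abs (hN.const_mul δ) fun x => ?_)
    have : Xop Z f x - Xop Z g x = -((fderiv ℝ g x - fderiv ℝ f x) (Z x)) := by
      simp [Xop]
    dsimp only
    rw [this, abs_neg]
    exact ((fderiv ℝ g x - fderiv ℝ f x).le_opNorm (Z x)).trans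
      (mul_le_mul_of_nonneg_right (hgf x) (norm_nonneg _))
  by_contra hne
  have hp : 0 < |∫ x, Xop Z f x| := abs_pos.2 hne
  have := key (|∫ x, Xop Z f x| / (2 * (N + 1))) (by positivity)
  rw [div_mul_eq_mul_div, le_div_iff₀ (by positivity)] at this
  nlinarith

end Calculus

section FlatSystem

variable {n m : ℕ} {X : Fin m → (Fin n → ℝ) → (Fin n → ℝ)} {V : Set (Fin n → ℝ)}
  {f g u η : (Fin n → ℝ) → ℝ}

lemma vfBracket_swap (c d : (Fin n → ℝ) → (Fin n → ℝ)) (x : Fin n → ℝ) :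
    vfBracket c d x = -vfBracket d c x := by
  ext l; simp [vfBracket]

lemma vfBracket_neg_right (c d : (Fin n → ℝ) → (Fin n → ℝ)) (x : Fin n → ℝ) :
    vfBracket c (fun y => -d y) x = -vfBracket c d x := by
  ext l
  simp only [vfBracket, Pi.neg_apply, fderiv_fun_neg, neg_apply, map_neg]
  ring

/-- A system of test fields which on `V` is divergence free with vanishing second commutators. -/
structure FlatSystem (X : Fin m → (Fin n → ℝ) → (Fin n → ℝ)) (V : Set (Fin n → ℝ)) : Prop where
  field : ∀ i, TestField (X i)
  div : ∀ i, ∀ x ∈ V, divField (X i) x = 0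
  comm : ∀ i j, ∀ x ∈ V, vfBracket (X i) (fun y => vfBracket (X i) (X j) y) x = 0

lemma tsupport_mul_subset_of_left (h : tsupport f ⊆ V) : tsupport (fun x => f x * g x) ⊆ V :=
  (closure_mono (Function.support_mul_subset_left f g)).trans h

namespace FlatSystem

lemma integral_Xop_eq_zero (hX : FlatSystem X V) (i : Fin m) (hf : ContDiff ℝ 1 f)
    (hc : HasCompactSupport f) (hV : tsupport f ⊆ V) : ∫ x, Xop (X i) f x = 0 := by
  rw [(hX.field i).integral_Xop hf hc, neg_eq_zero]
  have : ∀ x, divField (X i) x * f x = 0 := fun x => by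
    by_cases hx : x ∈ tsupport f
    · rw [hX.div i x (hV hx), zero_mul]
    · rw [image_eq_zero_of_notMem_tsupport hx, mul_zero]
  simp [this]

lemma integral_mul_Xop (hX : FlatSystem X V) (i : Fin m) (hf : ContDiff ℝ 1 f)
    (hc : HasCompactSupport f) (hV : tsupport f ⊆ V) (hg : ContDiff ℝ 1 g) :
    ∫ x, f x * Xop (X i) g x = -∫ x, Xop (X i) f x * g x := by
  have hZ := (hX.field i).contDiff.continuous
  have h0 := hX.integral_Xop_eq_zero i (hf.mul hg) hc.mul_right (tsupport_mul_subset_of_left hV)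
  have e : ∀ x, Xop (X i) (fun y => f y * g y) x = f x * Xop (X i) g x + Xop (X i) f x * g x :=
    fun x => Xop_mul (hf.differentiable one_ne_zero x) (hg.differentiable one_ne_zero x)
  have h1 : Integrable fun x => f x * Xop (X i) g x :=
    (hf.continuous.mul (continuous_Xop hg hZ)).integrable_of_hasCompactSupport hc.mul_right
  have h2 : Integrable fun x => Xop (X i) f x * g x :=
    ((continuous_Xop hf hZ).mul hg.continuous).integrable_of_hasCompactSupport
      (hasCompactSupport_Xop hc).mul_right
  have h3 : ∫ x, Xop (X i) (fun y => f y * g y) x = 0 := h0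
  simp only [e] at h3
  rw [integral_add h1 h2] at h3
  linarith

lemma integral_cross (hX : FlatSystem X V) (i j : Fin m) (hf : ContDiff ℝ 1 f)
    (hc : HasCompactSupport f) (hV : tsupport f ⊆ V) (hg : ContDiff ℝ 1 g)
    (hgc : HasCompactSupport g) :
    ∫ x, (Xop (X i) f x * Xop (X j) g x - Xop (X j) f x * Xop (X i) g x
      + f x * Xop (vfBracket (X i) (X j)) g x) = 0 := by
  have hXi := (hX.field i).contDiff.continuous
  have hXj := (hX.field j).contDiff.continuous
  have hB : Continuous (vfBracket (X i) (X j)) :=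
    ((hX.field i).bracket (hX.field j)).contDiff.continuous
  set W : (Fin n → ℝ) → (Fin n → ℝ) := fun x =>
    Xop (X i) f x • X j x - Xop (X j) f x • X i x + f x • vfBracket (X i) (X j) x with hW
  have hWg : ∀ (g : (Fin n → ℝ) → ℝ) x, Xop W g x
      = Xop (X i) f x * Xop (X j) g x - Xop (X j) f x * Xop (X i) g x
      + f x * Xop (vfBracket (X i) (X j)) g x := fun g x => by
    simp [Xop, hW]
  simp only [← hWg]
  refine integral_Xop_eq_zero_of_smooth ?_ ?_ (fun p hp => ?_) hg hgc
  · exact (((continuous_Xop hf hXi).smul hXj).sub ((continuous_Xop hf hXj).smul hXi)).add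
      (hf.continuous.smul hB)
  · refine HasCompactSupport.intro hc fun x hx => ?_
    simp [hW, Xop, image_eq_zero_of_notMem_tsupport hx, fderiv_of_notMem_tsupport ℝ hx]
  · have hp2 : ContDiff ℝ 2 p := hp.of_le (natCast_le_smooth 2)
    have hpi : ∀ i, ContDiff ℝ 1 (Xop (X i) p) := fun i =>
      ContDiff.Xop (k := 1) (by simpa [one_add_one_eq_two] using hp2) (hX.field i)
    have e : ∀ x, Xop W p x = Xop (X i) (fun y => f y * Xop (X j) p y) x
        - Xop (X j) (fun y => f y * Xop (X i) p y) x := fun x => by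
      rw [hWg, Xop_mul (hf.differentiable one_ne_zero x) ((hpi j).differentiable one_ne_zero x),
        Xop_mul (hf.differentiable one_ne_zero x) ((hpi i).differentiable one_ne_zero x),
        ← Xop_bracket hp2 (hX.field i) (hX.field j)]
      ring
    have hI : ∀ i j, Integrable (Xop (X i) (fun y => f y * Xop (X j) p y)) := fun i j =>
      integrable_Xop (hf.mul (hpi j)) hc.mul_right (hX.field i).contDiff.continuous
    simp only [e]
    rw [integral_sub (hI i j) (hI j i),
      hX.integral_Xop_eq_zero i (hf.mul (hpi j)) hc.mul_right (tsupport_mul_subset_of_left hV),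
      hX.integral_Xop_eq_zero j (hf.mul (hpi i)) hc.mul_right (tsupport_mul_subset_of_left hV),
      sub_zero]

lemma contDiff_Xop (hX : FlatSystem X V) (hu : ContDiff ℝ 2 u) (i : Fin m) :
    ContDiff ℝ 1 (Xop (X i) u) :=
  ContDiff.Xop (k := 1) (by simpa [one_add_one_eq_two] using hu) (hX.field i)

lemma continuous_Xop_Xop (hX : FlatSystem X V) (hu : ContDiff ℝ 2 u) (i j : Fin m) :
    Continuous (Xop (X i) (Xop (X j) u)) :=
  continuous_Xop (hX.contDiff_Xop hu j) (hX.field i).contDiff.continuous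

lemma contDiff_commOp (hX : FlatSystem X V) (hu : ContDiff ℝ 2 u) (i j : Fin m) :
    ContDiff ℝ 1 (commOp X i j u) := by
  have : commOp X i j u = Xop (vfBracket (X i) (X j)) u :=
    funext fun x => Xop_bracket hu (hX.field i) (hX.field j) x
  rw [this]
  exact ContDiff.Xop (k := 1) (by simpa [one_add_one_eq_two] using hu)
    ((hX.field i).bracket (hX.field j))

lemma Xop_vfBracket_Xop (hX : FlatSystem X V) (hu : ContDiff ℝ 2 u) (i j : Fin m)
    {x : Fin n → ℝ} (hx : x ∈ V) :
    Xop (vfBracket (X i) (X j)) (Xop (X j) u) x = Xop (X j) (commOp X i j u) x := by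
  have hB := (hX.field i).bracket (hX.field j)
  have : commOp X i j u = Xop (vfBracket (X i) (X j)) u :=
    funext fun x => Xop_bracket hu (hX.field i) (hX.field j) x
  rw [this, ← sub_eq_zero]
  have h := Xop_bracket hu hB (hX.field j) x
  rw [show Xop (vfBracket (X i) (X j)) (Xop (X j) u) x
    - Xop (X j) (Xop (vfBracket (X i) (X j)) u) x = _ from h, Xop]
  have hz : vfBracket (fun x => vfBracket (X i) (X j) x) (X j) x = 0 := by
    rw [vfBracket_swap]
    have e : (fun x => vfBracket (X i) (X j) x) = fun x => -vfBracket (X j) (X i) x :=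
      funext fun x => vfBracket_swap _ _ _
    rw [e, vfBracket_neg_right]
    have := hX.comm j i x hx
    rw [show vfBracket (X j) (vfBracket (X j) (X i)) x = 0 from this]; simp
  rw [hz, map_zero]

lemma integral_pair (hX : FlatSystem X V) (hu : ContDiff ℝ 2 u) (huc : HasCompactSupport u)
    (hη : ContDiff ℝ 1 η) (hc : HasCompactSupport η) (hV : tsupport η ⊆ V) (i j : Fin m) :
    ∫ x, (Xop (X i) (fun y => η y * Xop (X i) u y) x * Xop (X j) (Xop (X j) u) x
      - Xop (X j) (fun y => η y * Xop (X i) u y) x * Xop (X i) (Xop (X j) u) x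
      - Xop (X j) (fun y => η y * Xop (X i) u y) x * commOp X i j u x) = 0 := by
  set h : (Fin n → ℝ) → ℝ := fun y => η y * Xop (X i) u y with hh
  have hh1 : ContDiff ℝ 1 h := hη.mul (hX.contDiff_Xop hu i)
  have hhc : HasCompactSupport h := hc.mul_right
  have hhV : tsupport h ⊆ V := tsupport_mul_subset_of_left hV
  have h1 := hX.integral_cross i j hh1 hhc hhV (hX.contDiff_Xop hu j) (hasCompactSupport_Xop huc)
  have h2 := hX.integral_mul_Xop j hh1 hhc hhV (hX.contDiff_commOp hu i j)
  have e : ∀ x, h x * Xop (vfBracket (X i) (X j)) (Xop (X j) u) x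
      = h x * Xop (X j) (commOp X i j u) x := fun x => by
    by_cases hx : x ∈ V
    · rw [hX.Xop_vfBracket_Xop hu i j hx]
    · rw [image_eq_zero_of_notMem_tsupport (fun hx' => hx (hhV hx')), zero_mul, zero_mul]
  simp only [e] at h1
  have hXc : ∀ i, Continuous (Xop (X i) h) := fun i =>
    continuous_Xop hh1 (hX.field i).contDiff.continuous
  have hs : ∀ i, HasCompactSupport (Xop (X i) h) := fun i => hasCompactSupport_Xop hhc
  have I1 : Integrable fun x => Xop (X i) h x * Xop (X j) (Xop (X j) u) x
      - Xop (X j) h x * Xop (X i) (Xop (X j) u) x :=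
    (((hXc i).mul (hX.continuous_Xop_Xop hu j j)).integrable_of_hasCompactSupport
      (hs i).mul_right).sub
    (((hXc j).mul (hX.continuous_Xop_Xop hu i j)).integrable_of_hasCompactSupport
      (hs j).mul_right)
  have I2 : Integrable fun x => h x * Xop (X j) (commOp X i j u) x :=
    (hh1.continuous.mul (continuous_Xop (hX.contDiff_commOp hu i j)
      (hX.field j).contDiff.continuous)).integrable_of_hasCompactSupport hhc.mul_right
  have I3 : Integrable fun x => Xop (X j) h x * commOp X i j u x :=
    ((hXc j).mul (hX.contDiff_commOp hu i j).continuous).integrable_of_hasCompactSupport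
      (hs j).mul_right
  rw [integral_add I1 I2, h2] at h1
  rw [integral_sub I1 I3]
  linarith

lemma continuous_calF2 (hX : FlatSystem X V) (hu : ContDiff ℝ 2 u) :
    Continuous (calF2 X u) := by
  have hh := hX.continuous_Xop_Xop hu
  have hcm : ∀ i j, Continuous (commOp X i j u) := fun i j =>
    (hX.contDiff_commOp hu i j).continuous
  have e : calF2 X u = fun x => (∑ i, ∑ j, (Xop (X i) (Xop (X i) u) x * Xop (X j) (Xop (X j) u) x
      - Xop (X j) (Xop (X i) u) x * Xop (X i) (Xop (X j) u) x)
      + (1 / 2) * ∑ i, ∑ j, commOp X i j u x ^ 2) / 2 := by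
    funext x
    have h1 := two_mul_F2fun_eq_sum (b := X) (u := u) (x := x)
    have h2 := sum_commOp_sq (b := X) (u := u) (x := x)
    rw [calF2]; linarith
  rw [e]
  fun_prop

/-- The remainder in the integral identity for `calF2`. -/
noncomputable def _root_.calF2Remainder (X : Fin m → (Fin n → ℝ) → (Fin n → ℝ))
    (u η : (Fin n → ℝ) → ℝ) (x : Fin n → ℝ) : ℝ :=
  ∑ i, ∑ j, Xop (X i) u x * (Xop (X i) η x * Xop (X j) (Xop (X j) u) x
    - Xop (X j) η x * (symmHess X u x i j + 3 / 2 * commOp X i j u x))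

lemma integral_calF2 (hX : FlatSystem X V) (hu : ContDiff ℝ 2 u) (huc : HasCompactSupport u)
    (hη : ContDiff ℝ 1 η) (hc : HasCompactSupport η) (hV : tsupport η ⊆ V) :
    2 * ∫ x, η x * calF2 X u x = -∫ x, calF2Remainder X u η x := by
  have hh := hX.continuous_Xop_Xop hu
  have hcm : ∀ i j, Continuous (commOp X i j u) := fun i j =>
    (hX.contDiff_commOp hu i j).continuous
  have hu1 : ∀ i, Continuous (Xop (X i) u) := fun i => (hX.contDiff_Xop hu i).continuous
  have hη1 : ∀ i, Continuous (Xop (X i) η) := fun i =>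
    continuous_Xop hη (hX.field i).contDiff.continuous
  have hsum : ∀ x, ∑ i, ∑ j,
      (Xop (X i) (fun y => η y * Xop (X i) u y) x * Xop (X j) (Xop (X j) u) x
      - Xop (X j) (fun y => η y * Xop (X i) u y) x * Xop (X i) (Xop (X j) u) x
      - Xop (X j) (fun y => η y * Xop (X i) u y) x * commOp X i j u x)
      = 2 * (η x * calF2 X u x) + calF2Remainder X u η x := by
    intro x
    have h1 := two_mul_F2fun_eq_sum (b := X) (u := u) (x := x)
    have h2 := sum_commOp_sq (b := X) (u := u) (x := x)
    have h3 : ∑ i, ∑ j, Xop (X j) (Xop (X i) u) x * commOp X i j u x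
        = -(1 / 2) * ∑ i, ∑ j, commOp X i j u x ^ 2 := by
      have h4 : ∑ i, ∑ j, Xop (X j) (Xop (X i) u) x * commOp X i j u x
          = ∑ i, ∑ j, Xop (X i) (Xop (X j) u) x * commOp X j i u x := Finset.sum_comm
      have h5 : ∑ i, ∑ j, Xop (X j) (Xop (X i) u) x * commOp X i j u x
          + ∑ i, ∑ j, Xop (X i) (Xop (X j) u) x * commOp X j i u x
          = -∑ i, ∑ j, commOp X i j u x ^ 2 := by
        rw [← Finset.sum_add_distrib, ← Finset.sum_neg_distrib]
        refine Finset.sum_congr rfl fun i _ => ?_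
        rw [← Finset.sum_add_distrib, ← Finset.sum_neg_distrib]
        refine Finset.sum_congr rfl fun j _ => ?_
        simp only [commOp]; ring
      linarith
    have h6 : 2 * (η x * calF2 X u x) = η x * (∑ i, ∑ j,
        (Xop (X i) (Xop (X i) u) x * Xop (X j) (Xop (X j) u) x
        - Xop (X j) (Xop (X i) u) x * Xop (X i) (Xop (X j) u) x)
        - ∑ i, ∑ j, Xop (X j) (Xop (X i) u) x * commOp X i j u x) := by
      rw [h3, calF2]
      linear_combination η x * h1 - (3 / 4) * η x * h2
    rw [h6, calF2Remainder, ← Finset.sum_sub_distrib, Finset.mul_sum, ← Finset.sum_add_distrib]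
    refine Finset.sum_congr rfl fun i _ => ?_
    rw [← Finset.sum_sub_distrib, Finset.mul_sum, ← Finset.sum_add_distrib]
    refine Finset.sum_congr rfl fun j _ => ?_
    have hd : DifferentiableAt ℝ η x := hη.differentiable one_ne_zero x
    have hd' : DifferentiableAt ℝ (Xop (X i) u) x :=
      (hX.contDiff_Xop hu i).differentiable one_ne_zero x
    rw [Xop_mul hd hd', Xop_mul hd hd']
    simp only [symmHess, commOp]
    ring
  have hηs : ∀ i, HasCompactSupport (fun y => η y * Xop (X i) u y) := fun i => hc.mul_right
  have hηd : ∀ i j, Continuous (Xop (X j) (fun y => η y * Xop (X i) u y)) := fun i j =>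
    continuous_Xop (hη.mul (hX.contDiff_Xop hu i)) (hX.field j).contDiff.continuous
  have h_int : ∀ i j, Integrable fun x =>
      (Xop (X i) (fun y => η y * Xop (X i) u y) x * Xop (X j) (Xop (X j) u) x
      - Xop (X j) (fun y => η y * Xop (X i) u y) x * Xop (X i) (Xop (X j) u) x
      - Xop (X j) (fun y => η y * Xop (X i) u y) x * commOp X i j u x) := fun i j =>
    (((((hηd i i).mul (hh j j)).integrable_of_hasCompactSupport
      (hasCompactSupport_Xop (hηs i)).mul_right)).sub
    (((hηd i j).mul (hh i j)).integrable_of_hasCompactSupport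
      (hasCompactSupport_Xop (hηs i)).mul_right)).sub
    (((hηd i j).mul (hcm i j)).integrable_of_hasCompactSupport
      (hasCompactSupport_Xop (hηs i)).mul_right)
  have h0 : ∫ x, ∑ i, ∑ j,
      (Xop (X i) (fun y => η y * Xop (X i) u y) x * Xop (X j) (Xop (X j) u) x
      - Xop (X j) (fun y => η y * Xop (X i) u y) x * Xop (X i) (Xop (X j) u) x
      - Xop (X j) (fun y => η y * Xop (X i) u y) x * commOp X i j u x) = 0 := by
    rw [integral_finsetSum _ fun i _ => integrable_finsetSum _ fun j _ => h_int i j]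
    refine Finset.sum_eq_zero fun i _ => ?_
    rw [integral_finsetSum _ fun j _ => h_int i j]
    exact Finset.sum_eq_zero fun j _ => hX.integral_pair hu huc hη hc hV i j
  have J1 : Integrable fun x => 2 * (η x * calF2 X u x) :=
    ((hη.continuous.mul (hX.continuous_calF2 hu)).integrable_of_hasCompactSupport
      hc.mul_right).const_mul 2
  have J2 : Integrable (calF2Remainder X u η) := by
    have : calF2Remainder X u η = fun x => ∑ i, ∑ j,
      (Xop (X i) (fun y => η y * Xop (X i) u y) x * Xop (X j) (Xop (X j) u) x
      - Xop (X j) (fun y => η y * Xop (X i) u y) x * Xop (X i) (Xop (X j) u) x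
      - Xop (X j) (fun y => η y * Xop (X i) u y) x * commOp X i j u x)
      - 2 * (η x * calF2 X u x) := by
      funext x; rw [hsum]; ring
    rw [this]
    exact (integrable_finsetSum _ fun i _ => integrable_finsetSum _ fun j _ => h_int i j).sub J1
  simp only [hsum] at h0
  rw [integral_add J1 J2, integral_const_mul] at h0
  linarith

end FlatSystem

end FlatSystem

section Energy

variable {n m : ℕ} {X : Fin m → (Fin n → ℝ) → (Fin n → ℝ)} {V : Set (Fin n → ℝ)}
  {u φ : (Fin n → ℝ) → ℝ} {B : ℝ}

/-- A smooth cutoff function supported in `V`. -/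
structure IsCutoff (V : Set (Fin n → ℝ)) (φ : (Fin n → ℝ) → ℝ) : Prop where
  contDiff : ContDiff ℝ ((⊤ : ℕ∞) : WithTop ℕ∞) φ
  compact : HasCompactSupport φ
  subset : tsupport φ ⊆ V
  nonneg : ∀ x, 0 ≤ φ x
  le_one : ∀ x, φ x ≤ 1

lemma hasCompactSupport_pow (h : HasCompactSupport φ) {k : ℕ} (hk : k ≠ 0) :
    HasCompactSupport fun x => φ x ^ k :=
  h.comp_left (g := fun t : ℝ => t ^ k) (zero_pow hk)

lemma IsCutoff.pow (h : IsCutoff V φ) {k : ℕ} (hk : k ≠ 0) : IsCutoff V fun x => φ x ^ k where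
  contDiff := h.contDiff.pow k
  compact := hasCompactSupport_pow h.compact hk
  subset := (closure_mono fun x hx => by
    simp only [Function.mem_support] at hx ⊢
    exact fun h0 => hx (by rw [h0, zero_pow hk])).trans h.subset
  nonneg := fun x => pow_nonneg (h.nonneg x) k
  le_one := fun x => pow_le_one₀ (h.nonneg x) (h.le_one x)

lemma IsCutoff.eq_zero (h : IsCutoff V φ) {x : Fin n → ℝ} (hx : x ∉ V) : φ x = 0 :=
  image_eq_zero_of_notMem_tsupport fun hx' => hx (h.subset hx')

lemma IsCutoff.contDiff_one (h : IsCutoff V φ) : ContDiff ℝ 1 φ :=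
  h.contDiff.of_le (natCast_le_smooth 1)

/-- The square of the length of the horizontal gradient. -/
noncomputable def gradSq (X : Fin m → (Fin n → ℝ) → (Fin n → ℝ)) (u : (Fin n → ℝ) → ℝ)
    (x : Fin n → ℝ) : ℝ :=
  ∑ i, Xop (X i) u x ^ 2

lemma gradSq_nonneg (x : Fin n → ℝ) : 0 ≤ gradSq X u x :=
  Finset.sum_nonneg fun _ _ => sq_nonneg _

lemma abs_Xop_le_sqrt_gradSq (i : Fin m) (x : Fin n → ℝ) :
    |Xop (X i) u x| ≤ √(gradSq X u x) :=
  Real.abs_le_sqrt (Finset.single_le_sum (f := fun i => Xop (X i) u x ^ 2)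
    (fun _ _ => sq_nonneg _) (Finset.mem_univ i))

namespace FlatSystem

lemma contDiff_gradSq (hX : FlatSystem X V) (hu : ContDiff ℝ 2 u) :
    ContDiff ℝ 1 (gradSq X u) :=
  ContDiff.sum fun i _ => (hX.contDiff_Xop hu i).pow 2

lemma continuous_subLap (hX : FlatSystem X V) (hu : ContDiff ℝ 2 u) : Continuous (subLap X u) :=
  continuous_finsetSum _ fun i _ => hX.continuous_Xop_Xop hu i i

lemma Xop_gradSq (hX : FlatSystem X V) (hu : ContDiff ℝ 2 u) (i : Fin m) (x : Fin n → ℝ) :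
    Xop (X i) (gradSq X u) x = 2 * ∑ j, Xop (X j) u x * Xop (X i) (Xop (X j) u) x := by
  have hd : ∀ j, DifferentiableAt ℝ (Xop (X j) u) x := fun j =>
    (hX.contDiff_Xop hu j).differentiable one_ne_zero x
  have : Xop (X i) (gradSq X u) x = Xop (X i) (fun y => ∑ j, Xop (X j) u y ^ 2) x := rfl
  rw [this, Xop_sum (f := fun j y => Xop (X j) u y ^ 2) fun j _ => (hd j).pow 2, Finset.mul_sum]
  refine Finset.sum_congr rfl fun j _ => ?_
  rw [Xop_pow 2 (hd j)]
  norm_num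
  ring

lemma abs_Xop_pow_le (hφ : IsCutoff V φ) (hB : ∀ i x, |Xop (X i) φ x| ≤ B) (k : ℕ) (i : Fin m)
    (x : Fin n → ℝ) : |Xop (X i) (fun y => φ y ^ (k + 1)) x| ≤ (k + 1) * B * φ x ^ k := by
  rw [Xop_pow (k + 1) (hφ.contDiff_one.differentiable one_ne_zero x), abs_mul, abs_mul,
    Nat.add_sub_cancel, abs_of_nonneg (pow_nonneg (hφ.nonneg x) k)]
  have h0 : (0 : ℝ) ≤ (k : ℝ) + 1 := by positivity
  push_cast
  rw [abs_of_nonneg h0]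
  have := mul_le_mul_of_nonneg_left (hB i x) (mul_nonneg h0 (pow_nonneg (hφ.nonneg x) k))
  linarith

lemma sum_Xop_mul_sqrt (hX : FlatSystem X V) (hu : ContDiff ℝ 2 u) {x : Fin n → ℝ}
    (hconv : TwoConvexAt X u x) {δ : ℝ} (hδ : 0 < δ) :
    1 / m * (√(gradSq X u x) * subLap X u x)
      ≤ ∑ i, Xop (X i) (fun y => Xop (X i) u y * √(δ + gradSq X u y)) x := by
  set w := gradSq X u x with hw
  have hw0 : 0 ≤ w := gradSq_nonneg x
  set R := √(δ + w) with hR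
  have hR0 : 0 < R := Real.sqrt_pos.2 (by positivity)
  have hR2 : R ^ 2 = δ + w := Real.sq_sqrt (by positivity)
  set s := subLap X u x with hs
  have hs0 : 0 ≤ s := hconv.subLap_nonneg
  have hd : ∀ j, DifferentiableAt ℝ (Xop (X j) u) x := fun j =>
    (hX.contDiff_Xop hu j).differentiable one_ne_zero x
  have hwd : DifferentiableAt ℝ (gradSq X u) x :=
    (hX.contDiff_gradSq hu).differentiable one_ne_zero x
  have hF : HasDerivAt (fun t : ℝ => √(δ + t)) (1 / (2 * R)) w :=
    ((hasDerivAt_id w).const_add δ).sqrt (by simp; positivity)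
  have hRx : ∀ i, Xop (X i) (fun y => √(δ + gradSq X u y)) x
      = (∑ j, Xop (X j) u x * Xop (X i) (Xop (X j) u) x) / R := fun i => by
    rw [Xop_comp (F := fun t => √(δ + t)) hF hwd, hX.Xop_gradSq hu]
    field_simp
  have hRd : DifferentiableAt ℝ (fun y => √(δ + gradSq X u y)) x :=
    (hwd.const_add δ).sqrt (by positivity)
  have e : ∑ i, Xop (X i) (fun y => Xop (X i) u y * √(δ + gradSq X u y)) x
      = s * R + (∑ i, ∑ j, symmHess X u x i j * (Xop (X i) u x * Xop (X j) u x)) / R := by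
    have e1 : ∑ i, ∑ j, symmHess X u x i j * (Xop (X i) u x * Xop (X j) u x)
        = ∑ i, Xop (X i) u x * ∑ j, Xop (X j) u x * Xop (X i) (Xop (X j) u) x := by
      have e2 : ∑ i, ∑ j, Xop (X j) (Xop (X i) u) x * (Xop (X i) u x * Xop (X j) u x)
          = ∑ i, ∑ j, Xop (X i) (Xop (X j) u) x * (Xop (X i) u x * Xop (X j) u x) := by
        rw [Finset.sum_comm]
        refine Finset.sum_congr rfl fun i _ => Finset.sum_congr rfl fun j _ => by ring
      have e3 : ∑ i, ∑ j, symmHess X u x i j * (Xop (X i) u x * Xop (X j) u x)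
          = (∑ i, ∑ j, Xop (X i) (Xop (X j) u) x * (Xop (X i) u x * Xop (X j) u x)
            + ∑ i, ∑ j, Xop (X j) (Xop (X i) u) x * (Xop (X i) u x * Xop (X j) u x)) / 2 := by
        rw [← Finset.sum_add_distrib, Finset.sum_div]
        refine Finset.sum_congr rfl fun i _ => ?_
        rw [← Finset.sum_add_distrib, Finset.sum_div]
        refine Finset.sum_congr rfl fun j _ => ?_
        simp only [symmHess]; ring
      rw [e3, e2, add_self_div_two]
      refine Finset.sum_congr rfl fun i _ => ?_
      rw [Finset.mul_sum]
      exact Finset.sum_congr rfl fun j _ => by ring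
    rw [e1, hs, subLap, Finset.sum_mul, Finset.sum_div, ← Finset.sum_add_distrib]
    refine Finset.sum_congr rfl fun i _ => ?_
    rw [Xop_mul (hd i) hRd, hRx]
    ring
  have hq := hconv.quadraticForm_le fun i => Xop (X i) u x
  change 1 / (m : ℝ) * s * w ≤ s * w + _ at hq
  rw [e]
  set Q := ∑ i, ∑ j, symmHess X u x i j * (Xop (X i) u x * Xop (X j) u x)
  have hm1 : 1 / (m : ℝ) ≤ 1 := by
    rw [one_div]; exact Nat.cast_inv_le_one m
  have hm0 : 0 ≤ 1 / (m : ℝ) := by positivity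
  have hQ : -(1 - 1 / (m : ℝ)) * s * R ≤ Q / R := by
    rw [le_div_iff₀ hR0]
    have : (1 - 1 / (m : ℝ)) * s * w ≤ (1 - 1 / (m : ℝ)) * s * R ^ 2 :=
      mul_le_mul_of_nonneg_left (by rw [hR2]; linarith)
        (mul_nonneg (by linarith) hs0)
    nlinarith
  have hwR : √w ≤ R := Real.sqrt_le_sqrt (by linarith)
  have : 1 / (m : ℝ) * (√w * s) ≤ 1 / (m : ℝ) * (R * s) := by gcongr
  linarith

lemma integral_sqrt_gradSq_mul_subLap_le (hX : FlatSystem X V) (hφ : IsCutoff V φ)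
    (hB : ∀ i x, |Xop (X i) φ x| ≤ B) (hB0 : 0 ≤ B) {k : ℕ} (hk : k ≠ 0) (hu : ContDiff ℝ 2 u)
    (hconv : ∀ x ∈ V, TwoConvexAt X u x) :
    ∫ x, φ x ^ (k + 1) * (√(gradSq X u x) * subLap X u x)
      ≤ m * (m * ((k + 1) * B)) * ∫ x, φ x ^ k * gradSq X u x := by
  rcases Nat.eq_zero_or_pos m with rfl | hm
  · simp [subLap]
  have hm0 : (0 : ℝ) < m := by exact_mod_cast hm
  have hζ : IsCutoff V fun x => φ x ^ (k + 1) := hφ.pow (Nat.succ_ne_zero k)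
  have hw1 := hX.contDiff_gradSq hu
  have hφc := hφ.contDiff.continuous
  have hI1 : Integrable fun x => φ x ^ k * gradSq X u x :=
    ((hφc.pow k).mul hw1.continuous).integrable_of_hasCompactSupport
      (hφ.pow hk).compact.mul_right
  have hI2 : Integrable fun x => φ x ^ k :=
    (hφc.pow k).integrable_of_hasCompactSupport (hφ.pow hk).compact
  have hI3 : Integrable fun x => φ x ^ (k + 1) * (√(gradSq X u x) * subLap X u x) :=
    ((hφc.pow (k + 1)).mul (hw1.continuous.sqrt.mul
      (hX.continuous_subLap hu))).integrable_of_hasCompactSupport hζ.compact.mul_right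
  have key : ∀ δ > 0, 1 / m * ∫ x, φ x ^ (k + 1) * (√(gradSq X u x) * subLap X u x)
      ≤ m * ((k + 1) * B) * (∫ x, φ x ^ k * gradSq X u x)
        + δ * (m * ((k + 1) * B) * ∫ x, φ x ^ k) := by
    intro δ hδ
    have hR1 : ContDiff ℝ 1 fun y => √(δ + gradSq X u y) :=
      (contDiff_const.add hw1).sqrt fun x => by
        have := gradSq_nonneg (X := X) (u := u) x
        positivity
    have hg : ∀ i, ContDiff ℝ 1 fun y => Xop (X i) u y * √(δ + gradSq X u y) := fun i =>
      (hX.contDiff_Xop hu i).mul hR1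
    have hgi : ∀ i, Integrable fun x => φ x ^ (k + 1) *
        Xop (X i) (fun y => Xop (X i) u y * √(δ + gradSq X u y)) x := fun i =>
      ((hφc.pow (k + 1)).mul (continuous_Xop (hg i)
        (hX.field i).contDiff.continuous)).integrable_of_hasCompactSupport hζ.compact.mul_right
    have h1 : 1 / m * ∫ x, φ x ^ (k + 1) * (√(gradSq X u x) * subLap X u x)
        ≤ ∑ i, ∫ x, φ x ^ (k + 1) *
          Xop (X i) (fun y => Xop (X i) u y * √(δ + gradSq X u y)) x := by
      rw [← integral_finsetSum _ fun i _ => hgi i, ← integral_const_mul]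
      refine integral_mono (hI3.const_mul _) (integrable_finsetSum _ fun i _ => hgi i) fun x => ?_
      dsimp only
      rw [← Finset.mul_sum]
      by_cases hx : x ∈ V
      · have := mul_le_mul_of_nonneg_left (hX.sum_Xop_mul_sqrt hu (hconv x hx) hδ)
          (hζ.nonneg x)
        linarith
      · rw [hζ.eq_zero hx]; simp
    refine h1.trans ?_
    have h2 : ∀ i, ∫ x, φ x ^ (k + 1) *
          Xop (X i) (fun y => Xop (X i) u y * √(δ + gradSq X u y)) x
        ≤ ∫ x, (k + 1) * B * (φ x ^ k * gradSq X u x + δ * φ x ^ k) := by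
      intro i
      rw [hX.integral_mul_Xop i hζ.contDiff_one hζ.compact hζ.subset (hg i), ← integral_neg]
      refine integral_mono ?_ ((hI1.add (hI2.const_mul δ)).const_mul _) fun x => ?_
      · exact (((continuous_Xop hζ.contDiff_one (hX.field i).contDiff.continuous).mul
          (hg i).continuous).integrable_of_hasCompactSupport
          (hasCompactSupport_Xop hζ.compact).mul_right).neg
      · have ha := abs_Xop_pow_le hφ hB k i x
        have hb := abs_Xop_le_sqrt_gradSq (X := X) (u := u) i x
        have hw0 := gradSq_nonneg (X := X) (u := u) x
        have hR : √(gradSq X u x) ≤ √(δ + gradSq X u x) := Real.sqrt_le_sqrt (by linarith)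
        have hR0 := Real.sqrt_nonneg (δ + gradSq X u x)
        have hR2 : √(δ + gradSq X u x) * √(δ + gradSq X u x) = δ + gradSq X u x :=
          Real.mul_self_sqrt (by positivity)
        have hp := pow_nonneg (hφ.nonneg x) k
        calc -(Xop (X i) (fun y => φ y ^ (k + 1)) x * (Xop (X i) u x * √(δ + gradSq X u x)))
            ≤ |Xop (X i) (fun y => φ y ^ (k + 1)) x| * (|Xop (X i) u x| * √(δ + gradSq X u x)) := by
              rw [← abs_of_nonneg hR0, ← abs_mul, ← abs_mul, abs_of_nonneg hR0]
              exact neg_le_abs _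
          _ ≤ ((k + 1) * B * φ x ^ k) * (√(δ + gradSq X u x) * √(δ + gradSq X u x)) := by
              gcongr
              exact hb.trans hR
          _ = _ := by rw [hR2]; ring
    have e := integral_add hI1 (hI2.const_mul δ)
    calc _ ≤ ∑ _i : Fin m, ∫ x, (k + 1) * B * (φ x ^ k * gradSq X u x + δ * φ x ^ k) :=
          Finset.sum_le_sum fun i _ => h2 i
      _ = _ := by
          rw [integral_const_mul, e, integral_const_mul]
          simp only [Finset.sum_const, Finset.card_univ, Fintype.card_fin, nsmul_eq_mul]
          ring
  have h3 : 1 / m * ∫ x, φ x ^ (k + 1) * (√(gradSq X u x) * subLap X u x)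
      ≤ m * ((k + 1) * B) * ∫ x, φ x ^ k * gradSq X u x := by
    have hc : Tendsto (fun δ : ℝ => m * ((k + 1) * B) * (∫ x, φ x ^ k * gradSq X u x)
        + δ * (m * ((k + 1) * B) * ∫ x, φ x ^ k)) (𝓝[>] 0)
        (𝓝 (m * ((k + 1) * B) * (∫ x, φ x ^ k * gradSq X u x)
        + 0 * (m * ((k + 1) * B) * ∫ x, φ x ^ k))) :=
      (Continuous.tendsto (by fun_prop) 0).mono_left nhdsWithin_le_nhds
    rw [zero_mul, add_zero] at hc
    exact ge_of_tendsto hc (eventually_mem_nhdsWithin.mono fun δ hδ => key δ hδ)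
  have := mul_le_mul_of_nonneg_left h3 hm0.le
  rw [← mul_assoc, mul_one_div_cancel hm0.ne', one_mul] at this
  linarith

end FlatSystem

end Energy

section Energy

variable {n m : ℕ} {X : Fin m → (Fin n → ℝ) → (Fin n → ℝ)} {V : Set (Fin n → ℝ)}
  {u φ : (Fin n → ℝ) → ℝ} {B : ℝ}

lemma sum_commOp_sq_le {x : Fin n → ℝ} (h : TwoConvexAt X u x) :
    ∑ i, ∑ j, commOp X i j u x ^ 2 ≤ 8 / 3 * calF2 X u x := by
  rw [sum_commOp_sq]
  linarith [h.E2fun_le]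

lemma neg_calF2Remainder_le (hφ : IsCutoff V φ) (hB : ∀ i x, |Xop (X i) φ x| ≤ B)
    (hB0 : 0 ≤ B) (k : ℕ) {x : Fin n → ℝ} (h : TwoConvexAt X u x) :
    -calF2Remainder X u (fun y => φ y ^ (k + 2)) x
      ≤ (m + m * m) * ((k + 2) * B) * (φ x ^ (k + 1) * (√(gradSq X u x) * subLap X u x))
        + m * m * (3 / 2 * ((k + 2) * B) ^ 2) * (φ x ^ k * gradSq X u x)
        + φ x ^ (k + 2) * calF2 X u x := by
  set w := gradSq X u x with hw
  set s := subLap X u x with hs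
  set D := (k + 2) * B with hD
  have hD0 : 0 ≤ D := by positivity
  have hw0 : 0 ≤ w := gradSq_nonneg x
  have hsw : √w ^ 2 = w := Real.sq_sqrt hw0
  have hs0 : 0 ≤ s := h.subLap_nonneg
  have hφ0 := hφ.nonneg x
  set p := φ x
  set η : (Fin n → ℝ) → ℝ := fun y => φ y ^ (k + 2) with hη
  have hη' : ∀ i, |Xop (X i) η x| ≤ D * p ^ (k + 1) := fun i => by
    have := FlatSystem.abs_Xop_pow_le hφ hB (k + 1) i x
    refine this.trans (le_of_eq ?_)
    rw [hD]; push_cast; ring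
  have hui : ∀ i, |Xop (X i) u x| ≤ √w := fun i => abs_Xop_le_sqrt_gradSq i x
  have e : -calF2Remainder X u η x = ∑ i, (-(Xop (X i) u x * Xop (X i) η x * s)
      + ∑ j, Xop (X i) u x * Xop (X j) η x * (symmHess X u x i j + 3 / 2 * commOp X i j u x)) := by
    rw [calF2Remainder, ← Finset.sum_neg_distrib]
    refine Finset.sum_congr rfl fun i _ => ?_
    rw [hs, subLap, Finset.mul_sum, ← Finset.sum_neg_distrib, ← Finset.sum_neg_distrib,
      ← Finset.sum_add_distrib]
    exact Finset.sum_congr rfl fun j _ => by ring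
  have hprod : ∀ i j, |Xop (X i) u x * Xop (X j) η x| ≤ √w * (D * p ^ (k + 1)) := fun i j => by
    rw [abs_mul]
    exact mul_le_mul (hui i) (hη' j) (abs_nonneg _) (Real.sqrt_nonneg _)
  have b1 : ∀ i, -(Xop (X i) u x * Xop (X i) η x * s) ≤ D * (p ^ (k + 1) * (√w * s)) := fun i => by
    have h1 := (neg_le_abs _).trans (hprod i i)
    have := mul_le_mul_of_nonneg_right h1 hs0
    linarith
  have b2 : ∀ i j, Xop (X i) u x * Xop (X j) η x
        * (symmHess X u x i j + 3 / 2 * commOp X i j u x)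
      ≤ D * (p ^ (k + 1) * (√w * s)) + (3 / 2 * D ^ 2 * (p ^ k * w)
        + 3 / 8 * (p ^ (k + 2) * commOp X i j u x ^ 2)) := fun i j => by
    set c := commOp X i j u x
    have hA := h.abs_symmHess_le i j
    have h1 : |symmHess X u x i j + 3 / 2 * c| ≤ s + 3 / 2 * |c| := by
      refine (abs_add_le _ _).trans (add_le_add hA (le_of_eq ?_))
      rw [abs_mul, abs_of_pos (by norm_num : (0 : ℝ) < 3 / 2)]
    have h2 := mul_le_mul (hprod i j) h1 (abs_nonneg _) (by positivity)
    rw [← abs_mul] at h2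
    refine (le_abs_self _).trans (h2.trans ?_)
    have h3 : (3 / 2 * D * √w) * (p * |c|)
        ≤ 2 / 3 * (3 / 2 * D * √w) ^ 2 + 3 / 8 * (p * |c|) ^ 2 := by
      nlinarith [sq_nonneg (3 / 2 * D * √w - 3 / 4 * (p * |c|))]
    have h4 := mul_le_mul_of_nonneg_left h3 (pow_nonneg hφ0 k)
    have h5 : p ^ k * (2 / 3 * (3 / 2 * D * √w) ^ 2 + 3 / 8 * (p * |c|) ^ 2)
        = 3 / 2 * D ^ 2 * (p ^ k * w) + 3 / 8 * (p ^ (k + 2) * c ^ 2) := by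
      linear_combination (p ^ k * (2 / 3) * (3 / 2 * D) ^ 2) * hsw
        + 3 / 8 * p ^ k * p ^ 2 * sq_abs c
    rw [h5] at h4
    calc √w * (D * p ^ (k + 1)) * (s + 3 / 2 * |c|)
        = D * (p ^ (k + 1) * (√w * s)) + p ^ k * (3 / 2 * D * √w * (p * |c|)) := by ring
      _ ≤ _ := by linarith
  rw [e]
  have hc := mul_le_mul_of_nonneg_left (sum_commOp_sq_le h) (pow_nonneg hφ0 (k + 2))
  calc _ ≤ ∑ i, (D * (p ^ (k + 1) * (√w * s)) + ∑ j, (D * (p ^ (k + 1) * (√w * s))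
        + (3 / 2 * D ^ 2 * (p ^ k * w) + 3 / 8 * (p ^ (k + 2) * commOp X i j u x ^ 2)))) :=
        Finset.sum_le_sum fun i _ => add_le_add (b1 i) (Finset.sum_le_sum fun j _ => b2 i j)
    _ = (m + m * m) * D * (p ^ (k + 1) * (√w * s)) + m * m * (3 / 2 * D ^ 2) * (p ^ k * w)
        + 3 / 8 * (p ^ (k + 2) * ∑ i, ∑ j, commOp X i j u x ^ 2) := by
        simp only [Finset.sum_add_distrib, Finset.sum_const, Finset.card_univ, Fintype.card_fin,
          nsmul_eq_mul, Finset.mul_sum]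
        ring
    _ ≤ _ := by linarith

lemma abs_Xop_pow_mul_gradSq_le (hX : FlatSystem X V) (hφ : IsCutoff V φ)
    (hB : ∀ i x, |Xop (X i) φ x| ≤ B) (k : ℕ) (hu : ContDiff ℝ 2 u)
    {x : Fin n → ℝ} (h : TwoConvexAt X u x) (j : Fin m) :
    |Xop (X j) (fun y => φ y ^ (k + 1) * gradSq X u y) x|
      ≤ ((k + 1) * B + m) * (φ x ^ k * gradSq X u x)
        + 2 * m * (φ x ^ (k + 1) * (√(gradSq X u x) * subLap X u x))
        + 8 / 3 * (φ x ^ (k + 2) * calF2 X u x) := by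
  rw [Xop_mul ((hφ.contDiff_one.pow (k + 1)).differentiable one_ne_zero x)
    ((hX.contDiff_gradSq hu).differentiable one_ne_zero x), hX.Xop_gradSq hu]
  set w := gradSq X u x with hw
  set s := subLap X u x with hs
  have hw0 : 0 ≤ w := gradSq_nonneg x
  have hsw : √w ^ 2 = w := Real.sq_sqrt hw0
  have hs0 : 0 ≤ s := h.subLap_nonneg
  have hφ0 := hφ.nonneg x
  set p := φ x
  have hη' := FlatSystem.abs_Xop_pow_le hφ hB k j x
  have b1 : ∀ i, |p ^ (k + 1) * (2 * (Xop (X i) u x * Xop (X j) (Xop (X i) u) x))|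
      ≤ 2 * (p ^ (k + 1) * (√w * s)) + (p ^ k * w + p ^ (k + 2) * commOp X j i u x ^ 2) := by
    intro i
    set c := commOp X j i u x with hc
    have h1 : Xop (X j) (Xop (X i) u) x = symmHess X u x j i + c / 2 := by
      simp only [symmHess, hc, commOp]; ring
    have h2 : |symmHess X u x j i + c / 2| ≤ s + |c| / 2 := by
      refine (abs_add_le _ _).trans (add_le_add (h.abs_symmHess_le j i) (le_of_eq ?_))
      rw [abs_div, abs_of_pos (by norm_num : (0 : ℝ) < 2)]
    have h3 : |Xop (X i) u x| ≤ √w := abs_Xop_le_sqrt_gradSq i x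
    have h4 : √w * (p * |c|) ≤ w + (p * |c|) ^ 2 := by
      nlinarith [sq_nonneg (√w - p * |c|), sq_nonneg (p * |c|)]
    have h5 := mul_le_mul_of_nonneg_left h4 (pow_nonneg hφ0 k)
    rw [mul_pow, sq_abs] at h5
    rw [abs_mul, abs_mul, abs_mul, h1, abs_of_nonneg (pow_nonneg hφ0 _), abs_two]
    calc p ^ (k + 1) * (2 * (|Xop (X i) u x| * |symmHess X u x j i + c / 2|))
        ≤ p ^ (k + 1) * (2 * (√w * (s + |c| / 2))) := by gcongr
      _ = 2 * (p ^ (k + 1) * (√w * s)) + p ^ k * (√w * (p * |c|)) := by ring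
      _ ≤ 2 * (p ^ (k + 1) * (√w * s)) + p ^ k * (w + p ^ 2 * c ^ 2) := by linarith
      _ = _ := by ring
  have b2 : ∑ i, commOp X j i u x ^ 2 ≤ 8 / 3 * calF2 X u x :=
    (Finset.single_le_sum (f := fun j => ∑ i, commOp X j i u x ^ 2)
      (fun _ _ => Finset.sum_nonneg fun _ _ => sq_nonneg _) (Finset.mem_univ j)).trans
      (sum_commOp_sq_le h)
  have b3 := mul_le_mul_of_nonneg_left b2 (pow_nonneg hφ0 (k + 2))
  have b4 : |Xop (X j) (fun y => φ y ^ (k + 1)) x * w| ≤ (k + 1) * B * p ^ k * w := by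
    rw [abs_mul, abs_of_nonneg hw0]
    exact mul_le_mul_of_nonneg_right hη' hw0
  refine (abs_add_le _ _).trans ?_
  have b5 : |p ^ (k + 1) * (2 * ∑ i, Xop (X i) u x * Xop (X j) (Xop (X i) u) x)|
      ≤ ∑ i, (2 * (p ^ (k + 1) * (√w * s)) + (p ^ k * w + p ^ (k + 2) * commOp X j i u x ^ 2)) := by
    rw [Finset.mul_sum, Finset.mul_sum]
    exact (Finset.abs_sum_le_sum_abs _ _).trans (Finset.sum_le_sum fun i _ => b1 i)
  have b6 : ∑ i, (2 * (p ^ (k + 1) * (√w * s)) + (p ^ k * w + p ^ (k + 2) * commOp X j i u x ^ 2))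
      = m * (2 * (p ^ (k + 1) * (√w * s))) + (m * (p ^ k * w)
        + p ^ (k + 2) * ∑ i, commOp X j i u x ^ 2) := by
    simp only [Finset.sum_add_distrib, Finset.sum_const, Finset.card_univ, Fintype.card_fin,
      nsmul_eq_mul, Finset.mul_sum]
  rw [b6] at b5
  linarith

namespace FlatSystem

lemma integrable_calF2Remainder (hX : FlatSystem X V) (hu : ContDiff ℝ 2 u)
    {η : (Fin n → ℝ) → ℝ} (hη : ContDiff ℝ 1 η) (hc : HasCompactSupport η) :
    Integrable (calF2Remainder X u η) := by
  have hh := hX.continuous_Xop_Xop hu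
  have hu1 : ∀ i, Continuous (Xop (X i) u) := fun i => (hX.contDiff_Xop hu i).continuous
  have hη1 : ∀ i, Continuous (Xop (X i) η) := fun i =>
    continuous_Xop hη (hX.field i).contDiff.continuous
  refine Continuous.integrable_of_hasCompactSupport ?_ (HasCompactSupport.intro hc fun x hx => ?_)
  · have e : calF2Remainder X u η = fun x => ∑ i, ∑ j, Xop (X i) u x *
        (Xop (X i) η x * Xop (X j) (Xop (X j) u) x - Xop (X j) η x *
        ((Xop (X i) (Xop (X j) u) x + Xop (X j) (Xop (X i) u) x) / 2
        + 3 / 2 * (Xop (X i) (Xop (X j) u) x - Xop (X j) (Xop (X i) u) x))) := rfl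
    rw [e]
    fun_prop
  · have : ∀ i, Xop (X i) η x = 0 := fun i => by
      rw [Xop, fderiv_of_notMem_tsupport ℝ hx]; rfl
    simp [calF2Remainder, this]

lemma integrable_pow_mul_gradSq (hX : FlatSystem X V) (hφ : IsCutoff V φ) {k : ℕ} (hk : k ≠ 0)
    (hu : ContDiff ℝ 2 u) : Integrable fun x => φ x ^ k * gradSq X u x :=
  ((hφ.pow hk).contDiff.continuous.mul
    (hX.contDiff_gradSq hu).continuous).integrable_of_hasCompactSupport (hφ.pow hk).compact.mul_right

lemma integrable_pow_mul_sqrt (hX : FlatSystem X V) (hφ : IsCutoff V φ) {k : ℕ} (hk : k ≠ 0)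
    (hu : ContDiff ℝ 2 u) :
    Integrable fun x => φ x ^ k * (√(gradSq X u x) * subLap X u x) :=
  ((hφ.pow hk).contDiff.continuous.mul ((hX.contDiff_gradSq hu).continuous.sqrt.mul
    (hX.continuous_subLap hu))).integrable_of_hasCompactSupport (hφ.pow hk).compact.mul_right

lemma integrable_pow_mul_calF2 (hX : FlatSystem X V) (hφ : IsCutoff V φ) {k : ℕ} (hk : k ≠ 0)
    (hu : ContDiff ℝ 2 u) : Integrable fun x => φ x ^ k * calF2 X u x :=
  ((hφ.pow hk).contDiff.continuous.mul
    (hX.continuous_calF2 hu)).integrable_of_hasCompactSupport (hφ.pow hk).compact.mul_right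

lemma exists_integral_calF2_le (hX : FlatSystem X V) (hφ : IsCutoff V φ)
    (hB : ∀ i x, |Xop (X i) φ x| ≤ B) (hB0 : 0 ≤ B) {k : ℕ} (hk : k ≠ 0) :
    ∃ C ≥ 0, ∀ u : (Fin n → ℝ) → ℝ, ContDiff ℝ 2 u → HasCompactSupport u →
      (∀ x ∈ V, TwoConvexAt X u x) →
      ∫ x, φ x ^ (k + 2) * calF2 X u x ≤ C * ∫ x, φ x ^ k * gradSq X u x := by
  set C₁ : ℝ := (m + m * m) * ((k + 2) * B) with hC₁
  set C₂ : ℝ := m * m * (3 / 2 * ((k + 2) * B) ^ 2) with hC₂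
  have hC₁0 : 0 ≤ C₁ := by positivity
  refine ⟨C₁ * (m * (m * ((k + 1) * B))) + C₂, by positivity, fun u hu huc hconv => ?_⟩
  have hη : IsCutoff V fun x => φ x ^ (k + 2) := hφ.pow (by omega)
  have I1 := hX.integrable_pow_mul_sqrt hφ (Nat.succ_ne_zero k) hu
  have I2 := hX.integrable_pow_mul_gradSq hφ hk hu
  have I3 := hX.integrable_pow_mul_calF2 hφ (Nat.succ_ne_zero (k + 1)) hu
  have hid := hX.integral_calF2 hu huc hη.contDiff_one hη.compact hη.subset
  have I12 := (I1.const_mul C₁).add (I2.const_mul C₂)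
  have hle : -∫ x, calF2Remainder X u (fun y => φ y ^ (k + 2)) x
      ≤ ∫ x, (C₁ * (φ x ^ (k + 1) * (√(gradSq X u x) * subLap X u x))
        + C₂ * (φ x ^ k * gradSq X u x) + φ x ^ (k + 2) * calF2 X u x) := by
    rw [← integral_neg]
    refine integral_mono (hX.integrable_calF2Remainder hu hη.contDiff_one hη.compact).neg
      (I12.add I3) fun x => ?_
    by_cases hx : x ∈ V
    · exact neg_calF2Remainder_le hφ hB hB0 k (hconv x hx)
    · have hz : ∀ i, Xop (X i) (fun y => φ y ^ (k + 2)) x = 0 := fun i => by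
        rw [Xop, fderiv_of_notMem_tsupport ℝ fun hx' => hx (hη.subset hx')]; rfl
      simp [calF2Remainder, hz, hφ.eq_zero hx, hk]
  have e1 := integral_add I12 I3
  have e2 := integral_add (I1.const_mul C₁) (I2.const_mul C₂)
  simp only [Pi.add_apply] at e1 e2
  rw [e1, e2, integral_const_mul, integral_const_mul] at hle
  have ha := mul_le_mul_of_nonneg_left
    (hX.integral_sqrt_gradSq_mul_subLap_le hφ hB hB0 hk hu hconv) hC₁0
  linarith

lemma exists_xNorm_le (hX : FlatSystem X V) (hφ : IsCutoff V φ)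
    (hB : ∀ i x, |Xop (X i) φ x| ≤ B) (hB0 : 0 ≤ B) {k : ℕ} (hk : k ≠ 0) :
    ∃ C ≥ 0, ∀ u : (Fin n → ℝ) → ℝ, ContDiff ℝ 2 u → HasCompactSupport u →
      (∀ x ∈ V, TwoConvexAt X u x) →
      xNorm X (fun x => φ x ^ (k + 1) * gradSq X u x) ≤ C * ∫ x, φ x ^ k * gradSq X u x := by
  obtain ⟨C₀, hC₀, hF⟩ := hX.exists_integral_calF2_le hφ hB hB0 hk
  set C₁ : ℝ := (k + 1) * B + m with hC₁
  set C₂ : ℝ := 2 * m with hC₂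
  have hC₂0 : 0 ≤ C₂ := by positivity
  refine ⟨1 + m * (C₁ + C₂ * (m * (m * ((k + 1) * B))) + 8 / 3 * C₀), by positivity,
    fun u hu huc hconv => ?_⟩
  have hη1 : IsCutoff V fun x => φ x ^ (k + 1) := hφ.pow (Nat.succ_ne_zero k)
  have I1 := hX.integrable_pow_mul_sqrt hφ (Nat.succ_ne_zero k) hu
  have I2 := hX.integrable_pow_mul_gradSq hφ hk hu
  have I3 := hX.integrable_pow_mul_calF2 hφ (Nat.succ_ne_zero (k + 1)) hu
  have hf1 : ContDiff ℝ 1 fun x => φ x ^ (k + 1) * gradSq X u x :=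
    hη1.contDiff_one.mul (hX.contDiff_gradSq hu)
  have hfc : HasCompactSupport fun x => φ x ^ (k + 1) * gradSq X u x := hη1.compact.mul_right
  have h0 : ∫ x, |φ x ^ (k + 1) * gradSq X u x| ≤ ∫ x, φ x ^ k * gradSq X u x := by
    refine integral_mono (hf1.continuous.integrable_of_hasCompactSupport hfc).abs I2 fun x => ?_
    have hw0 := gradSq_nonneg (X := X) (u := u) x
    dsimp only
    rw [abs_of_nonneg (mul_nonneg (hη1.nonneg x) hw0)]
    exact mul_le_mul_of_nonneg_right
      (pow_le_pow_of_le_one (hφ.nonneg x) (hφ.le_one x) (Nat.le_succ k)) hw0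
  have h1 : ∀ j, ∫ x, |Xop (X j) (fun x => φ x ^ (k + 1) * gradSq X u x) x|
      ≤ C₁ * (∫ x, φ x ^ k * gradSq X u x)
        + C₂ * (∫ x, φ x ^ (k + 1) * (√(gradSq X u x) * subLap X u x))
        + 8 / 3 * ∫ x, φ x ^ (k + 2) * calF2 X u x := by
    intro j
    have I12 := (I2.const_mul C₁).add (I1.const_mul C₂)
    have e1 := integral_add I12 (I3.const_mul (8 / 3))
    have e2 := integral_add (I2.const_mul C₁) (I1.const_mul C₂)
    simp only [Pi.add_apply] at e1 e2
    rw [← integral_const_mul, ← integral_const_mul, ← integral_const_mul, ← e2]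
    refine le_trans ?_ e1.le
    refine integral_mono (integrable_Xop hf1 hfc (hX.field j).contDiff.continuous).abs
      (I12.add (I3.const_mul (8 / 3))) fun x => ?_
    by_cases hx : x ∈ V
    · exact abs_Xop_pow_mul_gradSq_le hX hφ hB k hu (hconv x hx) j
    · have hz : Xop (X j) (fun x => φ x ^ (k + 1) * gradSq X u x) x = 0 := by
        rw [Xop, fderiv_of_notMem_tsupport ℝ fun hx' =>
          hx (tsupport_mul_subset_of_left hη1.subset hx')]; rfl
      simp [hz, hφ.eq_zero hx, hk]
  have ha := mul_le_mul_of_nonneg_left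
    (hX.integral_sqrt_gradSq_mul_subLap_le hφ hB hB0 hk hu hconv) hC₂0
  have hb := hF u hu huc hconv
  have hm0 : (0 : ℝ) ≤ m := Nat.cast_nonneg m
  set J := ∫ x, φ x ^ k * gradSq X u x
  have h2 : ∑ j, ∫ x, |Xop (X j) (fun x => φ x ^ (k + 1) * gradSq X u x) x|
      ≤ ∑ _j : Fin m, (C₁ + C₂ * (m * (m * ((k + 1) * B))) + 8 / 3 * C₀) * J :=
    Finset.sum_le_sum fun j _ => (h1 j).trans (by linarith)
  rw [Finset.sum_const, Finset.card_univ, Fintype.card_fin, nsmul_eq_mul] at h2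
  rw [xNorm]
  linarith

end FlatSystem

end Energy

section WeakType

variable {n m : ℕ} {X : Fin m → (Fin n → ℝ) → (Fin n → ℝ)} {V : Set (Fin n → ℝ)}
  {u v ψ : (Fin n → ℝ) → ℝ} {L N : ℝ}

lemma volume_le_of_integral_le {f : (Fin n → ℝ) → ℝ} (hf : Integrable f) (h0 : ∀ x, 0 ≤ f x)
    {ε M : ℝ} (hε : 0 < ε) (hM : ∫ x, f x ≤ M) :
    volume {x | ε ≤ f x} ≤ ENNReal.ofReal (M / ε) := by
  have h := mul_meas_ge_le_integral_of_nonneg (Eventually.of_forall h0) hf ε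
  have hfin : volume {x | ε ≤ f x} ≠ ⊤ := (hf.measure_ge_lt_top hε).ne
  rw [← ofReal_measureReal hfin]
  refine ENNReal.ofReal_le_ofReal ((le_div_iff₀ hε).2 ?_)
  linarith

lemma subLap_eq_zero_of_notMem_tsupport {x : Fin n → ℝ} (hx : x ∉ tsupport ψ) :
    subLap X ψ x = 0 := by
  have h : ψ =ᶠ[𝓝 x] fun _ => 0 := notMem_tsupport_iff_eventuallyEq.1 hx
  refine Finset.sum_eq_zero fun i _ => ?_
  have h1 : Xop (X i) ψ =ᶠ[𝓝 x] fun _ => 0 := by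
    filter_upwards [h.eventuallyEq_nhds] with y hy
    rw [Xop_congr hy]; simp [Xop]
  rw [Xop_congr h1]; simp [Xop]

namespace FlatSystem

lemma integral_mul_subLap (hX : FlatSystem X V) (hψ : IsCutoff V ψ) (hv : ContDiff ℝ 2 v) :
    ∫ x, ψ x * subLap X v x = ∫ x, subLap X ψ x * v x := by
  have hψ2 : ContDiff ℝ 2 ψ := hψ.contDiff.of_le (natCast_le_smooth 2)
  have e1 : ∀ i, ∫ x, ψ x * Xop (X i) (Xop (X i) v) x = ∫ x, Xop (X i) (Xop (X i) ψ) x * v x := by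
    intro i
    rw [hX.integral_mul_Xop i hψ.contDiff_one hψ.compact hψ.subset (hX.contDiff_Xop hv i),
      hX.integral_mul_Xop i (hX.contDiff_Xop hψ2 i) (hasCompactSupport_Xop hψ.compact) ?_
        (hv.of_le one_le_two), neg_neg]
    refine subset_trans (closure_minimal (fun x hx => ?_) (isClosed_tsupport ψ)) hψ.subset
    by_contra hx'
    exact hx (by simp [Xop, fderiv_of_notMem_tsupport ℝ hx'])
  simp only [subLap, Finset.mul_sum, Finset.sum_mul]
  rw [integral_finsetSum, integral_finsetSum]
  · exact Finset.sum_congr rfl fun i _ => e1 i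
  · intro i _
    exact ((hX.continuous_Xop_Xop hψ2 i i).mul hv.continuous).integrable_of_hasCompactSupport
      (hasCompactSupport_Xop (hasCompactSupport_Xop hψ.compact)).mul_right
  · intro i _
    exact (hψ2.continuous.mul (hX.continuous_Xop_Xop hv i i)).integrable_of_hasCompactSupport
      hψ.compact.mul_right

lemma integral_mul_subLap_le (hX : FlatSystem X V) (hψ : IsCutoff V ψ)
    (hL : ∀ x, |subLap X ψ x| ≤ L) (hu : ContDiff ℝ 2 u) (huc : HasCompactSupport u)
    (hN : ∫ x in V, |u x| ≤ N) (hv : ContDiff ℝ 2 v) (hvu : ∀ x, |v x| ≤ |u x|) :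
    ∫ x, ψ x * subLap X v x ≤ L * N := by
  have hL0 : 0 ≤ L := (abs_nonneg _).trans (hL 0)
  have hψ2 : ContDiff ℝ 2 ψ := hψ.contDiff.of_le (natCast_le_smooth 2)
  have hc : HasCompactSupport (subLap X ψ) :=
    HasCompactSupport.intro hψ.compact fun x hx => subLap_eq_zero_of_notMem_tsupport hx
  have hi : Integrable fun x => subLap X ψ x * v x :=
    ((hX.continuous_subLap hψ2).mul hv.continuous).integrable_of_hasCompactSupport hc.mul_right
  have hui : Integrable fun x => |u x| :=
    hu.continuous.abs.integrable_of_hasCompactSupport (huc.comp_left abs_zero)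
  rw [hX.integral_mul_subLap hψ hv, ← setIntegral_eq_integral_of_forall_compl_eq_zero (s := V)
    fun x hx => by
      rw [subLap_eq_zero_of_notMem_tsupport fun h => hx (hψ.subset h), zero_mul]]
  calc ∫ x in V, subLap X ψ x * v x ≤ ∫ x in V, L * |u x| := by
        refine integral_mono hi.integrableOn (hui.const_mul L).integrableOn fun x => ?_
        refine (le_abs_self _).trans ?_
        rw [abs_mul]
        exact mul_le_mul (hL x) (hvu x) (abs_nonneg _) hL0
    _ = L * ∫ x in V, |u x| := integral_const_mul _ _
    _ ≤ L * N := mul_le_mul_of_nonneg_left hN hL0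

lemma subLap_sqrt_sq_add (hX : FlatSystem X V) (hu : ContDiff ℝ 2 u) {s : ℝ} (hs : 0 < s)
    (x : Fin n → ℝ) :
    subLap X (fun y => √(s ^ 2 + u y ^ 2) - s) x
      = s ^ 2 / √(s ^ 2 + u x ^ 2) ^ 3 * gradSq X u x
        + u x / √(s ^ 2 + u x ^ 2) * subLap X u x := by
  have hpos : ∀ t : ℝ, 0 < s ^ 2 + t ^ 2 := fun t => by positivity
  have hF : ∀ t : ℝ, HasDerivAt (fun t : ℝ => √(s ^ 2 + t ^ 2) - s) (t / √(s ^ 2 + t ^ 2)) t := by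
    intro t
    have h := ((((hasDerivAt_id t).pow 2).const_add (s ^ 2)).sqrt (hpos t).ne').sub_const s
    refine h.congr_deriv ?_
    have := Real.sqrt_pos.2 (hpos t)
    simp
    field_simp
  have hF' : ∀ t : ℝ, HasDerivAt (fun t : ℝ => t / √(s ^ 2 + t ^ 2))
      (s ^ 2 / √(s ^ 2 + t ^ 2) ^ 3) t := by
    intro t
    have hr := Real.sqrt_pos.2 (hpos t)
    have hr2 := Real.sq_sqrt (hpos t).le
    have h := (hasDerivAt_id t).div
      ((((hasDerivAt_id t).pow 2).const_add (s ^ 2)).sqrt (hpos t).ne') hr.ne'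
    refine h.congr_deriv ?_
    simp only [id, Pi.pow_apply, Nat.cast_ofNat]
    set r := √(s ^ 2 + t ^ 2)
    field_simp
    linear_combination hr2
  have hd := hu.differentiable two_ne_zero
  have h1 : ∀ i, Xop (X i) (fun y => √(s ^ 2 + u y ^ 2) - s)
      = fun y => u y / √(s ^ 2 + u y ^ 2) * Xop (X i) u y := fun i => by
    funext y
    exact Xop_comp (hF (u y)) (hd y)
  rw [subLap, subLap, gradSq, Finset.mul_sum, Finset.mul_sum, ← Finset.sum_add_distrib]
  refine Finset.sum_congr rfl fun i _ => ?_
  rw [h1 i, Xop_mul (f := fun y => u y / √(s ^ 2 + u y ^ 2))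
      (((hF' (u x)).differentiableAt).comp x (hd x))
    ((hX.contDiff_Xop hu i).differentiable one_ne_zero x),
    Xop_comp (F := fun t => t / √(s ^ 2 + t ^ 2)) (hF' (u x)) (hd x)]
  ring

lemma integral_mul_gradSq_le (hX : FlatSystem X V) (hψ : IsCutoff V ψ)
    (hL : ∀ x, |subLap X ψ x| ≤ L) (hu : ContDiff ℝ 2 u) (huc : HasCompactSupport u)
    (hconv : ∀ x ∈ V, TwoConvexAt X u x) (hN : ∫ x in V, |u x| ≤ N) {s : ℝ} (hs : 0 < s) :
    ∫ x, ψ x * (s ^ 2 / √(s ^ 2 + u x ^ 2) ^ 3 * gradSq X u x) ≤ 2 * (L * N) := by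
  have hpos : ∀ x, 0 < s ^ 2 + u x ^ 2 := fun x => by positivity
  have hrpos : ∀ x, 0 < √(s ^ 2 + u x ^ 2) := fun x => Real.sqrt_pos.2 (hpos x)
  have hv : ContDiff ℝ 2 fun y => √(s ^ 2 + u y ^ 2) - s :=
    ((contDiff_const.add (hu.pow 2)).sqrt fun x => (hpos x).ne').sub contDiff_const
  have hvu : ∀ x, |√(s ^ 2 + u x ^ 2) - s| ≤ |u x| := fun x => by
    have h1 : s ≤ √(s ^ 2 + u x ^ 2) := Real.le_sqrt_of_sq_le (by nlinarith [sq_nonneg (u x)])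
    rw [abs_of_nonneg (by linarith), sub_le_iff_le_add]
    refine Real.sqrt_le_iff.2 ⟨by positivity, ?_⟩
    nlinarith [sq_abs (u x), abs_nonneg (u x)]
  have hI1 : Integrable fun x => ψ x * subLap X (fun y => √(s ^ 2 + u y ^ 2) - s) x :=
    (hψ.contDiff.continuous.mul (hX.continuous_subLap hv)).integrable_of_hasCompactSupport
      hψ.compact.mul_right
  have hI2 : Integrable fun x => ψ x * subLap X u x :=
    (hψ.contDiff.continuous.mul (hX.continuous_subLap hu)).integrable_of_hasCompactSupport
      hψ.compact.mul_right
  have hr : Continuous fun x => √(s ^ 2 + u x ^ 2) :=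
    (continuous_const.add (hu.continuous.pow 2)).sqrt
  have hI3 : Integrable fun x => ψ x * (s ^ 2 / √(s ^ 2 + u x ^ 2) ^ 3 * gradSq X u x) :=
    (hψ.contDiff.continuous.mul ((continuous_const.div (hr.pow 3) fun x =>
      (pow_pos (hrpos x) 3).ne').mul
        (hX.contDiff_gradSq hu).continuous)).integrable_of_hasCompactSupport hψ.compact.mul_right
  have b1 := hX.integral_mul_subLap_le hψ hL hu huc hN hv hvu
  have b2 := hX.integral_mul_subLap_le hψ hL hu huc hN hu fun _ => le_rfl
  have e := integral_add hI1 hI2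
  have hle : ∫ x, ψ x * (s ^ 2 / √(s ^ 2 + u x ^ 2) ^ 3 * gradSq X u x)
      ≤ ∫ x, (ψ x * subLap X (fun y => √(s ^ 2 + u y ^ 2) - s) x + ψ x * subLap X u x) := by
    refine integral_mono hI3 (hI1.add hI2) fun x => ?_
    by_cases hx : x ∈ V
    · beta_reduce
      rw [hX.subLap_sqrt_sq_add hu hs, ← mul_add]
      refine mul_le_mul_of_nonneg_left ?_ (hψ.nonneg x)
      have h1 : -1 ≤ u x / √(s ^ 2 + u x ^ 2) := by
        rw [le_div_iff₀ (hrpos x)]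
        have : |u x| ≤ √(s ^ 2 + u x ^ 2) := Real.abs_le_sqrt (by nlinarith [sq_nonneg s])
        linarith [neg_abs_le (u x)]
      have := mul_le_mul_of_nonneg_right h1 (hconv x hx).subLap_nonneg
      linarith
    · simp [hψ.eq_zero hx]
  linarith

lemma volume_lt_gradSq_le (hX : FlatSystem X V) (hψ : IsCutoff V ψ)
    (hL : ∀ x, |subLap X ψ x| ≤ L) (hu : ContDiff ℝ 2 u) (huc : HasCompactSupport u)
    (hconv : ∀ x ∈ V, TwoConvexAt X u x) (hN : ∫ x in V, |u x| ≤ N) {s : ℝ} (hs : 0 < s) :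
    volume {x | ψ x = 1 ∧ s ^ 2 < gradSq X u x} ≤ ENNReal.ofReal ((6 * L + 1) * N / s) := by
  have hL0 : 0 ≤ L := (abs_nonneg _).trans (hL 0)
  have hN0 : 0 ≤ N := (integral_nonneg fun _ => abs_nonneg _).trans hN
  have hpos : ∀ x, 0 < s ^ 2 + u x ^ 2 := fun x => by positivity
  have hrpos : ∀ x, 0 < √(s ^ 2 + u x ^ 2) := fun x => Real.sqrt_pos.2 (hpos x)
  have hr : Continuous fun x => √(s ^ 2 + u x ^ 2) :=
    (continuous_const.add (hu.continuous.pow 2)).sqrt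
  have hI3 : Integrable fun x => ψ x * (s ^ 2 / √(s ^ 2 + u x ^ 2) ^ 3 * gradSq X u x) :=
    (hψ.contDiff.continuous.mul ((continuous_const.div (hr.pow 3) fun x =>
      (pow_pos (hrpos x) 3).ne').mul
        (hX.contDiff_gradSq hu).continuous)).integrable_of_hasCompactSupport hψ.compact.mul_right
  have hui : Integrable fun x => |u x| :=
    hu.continuous.abs.integrable_of_hasCompactSupport (huc.comp_left abs_zero)
  have hI4 : Integrable fun x => ψ x * |u x| :=
    (hψ.contDiff.continuous.mul hu.continuous.abs).integrable_of_hasCompactSupport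
      hψ.compact.mul_right
  have h4 : ∫ x, ψ x * |u x| ≤ N := by
    rw [← setIntegral_eq_integral_of_forall_compl_eq_zero (s := V) fun x hx => by
      rw [hψ.eq_zero hx, zero_mul]]
    refine (integral_mono hI4.integrableOn hui.integrableOn fun x => ?_).trans hN
    exact mul_le_of_le_one_left (abs_nonneg _) (hψ.le_one x)
  have v3 := volume_le_of_integral_le hI3 (fun x => mul_nonneg (hψ.nonneg x)
    (mul_nonneg (div_nonneg (sq_nonneg s) (pow_nonneg (hrpos x).le 3)) (gradSq_nonneg x)))
    (show 0 < s / 3 by positivity) (hX.integral_mul_gradSq_le hψ hL hu huc hconv hN hs)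
  have v4 := volume_le_of_integral_le hI4 (fun x => mul_nonneg (hψ.nonneg x) (abs_nonneg _)) hs h4
  have hsub : {x | ψ x = 1 ∧ s ^ 2 < gradSq X u x}
      ⊆ {x | s / 3 ≤ ψ x * (s ^ 2 / √(s ^ 2 + u x ^ 2) ^ 3 * gradSq X u x)}
        ∪ {x | s ≤ ψ x * |u x|} := by
    rintro x ⟨h1, h2⟩
    simp only [Set.mem_union, Set.mem_ofPred_eq, h1, one_mul]
    rcases le_total s |u x| with h | h
    · exact Or.inr h
    · left
      have hr2 := Real.sq_sqrt (hpos x).le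
      have hr0 := hrpos x
      set r := √(s ^ 2 + u x ^ 2)
      have hu2 : u x ^ 2 ≤ s ^ 2 := sq_le_sq' (by linarith [neg_abs_le (u x)])
        ((le_abs_self _).trans h)
      have hr3 : r ≤ 3 / 2 * s := by
        by_contra! hc
        nlinarith
      have hrr : r ^ 3 ≤ 3 * s ^ 3 := by
        have : r ^ 3 = r ^ 2 * r := by ring
        rw [this]
        calc r ^ 2 * r ≤ (2 * s ^ 2) * (3 / 2 * s) :=
              mul_le_mul (by linarith) hr3 hr0.le (by positivity)
          _ = 3 * s ^ 3 := by ring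
      rw [div_mul_eq_mul_div, le_div_iff₀ (pow_pos hr0 3)]
      calc s / 3 * r ^ 3 ≤ s / 3 * (3 * s ^ 3) := by gcongr
        _ = s ^ 2 * s ^ 2 := by ring
        _ ≤ s ^ 2 * gradSq X u x := by gcongr
  refine (measure_mono hsub).trans ((measure_union_le _ _).trans ((add_le_add v3 v4).trans ?_))
  rw [← ENNReal.ofReal_add (by positivity) (by positivity)]
  refine ENNReal.ofReal_le_ofReal (le_of_eq ?_)
  field_simp
  ring

end FlatSystem

end WeakType

section Closing

variable {n m : ℕ} {X : Fin m → (Fin n → ℝ) → (Fin n → ℝ)} {V : Set (Fin n → ℝ)}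
  {φ ψ w : (Fin n → ℝ) → ℝ}

lemma half_pow_rpow_le {q : ℕ} {γ : ℝ} (hqγ : 2 ≤ q * γ) (k : ℕ) :
    ((1 / 2 : ℝ) ^ (k * q)) ^ γ ≤ ((1 / 2 : ℝ) ^ k) ^ 2 := by
  rw [← pow_mul, ← Real.rpow_natCast, ← Real.rpow_natCast, ← Real.rpow_mul (by norm_num)]
  refine Real.rpow_le_rpow_of_exponent_ge (by norm_num) (by norm_num) ?_
  push_cast
  have := mul_le_mul_of_nonneg_left hqγ (Nat.cast_nonneg (α := ℝ) k)
  linarith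

lemma integral_pow_mul_le (hφ : Continuous φ) (hc : HasCompactSupport φ) (h0 : ∀ x, 0 ≤ φ x)
    (h1 : ∀ x, φ x ≤ 1) (hw : Continuous w) (hw0 : ∀ x, 0 ≤ w x) {q : ℕ} (hq : q ≠ 0)
    {γ D M : ℝ} (hγ : 0 < γ) (hD : 0 ≤ D) (hM : 0 < M) (hqγ : 2 ≤ q * γ)
    (hgain : ∀ A, MeasurableSet A → ∀ a : ℝ, 0 < a → volume A ≤ ENNReal.ofReal a →
      ∫ x in A, φ x ^ (2 * q + 1) * w x ≤ D * a ^ γ * ∫ x, φ x ^ (2 * q) * w x)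
    (hweak : ∀ s : ℝ, 0 < s → volume {x | 0 < φ x ∧ s ^ 2 < w x} ≤ ENNReal.ofReal (M / s)) :
    ∫ x, φ x ^ (2 * q) * w x
      ≤ 2 * (((8 * D + 1) ^ (1 / γ)) ^ 2 * volume.real (tsupport φ)) * M ^ 2 := by
  set J := ∫ x, φ x ^ (2 * q) * w x with hJ
  set R := (8 * D + 1) ^ (1 / γ) with hR
  have hR0 : 0 < R := Real.rpow_pos_of_pos (by positivity) _
  have hRγ : (1 / R) ^ γ = 1 / (8 * D + 1) := by
    rw [Real.div_rpow zero_le_one hR0.le, Real.one_rpow, hR, ← Real.rpow_mul (by positivity),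
      one_div_mul_cancel hγ.ne', Real.rpow_one]
  set T := M * R with hT
  have hT0 : 0 < T := by positivity
  have h2q : 2 * q ≠ 0 := by simpa using hq
  have hg0 : ∀ x, 0 ≤ φ x ^ (2 * q) * w x := fun x => mul_nonneg (pow_nonneg (h0 x) _) (hw0 x)
  have hJ0 : 0 ≤ J := integral_nonneg hg0
  have hgc : Continuous fun x => φ x ^ (2 * q) * w x := (hφ.pow _).mul hw
  have hgi : Integrable fun x => φ x ^ (2 * q) * w x :=
    hgc.integrable_of_hasCompactSupport (hasCompactSupport_pow hc h2q).mul_right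
  have hfi : Integrable fun x => φ x ^ (2 * q + 1) * w x :=
    ((hφ.pow _).mul hw).integrable_of_hasCompactSupport
      (hasCompactSupport_pow hc (Nat.succ_ne_zero _)).mul_right
  set E : Set (Fin n → ℝ) := {x | T ^ 2 < φ x ^ (2 * q) * w x} with hE
  have hEm : MeasurableSet E := measurableSet_lt measurable_const hgc.measurable
  set S : ℕ → Set (Fin n → ℝ) := fun k =>
    {x | ((1 / 2 : ℝ) ^ (k + 1) < φ x ∧ φ x ≤ (1 / 2) ^ k) ∧ T ^ 2 < φ x ^ (2 * q) * w x} with hS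
  have hSm : ∀ k, MeasurableSet (S k) := fun k =>
    ((measurableSet_lt measurable_const hφ.measurable).inter
      (measurableSet_le hφ.measurable measurable_const)).inter hEm
  have hdisj : Pairwise (Function.onFun Disjoint S) := by
    have key : ∀ k l, k < l → Disjoint (S k) (S l) := fun k l hkl => by
      refine Set.disjoint_left.2 fun x hx hy => ?_
      have := pow_le_pow_of_le_one (by norm_num : (0 : ℝ) ≤ 1 / 2) (by norm_num)
        (Nat.succ_le_of_lt hkl)
      exact absurd (hy.1.2.trans this) (not_le.2 hx.1.1)
    intro k l hkl
    rcases lt_or_gt_of_ne hkl with h | h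
    · exact key k l h
    · exact (key l k h).symm
  have hSU : ⋃ k, S k = E := by
    refine Set.Subset.antisymm (Set.iUnion_subset fun k x hx => hx.2) fun x hx => ?_
    have hpos : 0 < φ x := by
      refine lt_of_le_of_ne (h0 x) fun h => ?_
      have hx' : T ^ 2 < φ x ^ (2 * q) * w x := hx
      rw [← h, zero_pow h2q, zero_mul] at hx'
      exact absurd hx' (not_lt.2 (sq_nonneg T))
    obtain ⟨k, hk1, hk2⟩ := exists_nat_pow_near_of_lt_one hpos (h1 x)
      (by norm_num : (0 : ℝ) < 1 / 2) (by norm_num)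
    exact Set.mem_iUnion.2 ⟨k, ⟨hk1, hk2⟩, hx⟩
  have hvol : ∀ k, volume (S k) ≤ ENNReal.ofReal (1 / R * (1 / 2) ^ (k * q)) := fun k => by
    have h2 : (0 : ℝ) < 2 ^ (k * q) := by positivity
    have hv := hweak (T * 2 ^ (k * q)) (by positivity)
    refine (measure_mono fun x hx => ?_).trans (hv.trans_eq ?_)
    · refine ⟨lt_of_le_of_lt (by positivity) hx.1.1, ?_⟩
      have hφk : φ x ^ (2 * q) ≤ ((1 / 2 : ℝ) ^ k) ^ (2 * q) := pow_le_pow_left₀ (h0 x) hx.1.2 _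
      have hlt := hx.2.trans_le (mul_le_mul_of_nonneg_right hφk (hw0 x))
      have e : ((1 / 2 : ℝ) ^ k) ^ (2 * q) = 1 / (2 ^ (k * q)) ^ 2 := by
        rw [one_div, one_div, inv_pow, inv_pow, ← pow_mul, ← pow_mul]
        ring_nf
      rw [e, one_div, inv_mul_eq_div, lt_div_iff₀ (by positivity)] at hlt
      rw [mul_pow]
      exact hlt
    · congr 1
      rw [hT, one_div_pow]
      field_simp
  have hSk : ∀ k, ∫ x in S k, φ x ^ (2 * q) * w x
      ≤ 2 * (D * (1 / (8 * D + 1)) * J) * (1 / 2) ^ k := fun k => by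
    have ha : (0 : ℝ) < 1 / R * (1 / 2) ^ (k * q) := by positivity
    have hgk := hgain (S k) (hSm k) _ ha (hvol k)
    rw [Real.mul_rpow (by positivity) (by positivity), hRγ] at hgk
    have hhalf : (0 : ℝ) < (1 / 2) ^ k := by positivity
    have e2 : (2 : ℝ) ^ (k + 1) * ((1 / 2) ^ k) = 2 := by
      rw [pow_succ, one_div_pow]; field_simp
    calc ∫ x in S k, φ x ^ (2 * q) * w x
        ≤ ∫ x in S k, 2 ^ (k + 1) * (φ x ^ (2 * q + 1) * w x) := by
          refine setIntegral_mono_on hgi.integrableOn (hfi.const_mul _).integrableOn (hSm k)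
            fun x hx => ?_
          have h3 : 1 ≤ 2 ^ (k + 1) * φ x := by
            have := hx.1.1.le
            rw [one_div_pow, div_le_iff₀ (by positivity)] at this
            linarith
          calc φ x ^ (2 * q) * w x = 1 * (φ x ^ (2 * q) * w x) := (one_mul _).symm
            _ ≤ (2 ^ (k + 1) * φ x) * (φ x ^ (2 * q) * w x) :=
                mul_le_mul_of_nonneg_right h3 (hg0 x)
            _ = _ := by ring
      _ = 2 ^ (k + 1) * ∫ x in S k, φ x ^ (2 * q + 1) * w x := integral_const_mul _ _
      _ ≤ 2 ^ (k + 1) * (D * (1 / (8 * D + 1) * ((1 / 2 : ℝ) ^ (k * q)) ^ γ) * J) := by gcongr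
      _ ≤ 2 ^ (k + 1) * (D * (1 / (8 * D + 1) * ((1 / 2 : ℝ) ^ k) ^ 2) * J) := by
          gcongr
          exact half_pow_rpow_le hqγ k
      _ = (2 ^ (k + 1) * (1 / 2) ^ k) * (D * (1 / (8 * D + 1)) * J) * (1 / 2) ^ k := by ring
      _ = _ := by rw [e2]
  have hsum := hasSum_integral_iUnion hSm hdisj (hgi.integrableOn (s := ⋃ k, S k))
  rw [hSU] at hsum
  have hEle : ∫ x in E, φ x ^ (2 * q) * w x ≤ J / 2 := by
    have hgeo := (hasSum_geometric_two).mul_left (2 * (D * (1 / (8 * D + 1)) * J))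
    refine (hasSum_le hSk hsum hgeo).trans ?_
    have hfrac : D * (1 / (8 * D + 1)) ≤ 1 / 8 := by
      rw [mul_one_div, div_le_div_iff₀ (by positivity) (by norm_num)]
      linarith
    have := mul_le_mul_of_nonneg_right hfrac hJ0
    linarith
  have hEc : ∫ x in Eᶜ, φ x ^ (2 * q) * w x ≤ T ^ 2 * volume.real (tsupport φ) := by
    have hfin : volume (tsupport φ) ≠ ⊤ := hc.isCompact.measure_lt_top.ne
    have hms : MeasurableSet (tsupport φ) := (isClosed_tsupport φ).measurableSet
    have hind : Integrable ((tsupport φ).indicator fun _ => T ^ 2) :=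
      (integrable_indicator_iff hms).2 (integrableOn_const hfin)
    calc ∫ x in Eᶜ, φ x ^ (2 * q) * w x
        ≤ ∫ x in Eᶜ, (tsupport φ).indicator (fun _ => T ^ 2) x := by
          refine setIntegral_mono_on hgi.integrableOn hind.integrableOn hEm.compl fun x hx => ?_
          by_cases hxt : x ∈ tsupport φ
          · rw [Set.indicator_of_mem hxt]
            exact not_lt.1 hx
          · rw [Set.indicator_of_notMem hxt, image_eq_zero_of_notMem_tsupport hxt, zero_pow h2q,
              zero_mul]
      _ ≤ ∫ x, (tsupport φ).indicator (fun _ => T ^ 2) x :=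
          setIntegral_le_integral hind (Eventually.of_forall fun x =>
            Set.indicator_nonneg (fun _ _ => sq_nonneg T) x)
      _ = T ^ 2 * volume.real (tsupport φ) := by
          rw [integral_indicator hms, setIntegral_const, smul_eq_mul, mul_comm]
  have hsplit := integral_add_compl hEm hgi
  have hTe : T ^ 2 = R ^ 2 * M ^ 2 := by rw [hT]; ring
  rw [hTe] at hEc
  linarith

lemma IsCutoff.exists_abs_Xop_le (hX : ∀ i, TestField (X i)) (hφ : IsCutoff V φ) :
    ∃ B, 0 ≤ B ∧ ∀ i x, |Xop (X i) φ x| ≤ B := by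
  have h : ∀ i, ∃ B, ∀ x, ‖Xop (X i) φ x‖ ≤ B := fun i =>
    (continuous_Xop hφ.contDiff_one (hX i).contDiff.continuous).bounded_above_of_compact_support
      (hasCompactSupport_Xop hφ.compact)
  choose B hB using h
  refine ⟨∑ i, |B i|, Finset.sum_nonneg fun _ _ => abs_nonneg _, fun i x => ?_⟩
  exact ((hB i x).trans (le_abs_self _)).trans
    (Finset.single_le_sum (f := fun i => |B i|) (fun _ _ => abs_nonneg _) (Finset.mem_univ i))

namespace FlatSystem

/-- The local bound for a system of globally defined, compactly supported fields. -/
lemma exists_integral_pow_mul_calF2_le (hX : FlatSystem X V) (hV : IsOpen V)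
    (hspan : ∀ x ∈ V, Submodule.span ℝ {v | ∃ c, LieGen X c ∧ c x = v} = ⊤)
    (hφ : IsCutoff V φ) (hψ : IsCutoff V ψ) (hφψ : ∀ x ∈ tsupport φ, ψ x = 1) :
    ∃ k : ℕ, ∃ C ≥ (0 : ℝ), ∀ u, ContDiff ℝ 2 u → HasCompactSupport u →
      (∀ x ∈ V, TwoConvexAt X u x) → ∀ N : ℝ, 0 < N → ∫ x in V, |u x| ≤ N →
        ∫ x, φ x ^ (k + 2) * calF2 X u x ≤ C * N ^ 2 := by
  obtain ⟨γ, hγ, C₁, hC₁, hgain⟩ :=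
    exists_setIntegral_gain hX.field hφ.compact.isCompact hV hφ.subset hspan
  obtain ⟨B, hB0, hB⟩ := hφ.exists_abs_Xop_le hX.field
  obtain ⟨q, hq⟩ := exists_nat_ge (2 / γ)
  have hqγ : 2 ≤ q * γ := (div_le_iff₀ hγ).1 hq
  have hq0 : q ≠ 0 := by
    rintro rfl
    norm_num at hqγ
  have h2q : 2 * q ≠ 0 := by simpa using hq0
  obtain ⟨C₂, hC₂, hx⟩ := hX.exists_xNorm_le hφ hB hB0 h2q
  obtain ⟨C₃, hC₃, hF⟩ := hX.exists_integral_calF2_le hφ hB hB0 h2q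
  obtain ⟨L, hL⟩ : ∃ L, ∀ x, ‖subLap X ψ x‖ ≤ L :=
    (hX.continuous_subLap (hψ.contDiff.of_le (natCast_le_smooth 2))).bounded_above_of_compact_support
      (HasCompactSupport.intro hψ.compact fun x hx => subLap_eq_zero_of_notMem_tsupport hx)
  have hL0 : 0 ≤ L := (norm_nonneg _).trans (hL 0)
  have hD : 0 ≤ C₁ * C₂ := mul_nonneg hC₁ hC₂
  refine ⟨2 * q, C₃ * (2 * (((8 * (C₁ * C₂) + 1) ^ (1 / γ)) ^ 2 * volume.real (tsupport φ))
    * (6 * L + 1) ^ 2), by positivity, fun u hu huc hconv N hN hNu => ?_⟩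
  have hJ := integral_pow_mul_le hφ.contDiff.continuous hφ.compact hφ.nonneg hφ.le_one
    (hX.contDiff_gradSq hu).continuous gradSq_nonneg hq0 hγ hD
    (show 0 < (6 * L + 1) * N by positivity) hqγ (fun A hA a ha hvol => ?_) fun s hs => ?_
  · refine (hF u hu huc hconv).trans ?_
    refine (mul_le_mul_of_nonneg_left hJ hC₃).trans (le_of_eq ?_)
    ring
  · have hg := hgain (fun x => φ x ^ (2 * q + 1) * gradSq X u x)
      ((hφ.contDiff_one.pow _).mul (hX.contDiff_gradSq hu))
      (closure_mono fun x hx => by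
        simp only [Function.mem_support] at hx ⊢
        exact fun h => hx (by rw [h, zero_pow (Nat.succ_ne_zero _), zero_mul])) A hA a ha hvol
    have e : ∀ x, |φ x ^ (2 * q + 1) * gradSq X u x| = φ x ^ (2 * q + 1) * gradSq X u x :=
      fun x => abs_of_nonneg (mul_nonneg (pow_nonneg (hφ.nonneg x) _) (gradSq_nonneg x))
    simp only [e] at hg
    refine hg.trans ?_
    have ha' : 0 ≤ C₁ * a ^ γ := mul_nonneg hC₁ (Real.rpow_nonneg ha.le _)
    refine (mul_le_mul_of_nonneg_left (hx u hu huc hconv) ha').trans (le_of_eq ?_)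
    ring
  · refine (measure_mono fun x hx => ?_).trans
      (hX.volume_lt_gradSq_le hψ hL hu huc hconv hNu hs)
    exact ⟨hφψ x (subset_tsupport φ hx.1.ne'), hx.2⟩

end FlatSystem

end Closing

section Localization

variable {n m : ℕ} {b X : Fin m → (Fin n → ℝ) → (Fin n → ℝ)} {V Ω : Set (Fin n → ℝ)}
  {c c' d d' : (Fin n → ℝ) → (Fin n → ℝ)} {u v χ : (Fin n → ℝ) → ℝ}

open scoped Manifold in
lemma exists_isCutoff {K : Set (Fin n → ℝ)} (hK : IsCompact K) (hV : IsOpen V) (hKV : K ⊆ V) :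
    ∃ φ, IsCutoff V φ ∧ ∀ᶠ x in 𝓝ˢ K, φ x = 1 := by
  obtain ⟨L, hL, hKL, hLV⟩ := exists_compact_between hK hV hKV
  obtain ⟨f, h1, h0, hf⟩ := exists_contMDiffMap_one_nhds_of_subset_interior (n := (⊤ : ℕ∞))
    𝓘(ℝ, Fin n → ℝ) hK.isClosed hKL
  have hs : tsupport f ⊆ L := closure_minimal
    (fun x hx => by_contra fun hxL => hx (h0 x hxL)) hL.isClosed
  exact ⟨f, ⟨f.contMDiff.contDiff, hL.of_isClosed_subset (isClosed_tsupport _) hs,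
    hs.trans hLV, fun x => (hf x).1, fun x => (hf x).2⟩, h1⟩

lemma IsCutoff.contDiff_smul {F : Type*} [NormedAddCommGroup F] [NormedSpace ℝ F]
    (hχ : IsCutoff Ω χ) (hΩ : IsOpen Ω) {k : WithTop ℕ∞} (hk : k ≤ ((⊤ : ℕ∞) : WithTop ℕ∞))
    {f : (Fin n → ℝ) → F} (hf : ContDiffOn ℝ k f Ω) : ContDiff ℝ k fun x => χ x • f x := by
  refine contDiff_iff_contDiffAt.2 fun x => ?_
  by_cases hx : x ∈ tsupport χ
  · have hxΩ : x ∈ Ω := hχ.subset hx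
    exact (hχ.contDiff.of_le hk).contDiffAt.smul (hf.contDiffAt (hΩ.mem_nhds hxΩ))
  · refine (contDiffAt_const (c := (0 : F))).congr_of_eventuallyEq ?_
    filter_upwards [notMem_tsupport_iff_eventuallyEq.1 hx] with y hy
    simp only [hy, Pi.zero_apply, zero_smul]

lemma Xop_eqOn (hV : IsOpen V) (hc : Set.EqOn c c' V) (hu : Set.EqOn u v V) :
    Set.EqOn (Xop c u) (Xop c' v) V := fun x hx => by
  rw [Xop, Xop, hc hx, (hu.eventuallyEq_of_mem (hV.mem_nhds hx)).fderiv_eq]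

lemma vfBracket_eqOn (hV : IsOpen V) (hc : Set.EqOn c c' V) (hd : Set.EqOn d d' V) :
    Set.EqOn (vfBracket c d) (vfBracket c' d') V := fun x hx => by
  have key : ∀ {e e' : (Fin n → ℝ) → (Fin n → ℝ)}, Set.EqOn e e' V → ∀ l,
      fderiv ℝ (fun y => e y l) x = fderiv ℝ (fun y => e' y l) x := fun he l =>
    Filter.EventuallyEq.fderiv_eq <| by
      filter_upwards [hV.mem_nhds hx] with y hy
      rw [he hy]
  ext l
  simp only [vfBracket, key hc, key hd, hc hx, hd hx]

lemma LieGen.exists_eqOn (hV : IsOpen V) (hbX : ∀ i, Set.EqOn (b i) (X i) V) (hc : LieGen b c) :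
    ∃ c', LieGen X c' ∧ Set.EqOn c c' V := by
  induction hc with
  | base i => exact ⟨X i, .base i, hbX i⟩
  | bracket _ _ ih₁ ih₂ =>
    obtain ⟨c', hc', ec⟩ := ih₁
    obtain ⟨d', hd', ed⟩ := ih₂
    exact ⟨_, hc'.bracket hd', vfBracket_eqOn hV ec ed⟩

lemma commOp_eq_of_eqOn (hV : IsOpen V) (hbX : ∀ i, Set.EqOn (b i) (X i) V)
    (huv : Set.EqOn u v V) {x : Fin n → ℝ} (hx : x ∈ V) (i j : Fin m) :
    commOp b i j u x = commOp X i j v x := by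
  have h := fun i j => Xop_eqOn hV (hbX i) (Xop_eqOn hV (hbX j) huv) hx
  rw [commOp, commOp, h, h]

lemma symmHess_eq_of_eqOn (hV : IsOpen V) (hbX : ∀ i, Set.EqOn (b i) (X i) V)
    (huv : Set.EqOn u v V) {x : Fin n → ℝ} (hx : x ∈ V) : symmHess b u x = symmHess X v x := by
  have h := fun i j => Xop_eqOn hV (hbX i) (Xop_eqOn hV (hbX j) huv) hx
  ext i j
  rw [symmHess, symmHess, h, h]

lemma subLap_eq_of_eqOn (hV : IsOpen V) (hbX : ∀ i, Set.EqOn (b i) (X i) V)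
    (huv : Set.EqOn u v V) {x : Fin n → ℝ} (hx : x ∈ V) : subLap b u x = subLap X v x :=
  Finset.sum_congr rfl fun i _ => Xop_eqOn hV (hbX i) (Xop_eqOn hV (hbX i) huv) hx

lemma calF2_eq_of_eqOn (hV : IsOpen V) (hbX : ∀ i, Set.EqOn (b i) (X i) V)
    (huv : Set.EqOn u v V) {x : Fin n → ℝ} (hx : x ∈ V) : calF2 b u x = calF2 X v x := by
  have h1 := two_mul_F2fun (b := b) (u := u) (x := x)
  have h2 := two_mul_F2fun (b := X) (u := v) (x := x)
  rw [symmHess_eq_of_eqOn hV hbX huv hx, subLap_eq_of_eqOn hV hbX huv hx, ← h2] at h1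
  have h3 : F2fun b u x = F2fun X v x := by linarith
  rw [calF2, calF2, h3, E2fun, E2fun]
  simp only [commOp_eq_of_eqOn hV hbX huv hx]

lemma TwoConvexAt.congr (hV : IsOpen V) (hbX : ∀ i, Set.EqOn (b i) (X i) V)
    (huv : Set.EqOn u v V) {x : Fin n → ℝ} (hx : x ∈ V) (h : TwoConvexAt b u x) :
    TwoConvexAt X v x where
  subLap_nonneg := by
    rw [← subLap_eq_of_eqOn hV hbX huv hx]
    exact h.subLap_nonneg
  sum_sq_le := by
    rw [← subLap_eq_of_eqOn hV hbX huv hx, ← symmHess_eq_of_eqOn hV hbX huv hx]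
    exact h.sum_sq_le

lemma FlatSystem.of_eqOn (hX : ∀ i, TestField (X i)) (hV : IsOpen V) (hVΩ : V ⊆ Ω)
    (hbX : ∀ i, Set.EqOn (b i) (X i) V) (hdiv : DivFree Ω b) (hcomm : SecondCommVanish Ω b) :
    FlatSystem X V where
  field := hX
  div := fun i x hx => by
    rw [← hdiv i x (hVΩ hx)]
    refine Finset.sum_congr rfl fun j _ => ?_
    rw [Filter.EventuallyEq.fderiv_eq (show (fun y => X i y j) =ᶠ[𝓝 x] fun y => b i y j by
      filter_upwards [hV.mem_nhds hx] with y hy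
      rw [hbX i hy])]
  comm := fun i j x hx => by
    rw [← hcomm i j x (hVΩ hx)]
    exact (vfBracket_eqOn hV (hbX i) (vfBracket_eqOn hV (hbX i) (hbX j)) hx).symm

lemma Hormander.span_eq_top (h : Hormander Ω b) (hV : IsOpen V) (hVΩ : V ⊆ Ω)
    (hbX : ∀ i, Set.EqOn (b i) (X i) V) {x : Fin n → ℝ} (hx : x ∈ V) :
    Submodule.span ℝ {v : Fin n → ℝ | ∃ c, LieGen X c ∧ c x = v} = ⊤ := by
  rw [eq_top_iff, ← h x (hVΩ hx)]
  refine Submodule.span_mono ?_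
  rintro v ⟨c, hc, rfl⟩
  obtain ⟨c', hc', e⟩ := hc.exists_eqOn hV hbX
  exact ⟨c', hc', (e hx).symm⟩

end Localization

/-- Lemma 4.1. Local bound `∫_{Ω'} 𝓕₂[u] ≤ C (∫_Ω |u|)²` for
2-convex `u`; in particular a local `L²` bound for the commutators. -/
theorem calF2_local_bound (n m : ℕ) (Ω : Set (Fin n → ℝ))
    (hΩo : IsOpen Ω) (hΩb : Bornology.IsBounded Ω)
    (b : Fin m → (Fin n → ℝ) → (Fin n → ℝ))
    (hb : ∀ i, ContDiffOn ℝ (⊤ : ℕ∞) (b i) (closure Ω))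
    (hcond1 : DivFree Ω b) (hcond2 : Hormander Ω b) (hcond3 : SecondCommVanish Ω b) :
    ∀ Ω' : Set (Fin n → ℝ), CptIn Ω' Ω →
      ∃ C > (0 : ℝ), ∀ u : (Fin n → ℝ) → ℝ,
        ContDiffOn ℝ 2 u Ω → MeasureTheory.IntegrableOn u Ω → IsKConvex Ω b 2 u →
        (∫ x in Ω', calF2 b u x) ≤ C * (∫ x in Ω, |u x|) ^ 2 ∧
        (∫ x in Ω', E2fun b u x) ≤ C * (∫ x in Ω, |u x|) ^ 2 := by
  rintro Ω' ⟨hΩ'o, hK, hKΩ⟩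
  obtain ⟨χ, hχ, hχ1⟩ := exists_isCutoff hK hΩo hKΩ
  obtain ⟨V, hV, hKV, hV1⟩ := mem_nhdsSet_iff_exists.1 hχ1
  have hχV : ∀ x ∈ V, χ x = 1 := fun x hx => hV1 hx
  have hVΩ : V ⊆ Ω := fun x hx =>
    hχ.subset (subset_tsupport χ (by simp [Function.mem_support, hχV x hx]))
  set X : Fin m → (Fin n → ℝ) → (Fin n → ℝ) := fun i x => χ x • b i x with hXdef
  have hbX : ∀ i, Set.EqOn (b i) (X i) V := fun i x hx => by simp [hXdef, hχV x hx]
  have hXt : ∀ i, TestField (X i) := fun i =>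
    ⟨hχ.contDiff_smul hΩo le_rfl ((hb i).mono subset_closure), hχ.compact.smul_right⟩
  have hX : FlatSystem X V := .of_eqOn hXt hV hVΩ hbX hcond1 hcond3
  obtain ⟨φ, hφ, hφ1⟩ := exists_isCutoff hK hV hKV
  obtain ⟨ψ, hψ, hψ1⟩ := exists_isCutoff hφ.compact.isCompact hV hφ.subset
  obtain ⟨k, C, hC, hmain⟩ := hX.exists_integral_pow_mul_calF2_le hV
    (fun x hx => hcond2.span_eq_top hV hVΩ hbX hx) hφ hψ fun x hx => hψ1.self_of_nhdsSet x hx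
  refine ⟨4 / 3 * C + 1, by positivity, fun u hu hui hconv => ?_⟩
  set v : (Fin n → ℝ) → ℝ := fun x => χ x • u x with hvdef
  have hv : ContDiff ℝ 2 v := hχ.contDiff_smul hΩo (natCast_le_smooth 2) hu
  have hvc : HasCompactSupport v := hχ.compact.smul_right
  have huv : Set.EqOn u v V := fun x hx => by simp [hvdef, hχV x hx]
  have hconvu : ∀ x ∈ V, TwoConvexAt b u x := fun x hx => hconv.twoConvexAt (hVΩ hx)
  have hconvv : ∀ x ∈ V, TwoConvexAt X v x := fun x hx => (hconvu x hx).congr hV hbX huv hx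
  have hΩ'V : Ω' ⊆ V := subset_closure.trans hKV
  have hN : ∫ x in V, |v x| ≤ ∫ x in Ω, |u x| := by
    rw [setIntegral_congr_fun hV.measurableSet (g := fun x => |u x|)
      fun x hx => congrArg abs (huv hx).symm]
    exact setIntegral_mono_set hui.abs (Eventually.of_forall fun _ => abs_nonneg _)
      hVΩ.eventuallyLE
  have h_int := hX.integrable_pow_mul_calF2 hφ (Nat.succ_ne_zero (k + 1)) hv
  have hEq : Set.EqOn (fun x => φ x ^ (k + 2) * calF2 X v x) (calF2 b u) Ω' := fun x hx => by
    have h1 : φ x = 1 := hφ1.self_of_nhdsSet x (subset_closure hx)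
    simp only [h1, one_pow, one_mul, calF2_eq_of_eqOn hV hbX huv (hΩ'V hx)]
  have hle : ∫ x in Ω', calF2 b u x ≤ ∫ x, φ x ^ (k + 2) * calF2 X v x := by
    rw [← setIntegral_congr_fun hΩ'o.measurableSet hEq]
    refine setIntegral_le_integral h_int (Eventually.of_forall fun x => ?_)
    by_cases hx : x ∈ V
    · exact mul_nonneg (pow_nonneg (hφ.nonneg x) _) (hconvv x hx).calF2_nonneg
    · simp [hφ.eq_zero hx]
  have hbound : ∫ x in Ω', calF2 b u x ≤ C * (∫ x in Ω, |u x|) ^ 2 := by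
    set a := ∫ x in Ω, |u x|
    have ha : 0 ≤ a := integral_nonneg fun _ => abs_nonneg _
    have ht : Tendsto (fun N : ℝ => C * N ^ 2) (𝓝[>] a) (𝓝 (C * a ^ 2)) :=
      ((continuous_const.mul (continuous_pow 2)).tendsto a).mono_left nhdsWithin_le_nhds
    refine ge_of_tendsto ht ?_
    filter_upwards [self_mem_nhdsWithin] with N hNa
    exact hle.trans (hmain v hv hvc hconvv N (ha.trans_lt hNa) (hN.trans (le_of_lt hNa)))
  have hintu : IntegrableOn (calF2 b u) Ω' :=
    (integrableOn_congr_fun hEq hΩ'o.measurableSet).1 h_int.integrableOn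
  have hE : ∫ x in Ω', E2fun b u x ≤ 4 / 3 * ∫ x in Ω', calF2 b u x := by
    rw [← integral_const_mul]
    refine integral_mono_of_nonneg (Eventually.of_forall fun x => E2fun_nonneg)
      (hintu.const_mul _) ?_
    filter_upwards [ae_restrict_mem hΩ'o.measurableSet] with x hx
    exact (hconvu x (hΩ'V hx)).E2fun_le
  have hCa : 0 ≤ C * (∫ x in Ω, |u x|) ^ 2 := by positivity
  constructor <;> nlinarith [sq_nonneg (∫ x in Ω, |u x|)]
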